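/- arXiv:2106.09673 — 2 statements merged into one kernel-verified Lean document; each statement's English description precedes it below -/
import Mathlib

section
/- Let Γ be a countably infinite group and let F ⊂ Γ be a finite symmetric set with 1 ∉ F. Fix integers ℓ ≥ |F| + 1, m ≥ 1, and let π : Col(F, ℓ) → m^Γ be a continuous Γ-equivariant map. Then there exists a subshift Z ⊆ Col(F, ℓ) such that: (1) for all z ∈ Z, Stab(π(z)) = Stab(π); and (2) every free Borel action of Γ on a Polish space X admits a Borel Γ-equivariant map X → Z. -/
open scoped Pointwise
section ShiftDefs

variable {Γ : Type} [Group Γ] {A B : Type*}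

/-- The Bernoulli shift action of `Γ`: `(γ · x)(δ) = x(δγ)`. -/
def shiftAct (γ : Γ) (x : Γ → A) : Γ → A := fun δ => x (δ * γ)

/-- The free part of the shift `Γ ↷ (Γ → A)`. -/
def freePart (Γ : Type) [Group Γ] (A : Type*) : Set (Γ → A) :=
  {x | ∀ γ : Γ, shiftAct γ x = x → γ = 1}

/-- A subshift: a closed shift-invariant subset. -/
def IsSubshift [TopologicalSpace A] (S : Set (Γ → A)) : Prop :=
  IsClosed S ∧ ∀ γ : Γ, ∀ x ∈ S, shiftAct γ x ∈ S

/-- A subshift of finite type: `⋂ γ (γ · C)` for some clopen `C`. -/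
def IsSFT [TopologicalSpace A] (S : Set (Γ → A)) : Prop :=
  ∃ C : Set (Γ → A), IsClopen C ∧ S = ⋂ γ : Γ, shiftAct γ ⁻¹' C

/-- The stabilizer of a point under the shift action. -/
def ptStab (x : Γ → A) : Set Γ := {γ | shiftAct γ x = x}

/-- `Stab(π)`: elements fixing every point in the image of `π` (domain `dom`). -/
def mapStab (π : (Γ → A) → (Γ → B)) (dom : Set (Γ → A)) : Set Γ :=
  {γ | ∀ x ∈ dom, shiftAct γ (π x) = π x}

/-- `Γ`-equivariance of `π` on the set `dom`. -/
def EquivariantOn (π : (Γ → A) → (Γ → B)) (dom : Set (Γ → A)) : Prop :=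
  ∀ x ∈ dom, ∀ γ : Γ, π (shiftAct γ x) = shiftAct γ (π x)

/-- `Col(F, ℓ)`: proper `ℓ`-colorings of the Cayley graph `G(Γ, F)`. -/
def properCol (F : Finset Γ) (ℓ : ℕ) : Set (Γ → Fin ℓ) :=
  {x | ∀ γ : Γ, ∀ σ ∈ F, x γ ≠ x (σ * γ)}

end ShiftDefs

/-- An element of a group is *of finite class* if its centralizer has finite index. -/
def FiniteClass {Γ : Type} [Group Γ] (g : Γ) : Prop :=
  (Subgroup.centralizer {g} : Subgroup Γ).FiniteIndex

section GroupLemmas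

variable {Γ : Type} [Group Γ]

lemma not_finiteClass_conj {g : Γ} (hg : ¬ FiniteClass g) (u : Γ) :
    ¬ FiniteClass (u * g * u⁻¹) := by
  intro h
  apply hg
  have hle : (Subgroup.centralizer {u * g * u⁻¹}).map (MulAut.conj u⁻¹).toMonoidHom ≤
      Subgroup.centralizer {g} := by
    rintro _ ⟨x, hx, rfl⟩
    simp only [SetLike.mem_coe, Subgroup.mem_centralizer_singleton_iff] at hx ⊢
    simp only [MulEquiv.toMonoidHom_eq_coe, MonoidHom.coe_coe, MulAut.conj_apply, inv_inv]
    have : u⁻¹ * (x * (u * g * u⁻¹)) * u = u⁻¹ * (u * g * u⁻¹ * x) * u := by rw [hx]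
    simpa [mul_assoc] using this
  have hfi : ((Subgroup.centralizer {u * g * u⁻¹}).map
      (MulAut.conj u⁻¹).toMonoidHom).FiniteIndex := by
    rw [FiniteClass] at h
    constructor
    have := Subgroup.index_map_equiv (Subgroup.centralizer {u * g * u⁻¹}) (MulAut.conj u⁻¹)
    rw [show ((Subgroup.centralizer {u * g * u⁻¹}).map
      (MulAut.conj u⁻¹).toMonoidHom) = (Subgroup.centralizer {u * g * u⁻¹}).map
      ((MulAut.conj u⁻¹ : Γ ≃* Γ) : Γ →* Γ) from rfl, this]
    exact h.index_ne_zero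
  exact Subgroup.finiteIndex_of_le hle

lemma FiniteClass.finite_conj {g : Γ} (hg : FiniteClass g) :
    {x : Γ | ∃ u : Γ, x = u * g * u⁻¹}.Finite := by
  have : {x : Γ | ∃ u : Γ, x = u * g * u⁻¹} = MulAction.orbit (ConjAct Γ) g := by
    ext x
    constructor
    · rintro ⟨u, rfl⟩
      exact ⟨ConjAct.toConjAct u, by simp [ConjAct.smul_def]⟩
    · rintro ⟨u, rfl⟩
      exact ⟨ConjAct.ofConjAct u, by simp [ConjAct.smul_def]⟩
  rw [this]
  have hfi : (MulAction.stabilizer (ConjAct Γ) g).FiniteIndex := by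
    rw [ConjAct.stabilizer_eq_centralizer]
    exact hg
  have : Finite (ConjAct Γ ⧸ MulAction.stabilizer (ConjAct Γ) g) :=
    Subgroup.finite_quotient_of_finiteIndex
  exact Set.finite_coe_iff.mp
    (Finite.of_equiv _ (MulAction.orbitEquivQuotientStabilizer (ConjAct Γ) g).symm)

lemma FiniteClass.exists_commute [Infinite Γ] {g : Γ} (hg : FiniteClass g) (S : Finset Γ) :
    ∃ v, v ∉ S ∧ v * g = g * v := by
  have hinf : Infinite (Subgroup.centralizer {g} : Subgroup Γ) := by
    by_contra h
    rw [not_infinite_iff_finite] at h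
    have := hg
    rw [FiniteClass] at this
    have : Finite (Γ ⧸ (Subgroup.centralizer {g} : Subgroup Γ)) :=
      Subgroup.finite_quotient_of_finiteIndex
    have : Finite Γ := Finite.of_equiv _
      (Subgroup.groupEquivQuotientProdSubgroup (s := Subgroup.centralizer {g})).symm
    exact not_finite Γ
  have : ((Subgroup.centralizer {g} : Subgroup Γ) : Set Γ).Infinite := Set.infinite_coe_iff.mp hinf
  obtain ⟨v, hv, hvS⟩ := this.exists_notMem_finset S
  exact ⟨v, hvS, Subgroup.mem_centralizer_singleton_iff.mp hv⟩

/-- A consequence of B. H. Neumann's covering lemma. -/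
lemma exists_conj_ne [Infinite Γ] (G E S : Finset Γ) (hG : ∀ g ∈ G, ¬ FiniteClass g) :
    ∃ h, h ∉ S ∧ ∀ g ∈ G, ∀ e ∈ E, h * g * h⁻¹ ≠ e := by
  classical
  by_contra hcon
  push Not at hcon
  let s : Finset (Γ ⊕ Γ × Γ) := S.disjSum (G ×ˢ E)
  let H : Γ ⊕ Γ × Γ → Subgroup Γ := Sum.elim (fun _ => ⊥) (fun p => Subgroup.centralizer {p.1})
  let rep : Γ ⊕ Γ × Γ → Γ := Sum.elim id
    (fun p => if h : ∃ u, u * p.1 * u⁻¹ = p.2 then h.choose else 1)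
  have hcov : ⋃ i ∈ s, rep i • (H i : Set Γ) = Set.univ := by
    rw [Set.eq_univ_iff_forall]
    intro h
    rw [Set.mem_iUnion₂]
    by_cases hS : h ∈ S
    · exact ⟨Sum.inl h, by simp [s, hS], by simp [rep, H]⟩
    · obtain ⟨g, hg, e, he, hge⟩ := hcon h hS
      refine ⟨Sum.inr (g, e), by simp [s, hg, he], ?_⟩
      have hex : ∃ u, u * g * u⁻¹ = e := ⟨h, hge⟩
      have hspec := hex.choose_spec
      rw [mem_leftCoset_iff]
      simp only [rep, H, Sum.elim_inr, dif_pos hex, SetLike.mem_coe,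
        Subgroup.mem_centralizer_singleton_iff]
      set u := hex.choose
      have : u * g * u⁻¹ = h * g * h⁻¹ := hspec.trans hge.symm
      have h2 : u⁻¹ * (u * g * u⁻¹) * h = u⁻¹ * (h * g * h⁻¹) * h := by rw [this]
      simp only [mul_assoc, inv_mul_cancel_left, inv_mul_cancel, mul_one] at h2 ⊢
      exact h2.symm
  obtain ⟨k, hk, hfin⟩ := Subgroup.exists_finiteIndex_of_leftCoset_cover hcov
  rcases k with k | ⟨g, e⟩
  · have hbot : (⊥ : Subgroup Γ).FiniteIndex := hfin
    have : Finite (Γ ⧸ (⊥ : Subgroup Γ)) := Subgroup.finite_quotient_of_finiteIndex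
    have : Finite Γ := Finite.of_equiv _ (QuotientGroup.quotientBot (G := Γ)).toEquiv
    exact not_finite Γ
  · simp only [s, Finset.inr_mem_disjSum, Finset.mem_product] at hk
    exact hG g hk.1 hfin

/-- A sequence that is far apart and moves the elements of infinite class generically. -/
lemma exists_generic_seq [Infinite Γ] (S E : Finset Γ) :
    ∃ h : ℕ → Γ, (∀ i j, i ≠ j → ∀ σ ∈ S, h j ≠ σ * h i) ∧
      ∀ i j g, ¬ FiniteClass g → h i * g * (h i)⁻¹ ∈ E → h j * g * (h j)⁻¹ ∈ E → i = j := by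
  classical
  have key : ∀ l : List Γ, ∃ x : Γ, ∀ y ∈ l, (∀ σ ∈ S, x ≠ σ * y ∧ y ≠ σ * x) ∧
      ∀ e ∈ E, ¬ FiniteClass e → x * (y⁻¹ * e * y) * x⁻¹ ∉ E := by
    intro l
    obtain ⟨x, hx, hx2⟩ := exists_conj_ne
      (((l.toFinset ×ˢ E).image fun p => p.1⁻¹ * p.2 * p.1).filter fun g => ¬ FiniteClass g) E
      ((S ×ˢ l.toFinset).image (fun p => p.1 * p.2) ∪
        (S ×ˢ l.toFinset).image (fun p => p.1⁻¹ * p.2)) (by simp)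
    refine ⟨x, fun y hy => ⟨fun σ hσ => ⟨?_, ?_⟩, fun e he hfe hmem => ?_⟩⟩
    · rintro rfl
      exact hx (Finset.mem_union_left _ (Finset.mem_image.mpr ⟨(σ, y), by simp [hσ, hy], rfl⟩))
    · rintro rfl
      exact hx (Finset.mem_union_right _
        (Finset.mem_image.mpr ⟨(σ, σ * x), by simp [hσ, hy], by simp⟩))
    · refine hx2 (y⁻¹ * e * y) ?_ _ hmem rfl
      simp only [Finset.mem_filter, Finset.mem_image, Finset.mem_product, List.mem_toFinset]
      refine ⟨⟨(y, e), ⟨hy, he⟩, rfl⟩, ?_⟩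
      simpa using not_finiteClass_conj hfe y⁻¹
  choose nxt hnxt using key
  let L : ℕ → List Γ := fun n => Nat.rec [] (fun _ l => nxt l :: l) n
  have hL : ∀ i j, i < j → nxt (L i) ∈ L j := by
    intro i j hij
    induction j with
    | zero => omega
    | succ j ih =>
      change nxt (L i) ∈ nxt (L j) :: L j
      rcases Nat.lt_succ_iff_lt_or_eq.mp hij with h | rfl
      · exact List.mem_cons_of_mem _ (ih h)
      · exact List.mem_cons_self
  refine ⟨fun n => nxt (L n), ?_, ?_⟩
  · intro i j hij σ hσ
    rcases lt_or_gt_of_ne hij with h | h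
    · exact (((hnxt (L j)) _ (hL i j h)).1 σ hσ).1
    · exact (((hnxt (L i)) _ (hL j i h)).1 σ hσ).2
  · have main : ∀ i j g, i < j → ¬ FiniteClass g → nxt (L i) * g * (nxt (L i))⁻¹ ∈ E →
        nxt (L j) * g * (nxt (L j))⁻¹ ∈ E → False := by
      intro i j g hij hg hi hj
      refine ((hnxt (L j)) _ (hL i j hij)).2 _ hi (not_finiteClass_conj hg _) ?_
      simpa [mul_assoc] using hj
    intro i j g hg hi hj
    rcases lt_trichotomy i j with h | h | h
    · exact (main i j g h hg hi hj).elim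
    · exact h
    · exact (main j i g h hg hj hi).elim

end GroupLemmas

section Counting

variable {ι α : Type*} [Fintype ι] [DecidableEq ι]

/-- If the value of each bit in `I` is determined by the bits of smaller rank, then there are few
bit strings. -/
lemma card_determined_bits_mul_le (rk : ι → ℕ) (I : Finset ι) (u : ι → Bool → α)
    (hu : ∀ i, Function.Injective (u i)) (v : ι → (ι → Bool) → α)
    (hv : ∀ i ∈ I, ∀ b b', (∀ j, rk j < rk i → b j = b' j) → v i b = v i b')
    (B : Finset (ι → Bool)) (hB : ∀ b ∈ B, ∀ i ∈ I, u i (b i) = v i b) :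
    B.card * 2 ^ I.card ≤ 2 ^ Fintype.card ι := by
  classical
  have h1 : (B ×ˢ (Finset.univ : Finset (I → Bool))).card = B.card * 2 ^ I.card := by
    simp [Finset.card_product]
  have h2 : (Finset.univ : Finset (ι → Bool)).card = 2 ^ Fintype.card ι := by simp
  rw [← h1, ← h2]
  refine Finset.card_le_card_of_injOn
    (fun p i => if h : i ∈ I then xor (p.1 i) (p.2 ⟨i, h⟩) else p.1 i) (by simp) ?_
  rintro ⟨b, f⟩ hb ⟨b', f'⟩ hb' heq
  simp only [Finset.coe_product, Set.mem_prod, Finset.mem_coe] at hb hb'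
  simp only at heq
  have key : ∀ n i, rk i = n → b i = b' i := by
    intro n
    induction n using Nat.strong_induction_on with
    | _ n ih =>
      rintro i rfl
      by_cases h : i ∈ I
      · apply hu i
        rw [hB b hb.1 i h, hB b' hb'.1 i h]
        exact hv i h b b' fun j hj => ih (rk j) hj j rfl
      · simpa [h] using congrFun heq i
  have hbb : b = b' := funext fun i => key _ i rfl
  subst hbb
  have : f = f' := by
    funext ⟨i, hi⟩
    simpa [hi] using congrFun heq i
  rw [this]

lemma card_determined_bits_mul_two_pow_le (r : ι → ι → Prop)
    (hr : ∀ i j j', r i j → r i j' → j = j') (hself : ∀ i i', r i i → r i' i' → i = i')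
    (I : Finset ι) (k : ℕ) (hI : 2 * k + 1 ≤ I.card) (u : ι → Bool → α)
    (hu : ∀ i, Function.Injective (u i)) (v : ι → (ι → Bool) → α)
    (hv : ∀ i ∈ I, ∀ b b', (∀ j, r i j → b j = b' j) → v i b = v i b')
    (B : Finset (ι → Bool)) (hB : ∀ b ∈ B, ∀ i ∈ I, u i (b i) = v i b) :
    B.card * 2 ^ k ≤ 2 ^ Fintype.card ι := by
  classical
  let e := Fintype.equivFin ι
  let N := Fintype.card ι
  let I₁ := I.filter fun i => ∀ j, r i j → (e j : ℕ) < e i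
  let I₂ := I.filter fun i => ∀ j, r i j → (e i : ℕ) < e j
  let I₃ := I.filter fun i => r i i
  have hcov : I ⊆ I₁ ∪ I₂ ∪ I₃ := by
    intro i hi
    simp only [I₁, I₂, I₃, Finset.mem_union, Finset.mem_filter, hi, true_and]
    by_cases h : ∃ j, r i j
    · obtain ⟨j, hj⟩ := h
      rcases lt_trichotomy (e j : ℕ) (e i) with h | h | h
      · exact Or.inl (Or.inl fun j' hj' => hr i j j' hj hj' ▸ h)
      · have : j = i := e.injective (Fin.ext h)
        exact Or.inr (this ▸ hj)
      · exact Or.inl (Or.inr fun j' hj' => hr i j j' hj hj' ▸ h)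
    · push Not at h
      exact Or.inl (Or.inl fun j hj => (h j hj).elim)
  have h3 : I₃.card ≤ 1 := by
    rw [Finset.card_le_one]
    intro a ha b hb
    exact hself a b (Finset.mem_filter.mp ha).2 (Finset.mem_filter.mp hb).2
  have hcard : I.card ≤ I₁.card + I₂.card + I₃.card :=
    (Finset.card_le_card hcov).trans ((Finset.card_union_le _ _).trans
      (Nat.add_le_add_right (Finset.card_union_le _ _) _))
  have main : ∀ (rk : ι → ℕ) (J : Finset ι), J ⊆ I → (∀ i ∈ J, ∀ j, r i j → rk j < rk i) →
      k ≤ J.card → B.card * 2 ^ k ≤ 2 ^ Fintype.card ι := by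
    intro rk J hJI hJ hk
    refine le_trans (Nat.mul_le_mul_left _ (Nat.pow_le_pow_right two_pos hk)) ?_
    refine card_determined_bits_mul_le rk J u hu v ?_ B fun b hb i hi => hB b hb i (hJI hi)
    exact fun i hi b b' h => hv i (hJI hi) b b' fun j hj => h j (hJ i hi j hj)
  have hdisj : k ≤ I₁.card ∨ k ≤ I₂.card := by omega
  rcases hdisj with h | h
  · exact main (fun i => e i) I₁ (Finset.filter_subset _ _)
      (fun i hi j hj => (Finset.mem_filter.mp hi).2 j hj) h
  · refine main (fun i => N - e i) I₂ (Finset.filter_subset _ _) (fun i hi j hj => ?_) h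
    have h1 := (Finset.mem_filter.mp hi).2 j hj
    have h2 := (e j).2
    change N - (e j : ℕ) < N - e i
    omega

end Counting

section Patching

variable {Γ : Type} [Group Γ] {F : Finset Γ} {ℓ : ℕ}

/-- A partial coloring that is proper off a finite set can be corrected on that set. -/
lemma exists_properCol_eq_off_finset (hFsym : ∀ σ ∈ F, σ⁻¹ ∈ F) (hF1 : (1 : Γ) ∉ F)
    (hℓ : F.card + 1 ≤ ℓ) (S : Finset Γ) (x : Γ → Fin ℓ)
    (hx : ∀ γ, γ ∉ S → ∀ σ ∈ F, σ * γ ∉ S → x γ ≠ x (σ * γ)) :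
    ∃ x' ∈ properCol F ℓ, ∀ γ, γ ∉ S → x' γ = x γ := by
  classical
  induction S using Finset.induction_on generalizing x with
  | empty => exact ⟨x, fun γ σ hσ => hx γ (by simp) σ hσ (by simp), fun _ _ => rfl⟩
  | insert a S ha ih =>
    obtain ⟨c, hc⟩ : ∃ c : Fin ℓ, c ∉ F.image fun σ => x (σ * a) := by
      by_contra h
      push Not at h
      have h1 : (Finset.univ : Finset (Fin ℓ)) ⊆ F.image fun σ => x (σ * a) := fun c _ => h c
      have h2 := (Finset.card_le_card h1).trans Finset.card_image_le
      rw [Finset.card_univ, Fintype.card_fin] at h2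
      omega
    have hc' : ∀ σ ∈ F, c ≠ x (σ * a) := fun σ hσ h =>
      hc (Finset.mem_image.mpr ⟨σ, hσ, h.symm⟩)
    obtain ⟨x', hx', hoff⟩ := ih (Function.update x a c) (by
      intro γ hγ σ hσ hσγ
      by_cases h1 : γ = a
      · subst h1
        have h2 : σ * γ ≠ γ := fun h => hF1 (by rwa [mul_eq_right.mp h] at hσ)
        rw [Function.update_self, Function.update_of_ne h2]
        exact hc' σ hσ
      · by_cases h2 : σ * γ = a
        · rw [h2, Function.update_self, Function.update_of_ne h1]
          have := hc' σ⁻¹ (hFsym σ hσ)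
          rw [← h2, inv_mul_cancel_left] at this
          exact this.symm
        · rw [Function.update_of_ne h1, Function.update_of_ne h2]
          exact hx γ (by simp [h1, hγ]) σ hσ (by simp [h2, hσγ]))
    refine ⟨x', hx', fun γ hγ => ?_⟩
    rw [Finset.mem_insert, not_or] at hγ
    rw [hoff γ hγ.2, Function.update_of_ne hγ.1]

lemma exists_properCol_patch [DecidableEq Γ] (hFsym : ∀ σ ∈ F, σ⁻¹ ∈ F) (hF1 : (1 : Γ) ∉ F)
    (hℓ : F.card + 1 ≤ ℓ) {x w : Γ → Fin ℓ} (hx : x ∈ properCol F ℓ) (hw : w ∈ properCol F ℓ)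
    (B : Finset Γ) :
    ∃ x' ∈ properCol F ℓ, (∀ γ ∈ B, x' γ = w γ) ∧ ∀ γ, γ ∉ B ∪ F * B → x' γ = x γ := by
  obtain ⟨x', hx', hoff⟩ := exists_properCol_eq_off_finset hFsym hF1 hℓ ((F * B) \ B)
    (fun γ => if γ ∈ B then w γ else x γ) (by
      intro γ hγ σ hσ hσγ
      simp only [Finset.mem_sdiff, not_and, not_not] at hγ hσγ
      by_cases h1 : γ ∈ B
      · have h2 : σ * γ ∈ B := hσγ (Finset.mul_mem_mul hσ h1)
        simp only [h1, h2, if_true]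
        exact hw γ σ hσ
      · have h2 : σ * γ ∉ B := fun h2 => h1 (hγ (by
          have := Finset.mul_mem_mul (hFsym σ hσ) h2
          rwa [inv_mul_cancel_left] at this))
        simp only [h1, h2, if_false]
        exact hx γ σ hσ)
  refine ⟨x', hx', fun γ hγ => ?_, fun γ hγ => ?_⟩
  · rw [hoff γ (by simp [hγ])]
    simp [hγ]
  · simp only [Finset.mem_union, not_or] at hγ
    rw [hoff γ (by simp [hγ.2])]
    simp [hγ.1]

lemma shiftAct_mem_properCol {x : Γ → Fin ℓ} (hx : x ∈ properCol F ℓ) (γ : Γ) :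
    shiftAct γ x ∈ properCol F ℓ := fun δ σ hσ => by
  simp only [shiftAct, mul_assoc]
  exact hx _ σ hσ

/-- Independent patches at separated places. -/
lemma exists_properCol_patches [DecidableEq Γ] (hFsym : ∀ σ ∈ F, σ⁻¹ ∈ F) (hF1 : (1 : Γ) ∉ F)
    (hℓ : F.card + 1 ≤ ℓ) {x : Γ → Fin ℓ} (hx : x ∈ properCol F ℓ)
    {w : Bool → Γ → Fin ℓ} (hw : ∀ b, w b ∈ properCol F ℓ) (K : Finset Γ)
    {ι : Type*} (q : ι → Γ)
    (hq : ∀ i j, ∀ κ ∈ K ∪ F * K, ∀ κ' ∈ K ∪ F * K, ∀ τ, (τ = 1 ∨ τ ∈ F) →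
      κ' * q j = τ * (κ * q i) → i = j) :
    ∃ X : (ι → Bool) → Γ → Fin ℓ, (∀ b, X b ∈ properCol F ℓ) ∧
      (∀ b i, ∀ κ ∈ K, X b (κ * q i) = w (b i) κ) ∧
      (∀ b γ, (∀ i, ∀ κ ∈ K ∪ F * K, γ ≠ κ * q i) → X b γ = x γ) ∧
      (∀ b b' i, ∀ κ ∈ K ∪ F * K, b i = b' i → X b (κ * q i) = X b' (κ * q i)) := by
  classical
  have hsingle : ∀ i b, ∃ x' ∈ properCol F ℓ, (∀ κ ∈ K, x' (κ * q i) = w b κ) ∧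
      ∀ γ, (∀ κ ∈ K ∪ F * K, γ ≠ κ * q i) → x' γ = x γ := by
    intro i b
    obtain ⟨x', hx', h1, h2⟩ := exists_properCol_patch hFsym hF1 hℓ
      (shiftAct_mem_properCol hx (q i)) (hw b) K
    refine ⟨shiftAct (q i)⁻¹ x', shiftAct_mem_properCol hx' _, fun κ hκ => ?_, fun γ hγ => ?_⟩
    · simp [shiftAct, h1 κ hκ]
    · have : γ * (q i)⁻¹ ∉ K ∪ F * K := fun h => hγ _ h (by simp)
      simp [shiftAct, h2 _ this]
  choose ρ hρ hρK hρoff using hsingle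
  let X : (ι → Bool) → Γ → Fin ℓ := fun b γ =>
    if h : ∃ i, ∃ κ ∈ K ∪ F * K, γ = κ * q i then ρ h.choose (b h.choose) γ else x γ
  have huniq : ∀ i j, ∀ κ ∈ K ∪ F * K, ∀ κ' ∈ K ∪ F * K, κ' * q j = κ * q i → i = j :=
    fun i j κ hκ κ' hκ' h => hq i j κ hκ κ' hκ' 1 (Or.inl rfl) (by rw [h, one_mul])
  have hin : ∀ b i, ∀ κ ∈ K ∪ F * K, X b (κ * q i) = ρ i (b i) (κ * q i) := by
    intro b i κ hκ
    have h : ∃ j, ∃ κ' ∈ K ∪ F * K, κ * q i = κ' * q j := ⟨i, κ, hκ, rfl⟩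
    obtain ⟨κ', hκ', he⟩ := h.choose_spec
    have hj : h.choose = i := huniq _ _ κ' hκ' κ hκ he
    simp only [X, dif_pos h, hj]
  have hout : ∀ b γ, (∀ i, ∀ κ ∈ K ∪ F * K, γ ≠ κ * q i) → X b γ = x γ := by
    intro b γ hγ
    have h : ¬ ∃ i, ∃ κ ∈ K ∪ F * K, γ = κ * q i := by
      rintro ⟨i, κ, hκ, h⟩
      exact hγ i κ hκ h
    simp only [X, dif_neg h]
  refine ⟨X, fun b γ σ hσ => ?_, fun b i κ hκ => ?_, hout, fun b b' i κ hκ hb => ?_⟩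
  · by_cases h1 : ∃ i, ∃ κ ∈ K ∪ F * K, γ = κ * q i
    · obtain ⟨i, κ, hκ, rfl⟩ := h1
      have : X b (σ * (κ * q i)) = ρ i (b i) (σ * (κ * q i)) := by
        by_cases h2 : ∃ j, ∃ κ' ∈ K ∪ F * K, σ * (κ * q i) = κ' * q j
        · obtain ⟨j, κ', hκ', he⟩ := h2
          obtain rfl := hq i j κ hκ κ' hκ' σ (Or.inr hσ) he.symm
          rw [he, hin b i κ' hκ']
        · push Not at h2
          rw [hout b _ h2, hρoff i (b i) _ (h2 i)]
      rw [hin b i κ hκ, this]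
      exact hρ i (b i) _ σ hσ
    · push Not at h1
      rw [hout b γ h1]
      by_cases h2 : ∃ j, ∃ κ' ∈ K ∪ F * K, σ * γ = κ' * q j
      · obtain ⟨j, κ', hκ', he⟩ := h2
        rw [he, hin b j κ' hκ', ← he, ← hρoff j (b j) γ (h1 j)]
        exact hρ j (b j) _ σ hσ
      · push Not at h2
        rw [hout b _ h2]
        exact hx γ σ hσ
  · rw [hin b i κ (Finset.mem_union_left _ hκ), hρK i (b i) κ hκ]
  · rw [hin b i κ hκ, hin b' i κ hκ, hb]

/-- Recoloring near separated places so that many places witness that `P` is not invariant under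
each element of `G`. -/
lemma exists_properCol_witnesses [DecidableEq Γ] (hFsym : ∀ σ ∈ F, σ⁻¹ ∈ F) (hF1 : (1 : Γ) ∉ F)
    (hℓ : F.card + 1 ≤ ℓ) {β : Type*} {P : (Γ → Fin ℓ) → β} {K : Finset Γ}
    (hP : ∀ u v : Γ → Fin ℓ, (∀ κ ∈ K, u κ = v κ) → P u = P v)
    {w : Bool → Γ → Fin ℓ} (hw : ∀ b, w b ∈ properCol F ℓ) (hPw : P (w false) ≠ P (w true))
    {E : Finset Γ} (hE : ∀ κ ∈ K, ∀ κ' ∈ K ∪ F * K, κ⁻¹ * κ' ∈ E)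
    {L k : ℕ} (q : Fin L × Fin (2 * k + 1) → Γ)
    (hq : ∀ i j, ∀ κ ∈ K ∪ F * K, ∀ κ' ∈ K ∪ F * K, ∀ τ, (τ = 1 ∨ τ ∈ F) →
      κ' * q j = τ * (κ * q i) → i = j)
    (hqE : ∀ i j, ∀ e ∈ E, ∀ e' ∈ E, e * q i = e' * q j → i = j)
    (G : Finset Γ) (hG : ∀ g ∈ G, ∀ i i', q i * g * (q i)⁻¹ ∈ E → q i' * g * (q i')⁻¹ ∈ E → i = i')
    (hk : G.card * L < 2 ^ k) {x : Γ → Fin ℓ} (hx : x ∈ properCol F ℓ) :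
    ∃ x' ∈ properCol F ℓ, (∀ γ, (∀ i, ∀ κ ∈ K ∪ F * K, γ ≠ κ * q i) → x' γ = x γ) ∧
      ∀ g ∈ G, ∀ l, ∃ j, P (shiftAct (q (l, j)) x') ≠ P (shiftAct (q (l, j) * g) x') := by
  classical
  obtain ⟨X, hX, hXK, hXoff, hXdep⟩ := exists_properCol_patches hFsym hF1 hℓ hx hw K q hq
  suffices h : ∃ b, ∀ g ∈ G, ∀ l, ∃ j,
      P (shiftAct (q (l, j)) (X b)) ≠ P (shiftAct (q (l, j) * g) (X b)) by
    obtain ⟨b, hb⟩ := h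
    exact ⟨X b, hX b, hXoff b, hb⟩
  by_contra hcon
  push Not at hcon
  let bad : Γ × Fin L → Finset (Fin L × Fin (2 * k + 1) → Bool) := fun p =>
    Finset.univ.filter fun b => ∀ j,
      P (shiftAct (q (p.2, j)) (X b)) = P (shiftAct (q (p.2, j) * p.1) (X b))
  have hcov : (Finset.univ : Finset (Fin L × Fin (2 * k + 1) → Bool)) ⊆
      (G ×ˢ Finset.univ).biUnion bad := by
    intro b _
    obtain ⟨g, hg, l, hl⟩ := hcon b
    exact Finset.mem_biUnion.mpr ⟨(g, l), by simp [hg], by simpa [bad] using hl⟩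
  have hbad : ∀ p ∈ G ×ˢ (Finset.univ : Finset (Fin L)),
      (bad p).card * 2 ^ k ≤ 2 ^ Fintype.card (Fin L × Fin (2 * k + 1)) := by
    rintro ⟨g, l⟩ hp
    have hg : g ∈ G := (Finset.mem_product.mp hp).1
    have hval : ∀ b i, P (shiftAct (q i) (X b)) = P (w (b i)) := fun b i =>
      hP _ _ fun κ hκ => hXK b i κ hκ
    refine card_determined_bits_mul_two_pow_le (fun i j => q i * g * (q j)⁻¹ ∈ E) ?_ (hG g hg)
      (Finset.univ.image fun j => (l, j)) k ?_ (fun _ c => P (w c)) ?_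
      (fun i b => P (shiftAct (q i * g) (X b))) ?_ _ ?_
    · intro i j j' h h'
      by_contra hne
      have h1 : (q i * g * (q j)⁻¹)* q j = (q i * g * (q j')⁻¹) * q j' := by simp
      exact hne (hqE j j' _ h _ h' h1)
    · rw [Finset.card_image_of_injective _ (Prod.mk_right_injective l)]
      simp
    · rintro i (_ | _) (_ | _) h
      · rfl
      · exact (hPw h).elim
      · exact (hPw h.symm).elim
      · rfl
    · intro i _ b b' hb
      refine hP _ _ fun κ hκ => ?_
      simp only [shiftAct]
      by_cases h : ∃ j, ∃ κ' ∈ K ∪ F * K, κ * (q i * g) = κ' * q j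
      · obtain ⟨j, κ', hκ', he⟩ := h
        rw [he]
        refine hXdep b b' j κ' hκ' (hb j ?_)
        have : q i * g * (q j)⁻¹ = κ⁻¹ * κ' := by
          rw [mul_inv_eq_iff_eq_mul, mul_assoc, ← he, inv_mul_cancel_left]
        rw [this]
        exact hE κ hκ κ' hκ'
      · push Not at h
        rw [hXoff b _ h, hXoff b' _ h]
    · intro b hb i hi
      obtain ⟨j, -, rfl⟩ := Finset.mem_image.mp hi
      rw [← hval]
      exact (Finset.mem_filter.mp hb).2 j
  set N := Fintype.card (Fin L × Fin (2 * k + 1)) with hN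
  have h1 : 2 ^ N ≤ ∑ p ∈ G ×ˢ (Finset.univ : Finset (Fin L)), (bad p).card := by
    have := (Finset.card_le_card hcov).trans Finset.card_biUnion_le
    simpa [hN] using this
  have h2 : 2 ^ N * 2 ^ k ≤ (G.card * L) * 2 ^ N := by
    calc 2 ^ N * 2 ^ k ≤ (∑ p ∈ G ×ˢ (Finset.univ : Finset (Fin L)), (bad p).card) * 2 ^ k :=
          Nat.mul_le_mul_right _ h1
      _ = ∑ p ∈ G ×ˢ (Finset.univ : Finset (Fin L)), (bad p).card * 2 ^ k := Finset.sum_mul _ _ _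
      _ ≤ ∑ p ∈ G ×ˢ (Finset.univ : Finset (Fin L)), 2 ^ N := Finset.sum_le_sum hbad
      _ = (G.card * L) * 2 ^ N := by simp [Finset.card_product]
  have h3 : (G.card * L) * 2 ^ N < 2 ^ k * 2 ^ N := Nat.mul_lt_mul_of_pos_right hk (by positivity)
  rw [mul_comm (2 ^ N)] at h2
  omega

end Patching

section BorelCombinatorics

variable {Γ : Type} [Group Γ] {X : Type*} [MeasurableSpace X]

lemma exists_measurable_selection {S : Type*} [Countable S] (p : S → X → Prop)
    (hp : ∀ s, MeasurableSet {x | p s x}) (hex : ∀ x, ∃ s, p s x) :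
    ∃ f : X → S, (∀ s, MeasurableSet {x | f x = s}) ∧ ∀ x, p (f x) x := by
  classical
  rcases isEmpty_or_nonempty X with hX | ⟨⟨x₀⟩⟩
  · exact ⟨fun x => isEmptyElim x, fun s => by simp [Set.eq_empty_of_isEmpty], fun x => isEmptyElim x⟩
  have : Nonempty S := ⟨(hex x₀).choose⟩
  obtain ⟨e, he⟩ := exists_surjective_nat S
  have hex' : ∀ x, ∃ n, p (e n) x := fun x => by
    obtain ⟨s, hs⟩ := hex x
    obtain ⟨n, rfl⟩ := he s
    exact ⟨n, hs⟩
  have hfind : Measurable fun x => Nat.find (hex' x) :=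
    measurable_find hex' fun n => hp (e n)
  refine ⟨fun x => e (Nat.find (hex' x)), fun s => ?_, fun x => Nat.find_spec (hex' x)⟩
  exact hfind (MeasurableSet.of_discrete (s := {n | e n = s}))

variable [MulAction Γ X] [MeasurableConstSMul Γ X]

lemma measurableSet_smul_preimage {s : Set X} (hs : MeasurableSet s) (γ : Γ) :
    MeasurableSet {x | γ • x ∈ s} := measurable_const_smul γ hs

lemma exists_measurable_nat_coloring
    (hfree : ∀ (γ : Γ) (x : X), γ • x = x → γ = 1)
    [MeasurableSpace.CountablySeparated X] (Θ : Finset Γ)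
    (hΘ : (1 : Γ) ∉ Θ) : ∃ κ : X → ℕ, Measurable κ ∧ ∀ x, ∀ θ ∈ Θ, κ (θ • x) ≠ κ x := by
  obtain ⟨f, hf, hinj⟩ := MeasurableSpace.measurable_injection_nat_bool_of_countablySeparated X
  have hfi : ∀ i, Measurable fun x => f x i := fun i => (measurable_pi_apply i).comp hf
  have hfθ : ∀ (θ : Γ) i, Measurable fun x => f (θ • x) i := fun θ i =>
    (hfi i).comp (measurable_const_smul θ)
  obtain ⟨g, hg, hgp⟩ := exists_measurable_selection (X := X) (S := ℕ × Finset ℕ)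
    (fun s x => (∀ θ ∈ Θ, ∃ i < s.1, f x i ≠ f (θ • x) i) ∧ ∀ i < s.1, i ∈ s.2 ↔ f x i = true)
    (by
      rintro ⟨n, s⟩
      have h1 : MeasurableSet (⋂ θ ∈ Θ, ⋃ i : Fin n, {x | f x i = f (θ • x) i}ᶜ) :=
        Finset.measurableSet_biInter _ fun θ _ => MeasurableSet.iUnion fun i =>
          (measurableSet_eq_fun (hfi i) (hfθ θ i)).compl
      have h2 : MeasurableSet (⋂ i : Fin n, {x | (i : ℕ) ∈ s ↔ f x i = true}) :=
        MeasurableSet.iInter fun i =>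
          (hfi i) (MeasurableSet.of_discrete (s := {b | (i : ℕ) ∈ s ↔ b = true}))
      convert h1.inter h2 using 1
      ext x
      simp [Fin.exists_iff, Fin.forall_iff])
    (by
      intro x
      have h1 : ∀ θ ∈ Θ, ∃ i, f x i ≠ f (θ • x) i := by
        intro θ hθ
        by_contra h
        push Not at h
        have h2 : θ = 1 := hfree θ x (hinj (funext h)).symm
        exact hΘ (h2 ▸ hθ)
      choose! i hi using h1
      refine ⟨(Θ.sup i + 1, (Finset.range (Θ.sup i + 1)).filter fun j => f x j = true),
        fun θ hθ => ⟨i θ, Nat.lt_succ_of_le (Finset.le_sup hθ), hi θ hθ⟩, fun j hj => ?_⟩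
      simp only [Finset.mem_filter, Finset.mem_range]
      exact ⟨fun h => h.2, fun h => ⟨hj, h⟩⟩)
  obtain ⟨e, he⟩ := exists_injective_nat (ℕ × Finset ℕ)
  refine ⟨fun x => e (g x), measurable_to_countable' fun n => ?_, fun x θ hθ h => ?_⟩
  · by_cases h : ∃ s, e s = n
    · obtain ⟨s, rfl⟩ := h
      convert hg s using 1
      ext x
      simp [he.eq_iff]
    · convert MeasurableSet.empty
      ext x
      simp only [Set.mem_preimage, Set.mem_singleton_iff, Set.mem_empty_iff_false, iff_false]
      exact fun hx => h ⟨_, hx⟩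
  · have h' : g (θ • x) = g x := he h
    obtain ⟨i, hi, hne⟩ := (hgp x).1 θ hθ
    have h1 := (hgp x).2 i hi
    have h2 := (hgp (θ • x)).2 i (h' ▸ hi)
    rw [h', h1] at h2
    exact hne (Bool.eq_iff_iff.mpr h2)

/-- The greedy algorithm. -/
lemma exists_measurable_greedy_coloring
    (hfree : ∀ (γ : Γ) (x : X), γ • x = x → γ = 1)
    [MeasurableSpace.CountablySeparated X] (Θ : Finset Γ)
    (hΘ : (1 : Γ) ∉ Θ) (hsymm : ∀ θ ∈ Θ, θ⁻¹ ∈ Θ) :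
    ∃ c : X → ℕ, Measurable c ∧ (∀ x, ∀ θ ∈ Θ, c (θ • x) ≠ c x) ∧
      ∀ x, ∀ u < c x, ∃ θ ∈ Θ, c (θ • x) = u := by
  classical
  obtain ⟨κ, hκ, hκne⟩ := exists_measurable_nat_coloring hfree Θ hΘ
  let avail : (X → ℕ) → ℕ → X → Set ℕ := fun c k x => {n | ∀ θ ∈ Θ, κ (θ • x) < k → c (θ • x) ≠ n}
  have hav : ∀ c k x, ∃ n, n ∈ avail c k x := by
    intro c k x
    obtain ⟨n, hn⟩ := Infinite.exists_notMem_finset (Θ.image fun θ => c (θ • x))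
    exact ⟨n, fun θ hθ _ h => hn (Finset.mem_image.mpr ⟨θ, hθ, h⟩)⟩
  let step : (X → ℕ) → ℕ → X → ℕ := fun c k x =>
    if κ x = k then @Nat.find _ (Classical.decPred _) (hav c k x) else c x
  have hstep : ∀ c k, Measurable c → Measurable (step c k) := by
    intro c k hc
    refine Measurable.ite (hκ (measurableSet_singleton k)) ?_ hc
    refine @measurable_find _ _ (fun x n => n ∈ avail c k x) (fun _ => Classical.decPred _)
      (hav c k) fun n => ?_
    have : {x | n ∈ avail c k x} =
        ⋂ θ ∈ Θ, ({x | κ (θ • x) < k}ᶜ ∪ {x | c (θ • x) = n}ᶜ) := by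
      ext x
      simp only [avail, Set.mem_ofPred_eq, Set.mem_iInter, Set.mem_union, Set.mem_compl_iff,
        imp_iff_not_or, ne_eq]
    rw [this]
    refine Finset.measurableSet_biInter _ fun θ _ => MeasurableSet.union ?_ ?_
    · exact ((hκ.comp (measurable_const_smul θ)) (measurableSet_Iio (a := k))).compl
    · exact ((hc.comp (measurable_const_smul θ)) (measurableSet_singleton n)).compl
  let cs : ℕ → X → ℕ := fun k => Nat.rec (fun _ => 0) (fun k c => step c k) k
  have hcs : ∀ k, Measurable (cs k) := by
    intro k
    induction k with
    | zero => exact measurable_const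
    | succ k ih => exact hstep _ _ ih
  have hstable : ∀ x j, κ x < j → cs j x = cs (κ x + 1) x := by
    intro x j hj
    induction j with
    | zero => omega
    | succ j ih =>
      rcases Nat.lt_succ_iff_lt_or_eq.mp hj with h | rfl
      · rw [← ih h]
        change step (cs j) j x = cs j x
        simp only [step, if_neg h.ne]
      · rfl
  let c : X → ℕ := fun x => cs (κ x + 1) x
  have hspec : ∀ x, c x ∈ avail c (κ x) x ∧ ∀ u < c x, u ∉ avail c (κ x) x := by
    intro x
    have hav2 : avail c (κ x) x = avail (cs (κ x)) (κ x) x := by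
      ext n
      simp only [avail, Set.mem_ofPred_eq]
      refine forall₂_congr fun θ _ => forall_congr' fun h => ?_
      rw [hstable _ _ h]
    have hc : c x = step (cs (κ x)) (κ x) x := rfl
    rw [hav2, hc]
    simp only [step, if_true]
    have hav' := hav (cs (κ x)) (κ x) x
    exact ⟨@Nat.find_spec _ (Classical.decPred _) hav',
      fun u hu => @Nat.find_min _ (Classical.decPred _) hav' u hu⟩
  refine ⟨c, ?_, fun x θ hθ => ?_, fun x u hu => ?_⟩
  · refine measurable_to_countable' fun n => ?_
    have : c ⁻¹' {n} = ⋃ k, κ ⁻¹' {k} ∩ cs (k + 1) ⁻¹' {n} := by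
      ext x
      simp only [c, Set.mem_preimage, Set.mem_singleton_iff, Set.mem_iUnion, Set.mem_inter_iff]
      exact ⟨fun h => ⟨_, rfl, h⟩, fun ⟨k, h, h'⟩ => h ▸ h'⟩
    rw [this]
    exact MeasurableSet.iUnion fun k =>
      (hκ (measurableSet_singleton k)).inter (hcs (k + 1) (measurableSet_singleton n))
  · rcases lt_or_gt_of_ne (hκne x θ hθ) with h | h
    · exact (hspec x).1 θ hθ h
    · have := (hspec (θ • x)).1 θ⁻¹ (hsymm θ hθ)
      rw [inv_smul_smul] at this
      exact (this h).symm
  · have := (hspec x).2 u hu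
    simp only [avail, Set.mem_ofPred_eq, not_forall, not_not] at this
    obtain ⟨θ, hθ, -, h⟩ := this
    exact ⟨θ, hθ, h⟩

lemma exists_measurable_fin_coloring
    (hfree : ∀ (γ : Γ) (x : X), γ • x = x → γ = 1)
    [MeasurableSpace.CountablySeparated X] (Θ : Finset Γ)
    (hΘ : (1 : Γ) ∉ Θ) (hsymm : ∀ θ ∈ Θ, θ⁻¹ ∈ Θ) {n : ℕ} (hn : Θ.card + 1 ≤ n) :
    ∃ c : X → Fin n, Measurable c ∧ ∀ x, ∀ θ ∈ Θ, c x ≠ c (θ • x) := by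
  classical
  obtain ⟨c, hc, hne, hlt⟩ := exists_measurable_greedy_coloring hfree Θ hΘ hsymm
  have hle : ∀ x, c x < n := by
    intro x
    have : Finset.range (c x) ⊆ Θ.image fun θ => c (θ • x) := by
      intro u hu
      obtain ⟨θ, hθ, h⟩ := hlt x u (Finset.mem_range.mp hu)
      exact Finset.mem_image.mpr ⟨θ, hθ, h⟩
    have := (Finset.card_le_card this).trans Finset.card_image_le
    rw [Finset.card_range] at this
    omega
  refine ⟨fun x => ⟨c x, hle x⟩, measurable_to_countable' fun i => ?_, fun x θ hθ h => ?_⟩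
  · convert hc (measurableSet_singleton (i : ℕ)) using 1
    ext x
    simp [Fin.ext_iff]
  · exact hne x θ hθ (Fin.ext_iff.mp h).symm

lemma exists_measurable_maximal_discrete
    (hfree : ∀ (γ : Γ) (x : X), γ • x = x → γ = 1)
    [MeasurableSpace.CountablySeparated X] (R : Finset Γ)
    (hR : (1 : Γ) ∈ R) (hsymm : ∀ θ ∈ R, θ⁻¹ ∈ R) :
    ∃ M : Set X, MeasurableSet M ∧ (∀ x ∈ M, ∀ θ ∈ R, θ • x ∈ M → θ = 1) ∧
      ∀ x, ∃ θ ∈ R, θ • x ∈ M := by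
  classical
  obtain ⟨c, hc, hne, hlt⟩ := exists_measurable_greedy_coloring hfree (R.erase 1)
    (Finset.notMem_erase 1 R) (fun θ hθ => by
      rw [Finset.mem_erase] at hθ ⊢
      exact ⟨inv_ne_one.mpr hθ.1, hsymm θ hθ.2⟩)
  refine ⟨c ⁻¹' {0}, hc (measurableSet_singleton 0), fun x hx θ hθ hθx => ?_, fun x => ?_⟩
  · by_contra h
    refine hne x θ (Finset.mem_erase.mpr ⟨h, hθ⟩) ?_
    rw [Set.mem_preimage, Set.mem_singleton_iff] at hx hθx
    rw [hx, hθx]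
  · rcases Nat.eq_zero_or_pos (c x) with h | h
    · exact ⟨1, hR, by simpa using h⟩
    · obtain ⟨θ, hθ, h0⟩ := hlt x 0 h
      exact ⟨θ, Finset.mem_of_mem_erase hθ, h0⟩

/-- Recoloring simultaneously and measurably near the points of a sparse set. -/
lemma exists_measurable_recoloring
    (hfree : ∀ (γ : Γ) (x : X), γ • x = x → γ = 1)
    [Countable Γ] {F : Finset Γ} {ℓ : ℕ} {c : X → Fin ℓ}
    (hc : Measurable c) (hcF : ∀ x, ∀ σ ∈ F, c x ≠ c (σ • x)) {A : Set X} (hA : MeasurableSet A)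
    (Λ : Finset Γ)
    (hAΛ : ∀ a ∈ A, ∀ a' ∈ A, ∀ δ ∈ Λ, ∀ δ' ∈ Λ, ∀ τ, (τ = 1 ∨ τ ∈ F) →
      δ' • a' = τ • δ • a → a = a')
    {p : Set (Γ → Fin ℓ)} (hp : MeasurableSet p)
    (hex : ∀ a ∈ A, ∃ x' ∈ p, x' ∈ properCol F ℓ ∧ ∀ δ, δ ∉ Λ → x' δ = c (δ • a)) :
    ∃ c' : X → Fin ℓ, Measurable c' ∧ (∀ x, ∀ σ ∈ F, c' x ≠ c' (σ • x)) ∧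
      (∀ a ∈ A, ∃ x' ∈ p, (∀ δ ∈ Λ, c' (δ • a) = x' δ) ∧ ∀ δ, δ ∉ Λ → x' δ = c (δ • a)) ∧
      ∀ z, (∀ δ ∈ Λ, δ⁻¹ • z ∉ A) → c' z = c z := by
  classical
  rcases isEmpty_or_nonempty X with hX | ⟨⟨x₀⟩⟩
  · exact ⟨c, hc, hcF, fun a => isEmptyElim a, fun z => isEmptyElim z⟩
  let mk : (Λ → Fin ℓ) → X → Γ → Fin ℓ := fun s a δ =>
    if h : δ ∈ Λ then s ⟨δ, h⟩ else c (δ • a)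
  have hmk : ∀ s, Measurable (mk s) := by
    intro s
    refine measurable_pi_lambda _ fun δ => ?_
    by_cases h : δ ∈ Λ
    · simp only [mk, dif_pos h, measurable_const]
    · simp only [mk, dif_neg h]
      exact hc.comp (measurable_const_smul δ)
  have hcol : MeasurableSet (properCol F ℓ) := by
    have : properCol F ℓ = ⋂ γ : Γ, ⋂ σ ∈ F, {x : Γ → Fin ℓ | x γ = x (σ * γ)}ᶜ := by
      ext x
      simp [properCol]
    rw [this]
    exact MeasurableSet.iInter fun γ => Finset.measurableSet_biInter _ fun σ _ =>
      (measurableSet_eq_fun (measurable_pi_apply γ) (measurable_pi_apply (σ * γ))).compl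
  obtain ⟨f, hf, hfp⟩ := exists_measurable_selection (X := X) (S := Λ → Fin ℓ)
    (fun s a => a ∈ A → mk s a ∈ p ∩ properCol F ℓ)
    (fun s => by
      have : {a | a ∈ A → mk s a ∈ p ∩ properCol F ℓ} =
          Aᶜ ∪ mk s ⁻¹' (p ∩ properCol F ℓ) := by
        ext a
        simp [imp_iff_not_or]
      rw [this]
      exact hA.compl.union (hmk s (hp.inter hcol)))
    (fun a => by
      by_cases ha : a ∈ A
      · obtain ⟨x', hx'p, hx', hoff⟩ := hex a ha
        refine ⟨fun δ => x' δ, fun _ => ?_⟩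
        have : mk (fun δ => x' δ) a = x' := by
          funext δ
          by_cases h : δ ∈ Λ
          · simp [mk, h]
          · simp [mk, h, hoff]
        rw [this]
        exact ⟨hx'p, hx'⟩
      · exact ⟨fun _ => c x₀, fun h => (ha h).elim⟩)
  let c' : X → Fin ℓ := fun z =>
    if h : ∃ δ : Λ, (δ : Γ)⁻¹ • z ∈ A then f ((h.choose : Γ)⁻¹ • z) h.choose else c z
  have hout : ∀ z, (∀ δ ∈ Λ, δ⁻¹ • z ∉ A) → c' z = c z := by
    intro z hz
    have : ¬ ∃ δ : Λ, (δ : Γ)⁻¹ • z ∈ A := fun ⟨δ, h⟩ => hz δ δ.2 h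
    simp only [c', dif_neg this]
  have hin : ∀ a ∈ A, ∀ δ (h : δ ∈ Λ), c' (δ • a) = f a ⟨δ, h⟩ := by
    intro a ha δ hδ
    have h : ∃ δ' : Λ, (δ' : Γ)⁻¹ • δ • a ∈ A := ⟨⟨δ, hδ⟩, by simpa using ha⟩
    have h1 : a = (h.choose : Γ)⁻¹ • δ • a := hAΛ a ha _ h.choose_spec δ hδ h.choose h.choose.2 1
      (Or.inl rfl) (by simp)
    have h2 : h.choose = ⟨δ, hδ⟩ := by
      refine Subtype.ext ?_
      have h3 : ((h.choose : Γ)⁻¹ * δ) • a = a := by rw [mul_smul]; exact h1.symm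
      exact inv_mul_eq_one.mp (hfree _ _ h3)
    simp only [c', dif_pos h]
    rw [← h1, h2]
  have hin' : ∀ a ∈ A, ∀ δ ∈ Λ, c' (δ • a) = mk (f a) a δ := by
    intro a ha δ hδ
    rw [hin a ha δ hδ]
    simp [mk, hδ]
  have hnear : ∀ a ∈ A, ∀ δ ∈ Λ, ∀ τ, τ ∈ F ∨ τ⁻¹ ∈ F →
      c' (τ • δ • a) = mk (f a) a (τ * δ) := by
    intro a ha δ hδ τ hτ
    by_cases h : τ * δ ∈ Λ
    · rw [← mul_smul]
      exact hin' a ha _ h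
    · rw [hout]
      · simp only [mk, dif_neg h, mul_smul]
      · intro δ' hδ' h'
        have h1 : a = δ'⁻¹ • τ • δ • a := by
          rcases hτ with hτ | hτ
          · exact hAΛ a ha _ h' δ hδ δ' hδ' τ (Or.inr hτ) (by simp)
          · exact (hAΛ _ h' a ha δ' hδ' δ hδ τ⁻¹ (Or.inr hτ) (by simp)).symm
        have h3 : (δ'⁻¹ * (τ * δ)) • a = a := by
          rw [mul_smul, mul_smul]; exact h1.symm
        exact h (inv_mul_eq_one.mp (hfree _ _ h3) ▸ hδ')
  refine ⟨c', ?_, ?_, fun a ha => ⟨mk (f a) a, (hfp a ha).1, hin' a ha, fun δ hδ => ?_⟩, hout⟩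
  · refine measurable_to_countable' fun t => ?_
    have : c' ⁻¹' {t} = (⋃ δ : Λ, {z | (δ : Γ)⁻¹ • z ∈ A} ∩
        ⋃ s : {s : Λ → Fin ℓ // s δ = t}, {z | f ((δ : Γ)⁻¹ • z) = s.1}) ∪
        ((⋂ δ : Λ, {z | (δ : Γ)⁻¹ • z ∈ A}ᶜ) ∩ c ⁻¹' {t}) := by
      ext z
      simp only [Set.mem_preimage, Set.mem_singleton_iff, Set.mem_union, Set.mem_iUnion,
        Set.mem_inter_iff, Set.mem_ofPred_eq, Set.mem_iInter, Set.mem_compl_iff, Subtype.exists,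
        exists_prop]
      by_cases h : ∃ δ ∈ Λ, δ⁻¹ • z ∈ A
      · obtain ⟨δ, hδ, hz⟩ := h
        have key : ∀ δ' (h : δ' ∈ Λ), δ'⁻¹ • z ∈ A → c' z = f (δ'⁻¹ • z) ⟨δ', h⟩ := by
          intro δ' h h'
          have := hin _ h' δ' h
          rwa [smul_inv_smul] at this
        constructor
        · rintro rfl
          exact Or.inl ⟨δ, hδ, hz, _, (key δ hδ hz).symm, rfl⟩
        · rintro (⟨δ', h, h', s, rfl, hs⟩ | h)
          · rw [key δ' h h', hs]
          · exact (h.1 ⟨δ, hδ⟩ hz).elim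
      · push Not at h
        rw [hout z h]
        constructor
        · exact fun h' => Or.inr ⟨fun δ => h δ δ.2, h'⟩
        · rintro (⟨δ', h1, h2, -⟩ | h')
          · exact (h δ' h1 h2).elim
          · exact h'.2
    rw [this]
    refine MeasurableSet.union (MeasurableSet.iUnion fun δ =>
      (measurableSet_smul_preimage hA _).inter (MeasurableSet.iUnion fun s => ?_))
      ((MeasurableSet.iInter fun δ => (measurableSet_smul_preimage hA _).compl).inter
        (hc (measurableSet_singleton t)))
    exact measurable_const_smul (δ : Γ)⁻¹ (hf s.1)
  · intro z σ hσ
    by_cases h : ∃ δ ∈ Λ, δ⁻¹ • z ∈ A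
    · obtain ⟨δ, hδ, hz⟩ := h
      have h1 := hin' _ hz δ hδ
      have h2 := hnear _ hz δ hδ σ (Or.inl hσ)
      rw [smul_inv_smul] at h1 h2
      rw [h1, h2]
      exact (hfp _ hz).2 δ σ hσ
    · push Not at h
      by_cases h' : ∃ δ ∈ Λ, δ⁻¹ • σ • z ∈ A
      · obtain ⟨δ, hδ, hz⟩ := h'
        have h1 := hin' _ hz δ hδ
        have h2 := hnear _ hz δ hδ σ⁻¹ (Or.inr (by simpa using hσ))
        rw [smul_inv_smul] at h1 h2
        rw [inv_smul_smul] at h2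
        rw [h1, h2]
        have := (hfp _ hz).2 (σ⁻¹ * δ) σ hσ
        rwa [mul_inv_cancel_left] at this
      · push Not at h'
        rw [hout z h, hout _ h']
        exact hcF z σ hσ
  · simp only [mk, dif_neg hδ]

end BorelCombinatorics

section Configuration

variable {Γ : Type} [Group Γ]

lemma exists_mul_pow_lt_two_pow (a : ℕ) : ∃ k : ℕ, a * (2 * k + 1) ^ 6 < 2 ^ k := by
  have h := isLittleO_pow_const_const_pow_of_one_lt (R := ℝ) 6 (one_lt_two (α := ℝ))
  have h2 := (h.def (c := 1 / (729 * (a + 1) : ℝ)) (by positivity)).and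
    (Filter.eventually_ge_atTop 1)
  obtain ⟨k, hk, hk1⟩ := h2.exists
  refine ⟨k, ?_⟩
  have hpos : (0 : ℝ) < 729 * (a + 1) := by positivity
  simp only [norm_pow, Real.norm_natCast, Real.norm_ofNat] at hk
  rw [div_mul_eq_mul_div, one_mul, le_div_iff₀ hpos] at hk
  have hk' : k ^ 6 * (729 * (a + 1)) ≤ 2 ^ k := by exact_mod_cast hk
  have h3 : (2 * k + 1) ^ 6 ≤ (3 * k) ^ 6 := Nat.pow_le_pow_left (by omega) 6
  have hk6 : 0 < k ^ 6 := by positivity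
  calc a * (2 * k + 1) ^ 6 ≤ a * (3 * k) ^ 6 := Nat.mul_le_mul_left _ h3
    _ = k ^ 6 * (729 * a) := by ring
    _ < k ^ 6 * (729 * (a + 1)) := Nat.mul_lt_mul_of_pos_left (by omega) hk6
    _ ≤ 2 ^ k := hk'

lemma finiteClass_inv_iff {g : Γ} : FiniteClass g⁻¹ ↔ FiniteClass g := by
  have : (Subgroup.centralizer {g⁻¹} : Subgroup Γ) = Subgroup.centralizer {g} := by
    ext x
    simp only [Subgroup.mem_centralizer_singleton_iff]
    exact Commute.inv_right_iff (a := x) (b := g)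
  rw [FiniteClass, FiniteClass, this]

lemma exists_generic_configuration [DecidableEq Γ] [Infinite Γ] (E C U : Finset Γ)
    (hE : ∀ e ∈ E, e⁻¹ ∈ E) (hU : ∀ σ ∈ U, σ⁻¹ ∈ U) (γ : Γ)
    (hγ : ∀ u, u * γ * u⁻¹ ∈ E → ¬ FiniteClass γ) (L : ℕ) :
    ∃ (k : ℕ) (h : Fin L × Fin (2 * k + 1) → Γ) (T G : Finset Γ),
      (1 ∈ T ∧ ∀ t ∈ T, t⁻¹ ∈ T) ∧
      (∀ a ∈ C, ∀ a' ∈ C, ∀ i j, ∀ σ ∈ U, (a' * h j)⁻¹ * σ * (a * h i) ∈ T) ∧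
      (∀ a ∈ C, ∀ a' ∈ C, ∀ i j, ∀ σ ∈ U, a' * h j = σ * (a * h i) → i = j) ∧
      (∀ s ∈ T * T * T, s * γ * s⁻¹ ∈ G ∧ s * γ⁻¹ * s⁻¹ ∈ G) ∧
      (∀ g ∈ G, ∀ a ∈ C, ∀ a' ∈ C, ∀ i j, a * h i * g * (a * h i)⁻¹ ∈ E →
        a' * h j * g * (a' * h j)⁻¹ ∈ E → i = j) ∧
      G.card * L < 2 ^ k := by
  obtain ⟨h, hsep, hgen⟩ := exists_generic_seq (C⁻¹ * U * C) (C⁻¹ * E * C)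
  obtain ⟨k, hk⟩ := exists_mul_pow_lt_two_pow (2 * ((C.card * L) ^ 2 * U.card + 1) ^ 3 * L)
  let ι := Fin L × Fin (2 * k + 1)
  let f : ι → ℕ := fun i => Fintype.equivFin ι i
  have hf : Function.Injective f := fun i j hij =>
    (Fintype.equivFin ι).injective (Fin.ext hij)
  obtain ⟨Q, hQ, hQc⟩ : ∃ Q : Finset Γ, (∀ a ∈ C, ∀ i, a * h (f i) ∈ Q) ∧
      Q.card ≤ C.card * (L * (2 * k + 1)) := by
    refine ⟨C * Finset.univ.image fun i => h (f i), fun a ha i =>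
      Finset.mul_mem_mul ha (Finset.mem_image_of_mem _ (Finset.mem_univ i)),
      Finset.card_mul_le.trans (Nat.mul_le_mul_left _ (Finset.card_image_le.trans ?_))⟩
    simp [ι]
  obtain ⟨T, hT⟩ : ∃ T : Finset Γ, T = insert 1 (Q⁻¹ * U * Q) := ⟨_, rfl⟩
  obtain ⟨G, hG⟩ : ∃ G : Finset Γ, G = (T * T * T).image (fun s => s * γ * s⁻¹) ∪
    (T * T * T).image fun s => s * γ⁻¹ * s⁻¹ := ⟨_, rfl⟩
  refine ⟨k, fun i => h (f i), T, G, ⟨by simp [hT], fun t ht => ?_⟩, ?_, ?_, ?_, ?_, ?_⟩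
  · rw [hT] at ht ⊢
    rcases Finset.mem_insert.mp ht with rfl | ht
    · simp
    · obtain ⟨_, hx, q, hq, rfl⟩ := Finset.mem_mul.mp ht
      obtain ⟨q', hq', σ, hσ, rfl⟩ := Finset.mem_mul.mp hx
      refine Finset.mem_insert_of_mem ?_
      rw [mul_inv_rev, mul_inv_rev, ← mul_assoc]
      exact Finset.mul_mem_mul (Finset.mul_mem_mul (Finset.inv_mem_inv hq) (hU σ hσ))
        (Finset.mem_inv'.mp hq')
  · intro a ha a' ha' i j σ hσ
    rw [hT]
    exact Finset.mem_insert_of_mem (Finset.mul_mem_mul (Finset.mul_mem_mul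
      (Finset.inv_mem_inv (hQ a' ha' j)) hσ) (hQ a ha i))
  · intro a ha a' ha' i j σ hσ heq
    by_contra hij
    refine hsep (f i) (f j) (hf.ne hij) (a'⁻¹ * σ * a) (Finset.mul_mem_mul (Finset.mul_mem_mul
      (Finset.inv_mem_inv ha') hσ) ha) ?_
    rw [mul_assoc, mul_assoc, ← heq, inv_mul_cancel_left]
  · intro s hs
    rw [hG]
    exact ⟨Finset.mem_union_left _ (Finset.mem_image_of_mem _ hs),
      Finset.mem_union_right _ (Finset.mem_image_of_mem _ hs)⟩
  · intro g hg a ha a' ha' i j hi hj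
    have hg' : ¬ FiniteClass g := by
      rw [hG] at hg
      rcases Finset.mem_union.mp hg with h' | h'
      · obtain ⟨s, -, rfl⟩ := Finset.mem_image.mp h'
        refine not_finiteClass_conj (hγ (a * h (f i) * s) ?_) s
        simpa [mul_assoc] using hi
      · obtain ⟨s, -, rfl⟩ := Finset.mem_image.mp h'
        refine not_finiteClass_conj ?_ s
        rw [finiteClass_inv_iff]
        refine hγ (a * h (f i) * s) ?_
        simpa [mul_assoc] using hE _ hi
    have hmem : ∀ a ∈ C, ∀ i, a * h (f i) * g * (a * h (f i))⁻¹ ∈ E →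
        h (f i) * g * (h (f i))⁻¹ ∈ C⁻¹ * E * C := by
      intro a ha i hi
      have := Finset.mul_mem_mul (Finset.mul_mem_mul (Finset.inv_mem_inv ha) hi) ha
      simpa [mul_assoc] using this
    exact hf (hgen _ _ g hg' (hmem a ha i hi) (hmem a' ha' j hj))
  · have hTc : T.card ≤ ((C.card * L) ^ 2 * U.card + 1) * (2 * k + 1) ^ 2 := by
      calc T.card ≤ (Q⁻¹ * U * Q).card + 1 := hT ▸ Finset.card_insert_le _ _
        _ ≤ Q.card * U.card * Q.card + 1 := by
          refine Nat.add_le_add_right ?_ 1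
          refine Finset.card_mul_le.trans (Nat.mul_le_mul_right _ ?_)
          exact Finset.card_mul_le.trans_eq (by rw [Finset.card_inv])
        _ ≤ (C.card * (L * (2 * k + 1))) * U.card * (C.card * (L * (2 * k + 1))) + 1 := by
          gcongr
        _ ≤ ((C.card * L) ^ 2 * U.card + 1) * (2 * k + 1) ^ 2 := by
          have : 1 ≤ (2 * k + 1) ^ 2 := Nat.one_le_pow _ _ (by omega)
          nlinarith
    have hGc : G.card ≤ 2 * T.card ^ 3 := by
      have h3 : (T * T * T).card ≤ T.card ^ 3 := by
        calc (T * T * T).card ≤ (T * T).card * T.card := Finset.card_mul_le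
          _ ≤ T.card * T.card * T.card := Nat.mul_le_mul_right _ Finset.card_mul_le
          _ = T.card ^ 3 := by ring
      rw [hG]
      calc _ ≤ (T * T * T).card + (T * T * T).card :=
            (Finset.card_union_le _ _).trans (add_le_add Finset.card_image_le Finset.card_image_le)
        _ ≤ 2 * T.card ^ 3 := by omega
    calc G.card * L ≤ 2 * (((C.card * L) ^ 2 * U.card + 1) * (2 * k + 1) ^ 2) ^ 3 * L := by
          refine Nat.mul_le_mul_right _ (hGc.trans (Nat.mul_le_mul_left _ ?_))
          exact Nat.pow_le_pow_left hTc 3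
      _ = 2 * ((C.card * L) ^ 2 * U.card + 1) ^ 3 * L * (2 * k + 1) ^ 6 := by ring
      _ < 2 ^ k := hk

end Configuration

section LocalRules

lemma measurableSet_of_congr_on_finset {Γ : Type} {ℓ : ℕ} {p : (Γ → Fin ℓ) → Prop}
    (T : Finset Γ) (hp : ∀ u v : Γ → Fin ℓ, (∀ κ ∈ T, u κ = v κ) → (p u ↔ p v)) :
    MeasurableSet {u | p u} := by
  have : {u | p u} = (fun (u : Γ → Fin ℓ) (t : T) => u t) ⁻¹'
      ((fun (u : Γ → Fin ℓ) (t : T) => u t) '' {u | p u}) := by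
    ext u
    simp only [Set.mem_ofPred_eq, Set.mem_preimage, Set.mem_image]
    refine ⟨fun h => ⟨u, h, rfl⟩, fun ⟨v, hv, h⟩ => (hp v u fun κ hκ => ?_).mp hv⟩
    exact congrFun h ⟨κ, hκ⟩
  rw [this]
  exact (measurable_pi_lambda _ fun t => measurable_pi_apply _) (Set.toFinite _).measurableSet

lemma isClopen_of_congr_on_finset {Γ : Type} {ℓ : ℕ} {p : (Γ → Fin ℓ) → Prop}
    (T : Finset Γ) (hp : ∀ u v : Γ → Fin ℓ, (∀ κ ∈ T, u κ = v κ) → (p u ↔ p v)) :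
    IsClopen {u | p u} := by
  have : {u | p u} = (fun (u : Γ → Fin ℓ) (t : T) => u t) ⁻¹'
      ((fun (u : Γ → Fin ℓ) (t : T) => u t) '' {u | p u}) := by
    ext u
    simp only [Set.mem_ofPred_eq, Set.mem_preimage, Set.mem_image]
    refine ⟨fun h => ⟨u, h, rfl⟩, fun ⟨v, hv, h⟩ => (hp v u fun κ hκ => ?_).mp hv⟩
    exact congrFun h ⟨κ, hκ⟩
  rw [this]
  exact (isClopen_discrete _).preimage (continuous_pi fun t => continuous_apply _)

/-- A local rule that is not constant on the proper colorings, witnessed by `pattern`. -/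
structure NonconstantRule {Γ : Type} [Group Γ] (F : Finset Γ) (ℓ : ℕ) (β : Type*) where
  /-- The rule. -/
  rule : (Γ → Fin ℓ) → β
  /-- The finitely many coordinates the rule depends on. -/
  window : Finset Γ
  rule_congr : ∀ u v : Γ → Fin ℓ, (∀ κ ∈ window, u κ = v κ) → rule u = rule v
  /-- Two colorings with different values under the rule. -/
  pattern : Bool → Γ → Fin ℓ
  pattern_mem : ∀ b, pattern b ∈ properCol F ℓ
  pattern_ne : rule (pattern false) ≠ rule (pattern true)

variable {Γ : Type} [Group Γ] {F : Finset Γ} {ℓ : ℕ} {β : Type*}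

/-- The window of the rule together with its neighbors. -/
def NonconstantRule.nbhd [DecidableEq Γ] (R : NonconstantRule F ℓ β) : Finset Γ :=
  R.window ∪ F * R.window

/-- A symmetric set of translates at which a change on `nbhd` can affect the rule. -/
def NonconstantRule.inter [DecidableEq Γ] (R : NonconstantRule F ℓ β) : Finset Γ :=
  insert 1 (R.window⁻¹ * R.nbhd ∪ (R.window⁻¹ * R.nbhd)⁻¹)

lemma NonconstantRule.inv_mem_inter [DecidableEq Γ] (R : NonconstantRule F ℓ β) {e : Γ}
    (he : e ∈ R.inter) : e⁻¹ ∈ R.inter := by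
  simp only [inter, Finset.mem_insert, Finset.mem_union, Finset.mem_inv', inv_inv,
    inv_eq_one] at he ⊢
  tauto

lemma NonconstantRule.inv_mul_mem_inter [DecidableEq Γ] (R : NonconstantRule F ℓ β) {κ κ' : Γ}
    (hκ : κ ∈ R.window) (hκ' : κ' ∈ R.nbhd) : κ⁻¹ * κ' ∈ R.inter :=
  Finset.mem_insert_of_mem (Finset.mem_union_left _
    (Finset.mul_mem_mul (Finset.inv_mem_inv hκ) hκ'))

lemma NonconstantRule.ne_congr [DecidableEq Γ] (R : NonconstantRule F ℓ β) (a b : Γ)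
    (u v : Γ → Fin ℓ) (h : ∀ κ ∈ R.window * {a, b}, u κ = v κ) :
    R.rule (shiftAct a u) ≠ R.rule (shiftAct b u) ↔
      R.rule (shiftAct a v) ≠ R.rule (shiftAct b v) := by
  have h1 : R.rule (shiftAct a u) = R.rule (shiftAct a v) := R.rule_congr _ _ fun κ hκ =>
    h _ (Finset.mul_mem_mul hκ (by simp))
  have h2 : R.rule (shiftAct b u) = R.rule (shiftAct b v) := R.rule_congr _ _ fun κ hκ =>
    h _ (Finset.mul_mem_mul hκ (by simp))
  rw [h1, h2]

lemma NonconstantRule.isClopen_ne (R : NonconstantRule F ℓ β) (a b : Γ) :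
    IsClopen {u | R.rule (shiftAct a u) ≠ R.rule (shiftAct b u)} := by
  classical
  exact isClopen_of_congr_on_finset _ (R.ne_congr a b)

lemma NonconstantRule.measurableSet_ne (R : NonconstantRule F ℓ β) (a b : Γ) :
    MeasurableSet {u | R.rule (shiftAct a u) ≠ R.rule (shiftAct b u)} := by
  classical
  exact measurableSet_of_congr_on_finset _ (R.ne_congr a b)

end LocalRules

section Recoloring

variable {Γ : Type} [Group Γ] {X : Type*} [MulAction Γ X]

/-- The coloring of the group read off along the orbit of a point. -/
def colView {α : Type*} (c : X → α) (x : X) : Γ → α := fun δ => c (δ • x)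

lemma shiftAct_colView {α : Type*} (c : X → α) (γ : Γ) (x : X) :
    shiftAct γ (colView c x) = colView c (γ • x) := by
  funext δ
  simp [shiftAct, colView, mul_smul]

lemma colView_mem_properCol {F : Finset Γ} {ℓ : ℕ} {c : X → Fin ℓ}
    (hc : ∀ x, ∀ σ ∈ F, c x ≠ c (σ • x)) (x : X) : colView c x ∈ properCol F ℓ := by
  intro γ σ hσ
  simp only [colView, mul_smul]
  exact hc _ σ hσ

lemma measurable_colView [MeasurableSpace X] [MeasurableConstSMul Γ X] {α : Type*}
    [MeasurableSpace α] {c : X → α} (hc : Measurable c) :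
    Measurable (colView c : X → Γ → α) :=
  measurable_pi_lambda _ fun δ => hc.comp (measurable_const_smul δ)

variable [MeasurableSpace X] [MeasurableConstSMul Γ X] [DecidableEq Γ] [Countable Γ]
  {F : Finset Γ} {ℓ : ℕ} {β : Type*}

/-- Recoloring near the points of a sparse set, one class after the other. -/
lemma exists_recoloring_by_classes (hfree : ∀ (γ : Γ) (x : X), γ • x = x → γ = 1)
    (hFsym : ∀ σ ∈ F, σ⁻¹ ∈ F) (hF1 : (1 : Γ) ∉ F) (hℓ : F.card + 1 ≤ ℓ)
    (R : NonconstantRule F ℓ β) {c : X → Fin ℓ} (hc : Measurable c)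
    (hcF : ∀ x, ∀ σ ∈ F, c x ≠ c (σ • x)) {M : Set X} (hM : MeasurableSet M) {n L k : ℕ}
    (cl : X → Fin n) (hcl : ∀ r, MeasurableSet {x | cl x = r})
    (q : Fin n → Fin L × Fin (2 * k + 1) → Γ) (T G U : Finset Γ)
    (hMT : ∀ x ∈ M, ∀ t ∈ T, t • x ∈ M → t = 1)
    (hT : ∀ r r' i j, ∀ σ ∈ U, (q r' j)⁻¹ * σ * q r i ∈ T)
    (hq : ∀ r i j, ∀ σ ∈ U, q r j = σ * q r i → i = j)
    (hU : ∀ κ ∈ R.nbhd, ∀ κ' ∈ R.nbhd, ∀ τ, (τ = 1 ∨ τ ∈ F) → κ'⁻¹ * τ * κ ∈ U)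
    (hUE : ∀ e ∈ R.inter, ∀ e' ∈ R.inter, e'⁻¹ * e ∈ U)
    (hG : ∀ g ∈ G, ∀ r i j, q r i * g * (q r i)⁻¹ ∈ R.inter →
      q r j * g * (q r j)⁻¹ ∈ R.inter → i = j)
    (hk : G.card * L < 2 ^ k) :
    ∃ c' : X → Fin ℓ, Measurable c' ∧ (∀ x, ∀ σ ∈ F, c' x ≠ c' (σ • x)) ∧
      (∀ x, c' x ≠ c x → ∃ m ∈ M, ∃ i, ∃ κ ∈ R.nbhd, x = (κ * q (cl m) i) • m) ∧
      ∀ m ∈ M, ∀ g ∈ G,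
        (∀ t ∈ T, (t * g) • m ∈ M → cl m ≤ cl ((t * g) • m) → (t * g) • m = m) →
        ∀ l, ∃ j, R.rule (colView c' (q (cl m) (l, j) • m)) ≠
          R.rule (colView c' ((q (cl m) (l, j) * g) • m)) := by
  suffices h : ∀ r ≤ n, ∃ c' : X → Fin ℓ, Measurable c' ∧
      (∀ x, ∀ σ ∈ F, c' x ≠ c' (σ • x)) ∧
      (∀ x, c' x ≠ c x → ∃ m ∈ M, ∃ i, ∃ κ ∈ R.nbhd, x = (κ * q (cl m) i) • m) ∧
      ∀ m ∈ M, (cl m : ℕ) < r → ∀ g ∈ G,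
        (∀ t ∈ T, (t * g) • m ∈ M → cl m ≤ cl ((t * g) • m) → (t * g) • m = m) →
        ∀ l, ∃ j, R.rule (colView c' (q (cl m) (l, j) • m)) ≠
          R.rule (colView c' ((q (cl m) (l, j) * g) • m)) by
    obtain ⟨c', h1, h2, h3, h4⟩ := h n le_rfl
    exact ⟨c', h1, h2, h3, fun m hm => h4 m hm (cl m).2⟩
  intro r
  induction r with
  | zero => exact fun _ => ⟨c, hc, hcF, fun x h => (h rfl).elim, fun m _ h => by omega⟩
  | succ r ih =>
    intro hr
    obtain ⟨c₁, hc₁, hc₁F, hch₁, hw₁⟩ := ih (by omega)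
    let r' : Fin n := ⟨r, hr⟩
    have hnear : ∀ i j, ∀ κ ∈ R.nbhd, ∀ κ' ∈ R.nbhd, ∀ τ, (τ = 1 ∨ τ ∈ F) →
        κ' * q r' j = τ * (κ * q r' i) → i = j := by
      intro i j κ hκ κ' hκ' τ hτ h
      refine hq r' i j _ (hU κ hκ κ' hκ' τ hτ) ?_
      rw [mul_assoc, mul_assoc, ← h, inv_mul_cancel_left]
    have hexw : ∀ x ∈ properCol F ℓ, _ := fun x hx =>
      exists_properCol_witnesses hFsym hF1 hℓ R.rule_congr R.pattern_mem R.pattern_ne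
        (E := R.inter) (fun κ hκ κ' hκ' => R.inv_mul_mem_inter hκ hκ') (q r') hnear
        (fun i j e he e' he' h => hq r' i j _ (hUE e he e' he') (by
          rw [mul_assoc, h, inv_mul_cancel_left]))
        G (fun g hg => hG g hg r') hk hx
    let Λ : Finset Γ := R.nbhd * Finset.univ.image (q r')
    have hΛ : ∀ δ ∈ Λ, ∃ κ ∈ R.nbhd, ∃ i, δ = κ * q r' i := by
      intro δ hδ
      obtain ⟨κ, hκ, _, hi, rfl⟩ := Finset.mem_mul.mp hδ
      obtain ⟨i, -, rfl⟩ := Finset.mem_image.mp hi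
      exact ⟨κ, hκ, i, rfl⟩
    have hΛ' : ∀ κ ∈ R.nbhd, ∀ i, κ * q r' i ∈ Λ := fun κ hκ i =>
      Finset.mul_mem_mul hκ (Finset.mem_image_of_mem _ (Finset.mem_univ i))
    have hsep : ∀ a ∈ M ∩ {x | cl x = r'}, ∀ a' ∈ M ∩ {x | cl x = r'}, ∀ δ ∈ Λ, ∀ δ' ∈ Λ, ∀ τ,
        (τ = 1 ∨ τ ∈ F) → δ' • a' = τ • δ • a → a = a' := by
      rintro a ⟨ha, -⟩ a' ⟨ha', -⟩ δ hδ δ' hδ' τ hτ h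
      obtain ⟨κ, hκ, i, rfl⟩ := hΛ δ hδ
      obtain ⟨κ', hκ', j, rfl⟩ := hΛ δ' hδ'
      have h1 : a' = ((q r' j)⁻¹ * (κ'⁻¹ * τ * κ) * q r' i) • a := by
        rw [← inv_smul_eq_iff.mpr h.symm, ← mul_smul, ← mul_smul]
        congr 1
        simp only [mul_inv_rev, mul_assoc]
      have h2 := hMT a ha _ (hT r' r' i j _ (hU κ hκ κ' hκ' τ hτ)) (h1 ▸ ha')
      rw [h1, h2, one_smul]
    obtain ⟨c₂, hc₂, hc₂F, hw₂, hch₂⟩ := exists_measurable_recoloring hfree hc₁ hc₁F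
      (hM.inter (hcl r')) Λ hsep
      (p := ⋂ g ∈ G, ⋂ l : Fin L, ⋃ j : Fin (2 * k + 1),
        {x | R.rule (shiftAct (q r' (l, j)) x) ≠ R.rule (shiftAct (q r' (l, j) * g) x)})
      (Finset.measurableSet_biInter _ fun g _ => MeasurableSet.iInter fun l =>
        MeasurableSet.iUnion fun j => R.measurableSet_ne _ _)
      (by
        rintro a -
        obtain ⟨x', hx', hoff, hwit⟩ := hexw _ (colView_mem_properCol hc₁F a)
        refine ⟨x', ?_, hx', fun δ hδ => hoff δ fun i κ hκ h => hδ (h ▸ hΛ' κ hκ i)⟩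
        simp only [Set.mem_iInter, Set.mem_iUnion]
        exact hwit)
    have hchange : ∀ z, c₂ z ≠ c₁ z → ∃ m ∈ M, cl m = r' ∧ ∃ i, ∃ κ ∈ R.nbhd,
        z = (κ * q r' i) • m := by
      intro z hz
      by_contra hcon
      refine hz (hch₂ z fun δ hδ hmem => hcon ?_)
      obtain ⟨κ, hκ, i, rfl⟩ := hΛ δ hδ
      exact ⟨_, hmem.1, hmem.2, i, κ, hκ, by rw [smul_inv_smul]⟩
    have hback : ∀ (z m : X) (s : Fin n) i j, ∀ κ ∈ R.nbhd, ∀ κ' ∈ R.nbhd,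
        (κ' * q s j) • z = (κ * q r' i) • m → ∃ t ∈ T, m = t • z := by
      intro z m s i j κ hκ κ' hκ' h
      refine ⟨_, hT s r' j i _ (hU κ' hκ' κ hκ 1 (Or.inl rfl)), ?_⟩
      rw [← inv_smul_eq_iff.mpr h, ← mul_smul]
      congr 1
      simp only [mul_inv_rev, mul_assoc, one_mul]
    have hKN : ∀ κ ∈ R.window, κ ∈ R.nbhd := fun κ hκ => Finset.mem_union_left _ hκ
    refine ⟨c₂, hc₂, hc₂F, fun x hx => ?_, fun m hm hmr g hg hcond l => ?_⟩
    · by_cases h : c₂ x = c₁ x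
      · exact hch₁ x (h ▸ hx)
      · obtain ⟨m, hm, hmr, i, κ, hκ, hz⟩ := hchange x h
        exact ⟨m, hm, i, κ, hκ, by rw [hmr]; exact hz⟩
    · rcases Nat.lt_succ_iff_lt_or_eq.mp hmr with hlt | heq
      · obtain ⟨j, hj⟩ := hw₁ m hm hlt g hg hcond l
        refine ⟨j, ?_⟩
        rwa [R.rule_congr (colView c₂ (q (cl m) (l, j) • m)) (colView c₁ _) ?_,
          R.rule_congr (colView c₂ ((q (cl m) (l, j) * g) • m)) (colView c₁ _) ?_]
        · intro κ' hκ'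
          by_contra hne
          obtain ⟨m', hm', hmr', i, κ, hκ, hz⟩ := hchange _ hne
          rw [← mul_smul, ← mul_assoc, mul_smul] at hz
          obtain ⟨t, ht, rfl⟩ := hback _ _ _ _ _ κ hκ κ' (hKN κ' hκ') hz
          rw [← mul_smul] at hm' hmr'
          have h1 : cl m ≤ cl ((t * g) • m) := by
            rw [hmr']
            exact hlt.le
          rw [hcond t ht hm' h1] at hmr'
          rw [hmr'] at hlt
          exact absurd hlt (lt_irrefl r)
        · intro κ' hκ'
          by_contra hne
          obtain ⟨m', hm', hmr', i, κ, hκ, hz⟩ := hchange _ hne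
          rw [← mul_smul] at hz
          obtain ⟨t, ht, rfl⟩ := hback _ _ _ _ _ κ hκ κ' (hKN κ' hκ') hz
          rw [hMT m hm t ht hm', one_smul] at hmr'
          rw [hmr'] at hlt
          exact absurd hlt (lt_irrefl r)
      · have hclm : cl m = r' := Fin.ext heq
        obtain ⟨x', hx', hon, hoff⟩ := hw₂ m ⟨hm, hclm⟩
        simp only [Set.mem_iInter, Set.mem_iUnion] at hx'
        obtain ⟨j, hj⟩ := hx' g hg l
        refine ⟨j, ?_⟩
        rw [hclm]
        rwa [R.rule_congr (colView c₂ (q r' (l, j) • m)) (shiftAct (q r' (l, j)) x') ?_,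
          R.rule_congr (colView c₂ ((q r' (l, j) * g) • m)) (shiftAct (q r' (l, j) * g) x') ?_]
        · intro κ' hκ'
          simp only [colView, shiftAct, ← mul_smul]
          by_cases hmem : κ' * (q r' (l, j) * g) ∈ Λ
          · exact hon _ hmem
          · rw [hoff _ hmem]
            by_contra hne
            obtain ⟨m', hm', hmr', i, κ, hκ, hz⟩ := hchange _ hne
            have hz' := hz
            rw [← mul_assoc, mul_smul] at hz
            obtain ⟨t, ht, rfl⟩ := hback _ _ _ _ _ κ hκ κ' (hKN κ' hκ') hz
            rw [← mul_smul] at hm' hmr'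
            have h1 : (t * g) • m = m := hcond t ht hm' (by rw [hmr', hclm])
            rw [← mul_smul t, h1] at hz'
            have h2 : (κ * q r' i)⁻¹ * (κ' * (q r' (l, j) * g)) = 1 := hfree _ m (by
              rw [mul_smul, hz', inv_smul_smul])
            rw [← inv_mul_eq_one.mp h2] at hmem
            exact hmem (hΛ' κ hκ i)
        · intro κ' hκ'
          simp only [colView, shiftAct, ← mul_smul]
          exact hon _ (hΛ' κ' (hKN κ' hκ') _)

end Recoloring

section Stage

variable {Γ : Type} [Group Γ] [DecidableEq Γ] [Countable Γ] [Infinite Γ]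
  {F : Finset Γ} {ℓ : ℕ} {β : Type*}

/-- Elements of finite class that are conjugate into the interaction set of the rule. -/
def NonconstantRule.exceptional (R : NonconstantRule F ℓ β) : Set Γ :=
  {γ | FiniteClass γ ∧ ∃ u, u * γ * u⁻¹ ∈ R.inter}

/-- One round of recoloring: away from `B`, near a sparse set of cells, so that everywhere there
are many witnesses that `γ` does not preserve the values of the rule. -/
lemma exists_stage (hFsym : ∀ σ ∈ F, σ⁻¹ ∈ F) (hF1 : (1 : Γ) ∉ F) (hℓ : F.card + 1 ≤ ℓ)
    (R : NonconstantRule F ℓ β) (V C : Finset Γ) (γ : Γ) (hγ : γ ∉ R.exceptional) (W : ℕ) :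
    ∃ D : Finset Γ, ∀ (X : Type) [MeasurableSpace X] [MeasurableSpace.CountablySeparated X]
      [MulAction Γ X] [MeasurableConstSMul Γ X], (∀ (γ : Γ) (x : X), γ • x = x → γ = 1) →
      ∀ c : X → Fin ℓ, Measurable c → (∀ x, ∀ σ ∈ F, c x ≠ c (σ • x)) →
      ∀ B : Set X, MeasurableSet B → (∀ x : X, ∃ a ∈ C, a • x ∉ B) →
      ∃ (c' : X → Fin ℓ) (Z : Set X), Measurable c' ∧ (∀ x, ∀ σ ∈ F, c' x ≠ c' (σ • x)) ∧
        MeasurableSet Z ∧ Disjoint Z B ∧ (∀ z ∈ Z, ∀ v ∈ V, v • z ∈ Z → v • z = z) ∧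
        (∀ x, c' x ≠ c x → ∃ κ ∈ R.nbhd, κ⁻¹ • x ∈ Z) ∧
        ∀ y : X, ∃ S ⊆ D, W < S.card ∧ ∀ δ ∈ S,
          R.rule (colView c' (δ • y)) ≠ R.rule (colView c' ((δ * γ) • y)) := by
  obtain ⟨U, hUsym, hU1, hUV, hUn, hUE⟩ : ∃ U : Finset Γ, (∀ σ ∈ U, σ⁻¹ ∈ U) ∧ 1 ∈ U ∧ V ⊆ U ∧
      (∀ κ ∈ R.nbhd, ∀ κ' ∈ R.nbhd, ∀ τ, (τ = 1 ∨ τ ∈ F) → κ'⁻¹ * τ * κ ∈ U) ∧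
      (∀ e ∈ R.inter, ∀ e' ∈ R.inter, e'⁻¹ * e ∈ U) := by
    let U₀ := insert 1 (V ∪ R.nbhd⁻¹ * insert 1 F * R.nbhd ∪ R.inter⁻¹ * R.inter)
    have h0 : U₀ ⊆ U₀ ∪ U₀⁻¹ := Finset.subset_union_left
    refine ⟨U₀ ∪ U₀⁻¹, fun σ hσ => ?_, h0 (Finset.mem_insert_self _ _), fun v hv => h0 ?_,
      fun κ hκ κ' hκ' τ hτ => h0 ?_, fun e he e' he' => h0 ?_⟩
    · simp only [Finset.mem_union, Finset.mem_inv', inv_inv] at hσ ⊢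
      exact hσ.symm
    · simp [U₀, hv]
    · refine Finset.mem_insert_of_mem (Finset.mem_union_left _ (Finset.mem_union_right _ ?_))
      exact Finset.mul_mem_mul (Finset.mul_mem_mul (Finset.inv_mem_inv hκ')
        (Finset.mem_insert.mpr hτ)) hκ
    · exact Finset.mem_insert_of_mem (Finset.mem_union_right _
        (Finset.mul_mem_mul (Finset.inv_mem_inv he') he))
  obtain ⟨k, h, T, G, ⟨hT1, hTsym⟩, hT, hq, hGmem, hG, hk⟩ :=
    exists_generic_configuration R.inter C U (fun e he => R.inv_mem_inter he) hUsym γ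
      (fun u hu hfc => hγ ⟨hfc, u, hu⟩) (W + 1)
  let Q : Finset Γ := C * Finset.univ.image h
  refine ⟨Q * (T * (T * T)), ?_⟩
  intro X _ _ _ _ hfree c hc hcF B hB hCB
  have hTT : ∀ t ∈ T, t ∈ T * T := fun t ht => by simpa using Finset.mul_mem_mul ht hT1
  obtain ⟨M, hM, hMdisc, hMmax⟩ := exists_measurable_maximal_discrete (X := X) hfree (T * T)
    (by simpa using Finset.mul_mem_mul hT1 hT1) (fun t ht => by
      obtain ⟨t₁, h₁, t₂, h₂, rfl⟩ := Finset.mem_mul.mp ht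
      rw [mul_inv_rev]
      exact Finset.mul_mem_mul (hTsym _ h₂) (hTsym _ h₁))
  obtain ⟨κ, hκ, hκne⟩ := exists_measurable_fin_coloring (X := X) hfree
    (((T * G) ∪ (T * G)⁻¹).erase 1) (Finset.notMem_erase 1 _) (fun θ hθ => by
      simp only [Finset.mem_erase, Finset.mem_union, Finset.mem_inv', inv_inv, ne_eq,
        inv_eq_one] at hθ ⊢
      exact ⟨hθ.1, hθ.2.symm⟩) le_rfl
  obtain ⟨τ, hτ, hτB⟩ := exists_measurable_selection (X := X)
    (S := Fin (W + 1) × Fin (2 * k + 1) → C) (fun s x => ∀ i, ((s i : Γ) * h i) • x ∉ B)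
    (fun s => by
      have : {x : X | ∀ i, ((s i : Γ) * h i) • x ∉ B} =
          ⋂ i, {x | ((s i : Γ) * h i) • x ∈ B}ᶜ := by
        ext x
        simp
      rw [this]
      exact MeasurableSet.iInter fun i => (measurableSet_smul_preimage hB _).compl)
    (fun x => by
      choose a ha hax using fun i => hCB (h i • x)
      exact ⟨fun i => ⟨a i, ha i⟩, fun i => by rw [mul_smul]; exact hax i⟩)
  let e := Fintype.equivFin (Fin ((((T * G) ∪ (T * G)⁻¹).erase 1).card + 1) ×
    (Fin (W + 1) × Fin (2 * k + 1) → C))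
  let cl := fun x => e (κ x, τ x)
  let q := fun r i => ((e.symm r).2 i : Γ) * h i
  have hqcl : ∀ x i, q (cl x) i • x ∉ B := fun x i => by
    simpa [q, cl] using hτB x i
  have hqQ : ∀ r i, q r i ∈ Q := fun r i =>
    Finset.mul_mem_mul ((e.symm r).2 i).2 (Finset.mem_image_of_mem _ (Finset.mem_univ i))
  have hcl : ∀ r, MeasurableSet {x | cl x = r} := by
    intro r
    have : {x | cl x = r} = κ ⁻¹' {(e.symm r).1} ∩ {x | τ x = (e.symm r).2} := by
      ext x
      simp only [cl, Set.mem_ofPred_eq, ← Equiv.eq_symm_apply, Prod.ext_iff, Set.mem_inter_iff,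
        Set.mem_preimage, Set.mem_singleton_iff]
    rw [this]
    exact (hκ (measurableSet_singleton _)).inter (hτ _)
  have hclne : ∀ m : X, ∀ t ∈ T, ∀ g ∈ G, cl ((t * g) • m) = cl m → (t * g) • m = m := by
    intro m t ht g hg heq
    by_contra hne
    refine hκne m (t * g) (Finset.mem_erase.mpr ⟨fun h1 => hne (by rw [h1, one_smul]),
      Finset.mem_union_left _ (Finset.mul_mem_mul ht hg)⟩) ?_
    exact (congrArg Prod.fst (e.injective heq)).symm
  have hMT : ∀ x ∈ M, ∀ t ∈ T, t • x ∈ M → t = 1 := fun x hx t ht =>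
    hMdisc x hx t (hTT t ht)
  have hqT : ∀ r r' i j, ∀ σ ∈ U, (q r' j)⁻¹ * σ * q r i ∈ T := fun r r' i j σ hσ =>
    hT _ ((e.symm r).2 i).2 _ ((e.symm r').2 j).2 i j σ hσ
  have hqq : ∀ r r' i j, ∀ σ ∈ U, q r' j = σ * q r i → i = j := fun r r' i j σ hσ =>
    hq _ ((e.symm r).2 i).2 _ ((e.symm r').2 j).2 i j σ hσ
  obtain ⟨c', hc', hc'F, hch, hwit⟩ := exists_recoloring_by_classes hfree hFsym hF1 hℓ R hc hcF hM
    cl hcl q T G U hMT hqT (fun r => hqq r r) hUn hUE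
    (fun g hg r i j => hG g hg _ ((e.symm r).2 i).2 _ ((e.symm r).2 j).2 i j) hk
  refine ⟨c', {z | ∃ m ∈ M, ∃ i, z = q (cl m) i • m}, hc', hc'F, ?_, ?_, ?_, ?_, ?_⟩
  · have : {z : X | ∃ m ∈ M, ∃ i, z = q (cl m) i • m} =
        ⋃ r, ⋃ i, ({z | (q r i)⁻¹ • z ∈ M} ∩ {z | (q r i)⁻¹ • z ∈ {x | cl x = r}}) := by
      ext z
      simp only [Set.mem_ofPred_eq, Set.mem_iUnion, Set.mem_inter_iff]
      constructor
      · rintro ⟨m, hm, i, rfl⟩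
        exact ⟨cl m, i, by simpa using hm, by simp⟩
      · rintro ⟨r, i, hz, hr⟩
        exact ⟨_, hz, i, by rw [hr, smul_inv_smul]⟩
    rw [this]
    exact MeasurableSet.iUnion fun r => MeasurableSet.iUnion fun i =>
      (measurableSet_smul_preimage hM _).inter (measurableSet_smul_preimage (hcl r) _)
  · rw [Set.disjoint_left]
    rintro _ ⟨m, hm, i, rfl⟩
    exact hqcl m i
  · rintro _ ⟨m, hm, i, rfl⟩ v hv ⟨m', hm', j, heq⟩
    have h1 : m' = ((q (cl m') j)⁻¹ * v * q (cl m) i) • m := by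
      rw [mul_smul, mul_smul, heq, inv_smul_smul]
    have h2 := hMT m hm _ (hqT _ _ i j v (hUV hv)) (h1 ▸ hm')
    have h3 : m' = m := by rw [h1, h2, one_smul]
    subst h3
    have h4 : i = j := hqq _ _ i j v (hUV hv) (by
      rw [mul_assoc] at h2
      exact inv_mul_eq_one.mp h2)
    rw [heq, h4]
  · intro x hx
    obtain ⟨m, hm, i, κ', hκ', rfl⟩ := hch x hx
    exact ⟨κ', hκ', m, hm, i, by rw [mul_smul, inv_smul_smul]⟩
  · intro y
    obtain ⟨s, hs, hsM⟩ := hMmax y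
    have hcard : ∀ (r : _) (u : Γ) (j : Fin (W + 1) → Fin (2 * k + 1)),
        W < (Finset.univ.image fun l => q r (l, j l) * u).card := by
      intro r u j
      rw [Finset.card_image_of_injective]
      · simp
      · intro l l' hll
        have := hqq r r (l', j l') (l, j l) 1 hU1 (by
          rw [one_mul]
          exact mul_right_cancel hll)
        exact (congrArg Prod.fst this).symm
    have hsub : ∀ (r : _) (u : Γ) (j : Fin (W + 1) → Fin (2 * k + 1)), u ∈ T * (T * T) →
        (Finset.univ.image fun l => q r (l, j l) * u) ⊆ Q * (T * (T * T)) := by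
      intro r u j hu δ hδ
      obtain ⟨l, -, rfl⟩ := Finset.mem_image.mp hδ
      exact Finset.mul_mem_mul (hqQ _ _) hu
    have hsT3 : s ∈ T * (T * T) := by simpa using Finset.mul_mem_mul hT1 hs
    by_cases hcond : ∀ t ∈ T, (t * (s * γ * s⁻¹)) • s • y ∈ M →
        cl (s • y) ≤ cl ((t * (s * γ * s⁻¹)) • s • y) → (t * (s * γ * s⁻¹)) • s • y = s • y
    · choose j hj using hwit _ hsM _ (hGmem s (by rw [mul_assoc]; exact hsT3)).1 hcond
      refine ⟨_, hsub (cl (s • y)) s j hsT3, hcard _ _ _, fun δ hδ => ?_⟩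
      obtain ⟨l, -, rfl⟩ := Finset.mem_image.mp hδ
      have := hj l
      simp only [← mul_smul] at this ⊢
      simpa [mul_assoc] using this
    · push Not at hcond
      obtain ⟨t, ht, hm', hle, hne⟩ := hcond
      have hts : t * s ∈ T * (T * T) := Finset.mul_mem_mul ht hs
      have hsG := (hGmem s (by rw [mul_assoc]; exact hsT3)).1
      have htsG := (hGmem (t * s) (by rw [mul_assoc]; exact hts)).2
      have hback : ∀ t' : Γ, (t' * (t * s * γ⁻¹ * (t * s)⁻¹)) • (t * (s * γ * s⁻¹)) • s • y =
          (t' * t) • s • y := by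
        intro t'
        simp only [← mul_smul]
        congr 1
        group
      choose j hj using hwit _ hm' _ htsG (by
        intro t' ht' hm'' hle'
        rw [hback] at hm'' hle' ⊢
        exfalso
        have h1 := hMdisc _ hsM _ (Finset.mul_mem_mul ht' ht) hm''
        rw [h1, one_smul] at hle'
        exact hne (hclne _ t ht _ hsG (le_antisymm hle' hle)))
      refine ⟨_, hsub (cl ((t * (s * γ * s⁻¹)) • s • y)) (t * s) j hts, hcard _ _ _, fun δ hδ => ?_⟩
      obtain ⟨l, -, rfl⟩ := Finset.mem_image.mp hδ
      have h1 := hj l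
      rw [hback] at h1
      simp only [← mul_smul] at h1 ⊢
      simpa [mul_assoc] using h1.symm

end Stage

section InitialColoring

variable {Γ : Type} [Group Γ] [DecidableEq Γ] {F : Finset Γ} {ℓ : ℕ} {β : Type*}

lemma NonconstantRule.finite_exceptional (R : NonconstantRule F ℓ β) : R.exceptional.Finite := by
  have : R.exceptional ⊆ ⋃ e ∈ {e | e ∈ R.inter ∧ FiniteClass e}, {x | ∃ u, x = u * e * u⁻¹} := by
    rintro γ ⟨hγ, u, hu⟩
    simp only [Set.mem_iUnion, Set.mem_ofPred_eq]
    refine ⟨u * γ * u⁻¹, ⟨hu, ?_⟩, u⁻¹, by group⟩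
    by_contra h
    refine not_finiteClass_conj h u⁻¹ ?_
    rwa [show u⁻¹ * (u * γ * u⁻¹) * u⁻¹⁻¹ = γ by group]
  refine Set.Finite.subset (Set.Finite.biUnion ?_ fun e he => he.2.finite_conj) this
  exact R.inter.finite_toSet.subset fun e he => he.1

lemma NonconstantRule.conj_mem_exceptional (R : NonconstantRule F ℓ β) {γ : Γ}
    (hγ : γ ∈ R.exceptional) (u : Γ) : u * γ * u⁻¹ ∈ R.exceptional := by
  obtain ⟨h, v, hv⟩ := hγ
  refine ⟨?_, v * u⁻¹, ?_⟩
  · by_contra hcon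
    refine not_finiteClass_conj hcon u⁻¹ ?_
    rwa [show u⁻¹ * (u * γ * u⁻¹) * u⁻¹⁻¹ = γ by group]
  · rwa [show v * u⁻¹ * (u * γ * u⁻¹) * (v * u⁻¹)⁻¹ = v * γ * v⁻¹ by group]

variable [Infinite Γ]

/-- A new witness against invariance under an element of finite class can be planted away from any
given finite set. -/
lemma NonconstantRule.exists_new_witness (R : NonconstantRule F ℓ β)
    (hFsym : ∀ σ ∈ F, σ⁻¹ ∈ F) (hF1 : (1 : Γ) ∉ F) (hℓ : F.card + 1 ≤ ℓ) {g : Γ}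
    (hg : FiniteClass g)
    (hw : ∃ w ∈ properCol F ℓ, ∃ δ, R.rule (shiftAct δ w) ≠ R.rule (shiftAct (δ * g) w))
    {x : Γ → Fin ℓ} (hx : x ∈ properCol F ℓ) (T A : Finset Γ) :
    ∃ x' ∈ properCol F ℓ, (∀ t ∈ T, x' t = x t) ∧
      ∃ b ∉ A, R.rule (shiftAct b x') ≠ R.rule (shiftAct (b * g) x') := by
  obtain ⟨w, hw, δ, hδ⟩ := hw
  obtain ⟨v, hv, hvg⟩ := hg.exists_commute
    ((R.window * {δ, δ * g} ∪ F * (R.window * {δ, δ * g}))⁻¹ * T ∪ {δ}⁻¹ * A)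
  simp only [Finset.notMem_union] at hv
  obtain ⟨x', hx', hon, hoff⟩ := exists_properCol_patch hFsym hF1 hℓ hx
    (shiftAct_mem_properCol hw v⁻¹) (R.window * {δ, δ * g} * {v})
  have hval : ∀ d ∈ ({δ, δ * g} : Finset Γ),
      R.rule (shiftAct (d * v) x') = R.rule (shiftAct d w) := fun d hd =>
    R.rule_congr _ _ fun κ hκ => by
      simp only [shiftAct]
      rw [← mul_assoc, hon _ (Finset.mul_mem_mul (Finset.mul_mem_mul hκ hd)
        (Finset.mem_singleton_self v))]
      simp [shiftAct]
  refine ⟨x', hx', fun t ht => hoff t fun hmem => hv.1 ?_, δ * v, fun hA => hv.2 ?_, ?_⟩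
  · rw [← mul_assoc, ← Finset.union_mul] at hmem
    obtain ⟨k, hk, v', hv', rfl⟩ := Finset.mem_mul.mp hmem
    rw [Finset.mem_singleton] at hv'
    subst hv'
    have := Finset.mul_mem_mul (Finset.inv_mem_inv hk) ht
    rwa [inv_mul_cancel_left] at this
  · have := Finset.mul_mem_mul (Finset.inv_mem_inv (Finset.mem_singleton_self δ)) hA
    rwa [inv_mul_cancel_left] at this
  · rw [mul_assoc, hvg, ← mul_assoc, hval δ (by simp), hval (δ * g) (by simp)]
    exact hδ

lemma NonconstantRule.exists_witnesses_of_finiteClass (R : NonconstantRule F ℓ β)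
    (hFsym : ∀ σ ∈ F, σ⁻¹ ∈ F) (hF1 : (1 : Γ) ∉ F) (hℓ : F.card + 1 ≤ ℓ) {g : Γ}
    (hg : FiniteClass g)
    (hw : ∃ w ∈ properCol F ℓ, ∃ δ, R.rule (shiftAct δ w) ≠ R.rule (shiftAct (δ * g) w))
    {x : Γ → Fin ℓ} (hx : x ∈ properCol F ℓ) (T : Finset Γ) (n : ℕ) :
    ∃ x' ∈ properCol F ℓ, (∀ t ∈ T, x' t = x t) ∧ ∃ S : Finset Γ, S.card = n ∧
      ∀ b ∈ S, R.rule (shiftAct b x') ≠ R.rule (shiftAct (b * g) x') := by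
  induction n with
  | zero => exact ⟨x, hx, fun _ _ => rfl, ∅, rfl, by simp⟩
  | succ n ih =>
    obtain ⟨x₁, hx₁, hT₁, S, hS, hwit⟩ := ih
    obtain ⟨x₂, hx₂, hT₂, b, hb, hbwit⟩ := R.exists_new_witness hFsym hF1 hℓ hg hw hx₁
      (T ∪ S.biUnion fun b => R.window * {b, b * g}) S
    refine ⟨x₂, hx₂, fun t ht => (hT₂ t (Finset.mem_union_left _ ht)).trans (hT₁ t ht),
      insert b S, by rw [Finset.card_insert_of_notMem hb, hS], fun d hd => ?_⟩
    rcases Finset.mem_insert.mp hd with rfl | hd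
    · exact hbwit
    · exact (R.ne_congr _ _ _ _ fun κ hκ => hT₂ κ (Finset.mem_union_right _
        (Finset.mem_biUnion.mpr ⟨d, hd, hκ⟩))).mpr (hwit d hd)

/-- A coloring with many witnesses against invariance under finitely many elements of finite
class. -/
lemma NonconstantRule.exists_pattern (R : NonconstantRule F ℓ β)
    (hFsym : ∀ σ ∈ F, σ⁻¹ ∈ F) (hF1 : (1 : Γ) ∉ F) (hℓ : F.card + 1 ≤ ℓ) (G : Finset Γ)
    (hG : ∀ g ∈ G, FiniteClass g)
    (hw : ∀ g ∈ G, ∃ w ∈ properCol F ℓ, ∃ δ,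
      R.rule (shiftAct δ w) ≠ R.rule (shiftAct (δ * g) w)) (n : ℕ) :
    ∃ x ∈ properCol F ℓ, ∃ S : Γ → Finset Γ, ∀ g ∈ G, (S g).card = n ∧
      ∀ b ∈ S g, R.rule (shiftAct b x) ≠ R.rule (shiftAct (b * g) x) := by
  induction G using Finset.induction_on with
  | empty => exact ⟨_, R.pattern_mem true, fun _ => ∅, by simp⟩
  | insert g G hgG ih =>
    obtain ⟨x₁, hx₁, S, hS⟩ := ih (fun g' hg' => hG g' (Finset.mem_insert_of_mem hg'))
      (fun g' hg' => hw g' (Finset.mem_insert_of_mem hg'))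
    obtain ⟨x₂, hx₂, hT, S', hS', hwit⟩ := R.exists_witnesses_of_finiteClass hFsym hF1 hℓ
      (hG g (Finset.mem_insert_self _ _)) (hw g (Finset.mem_insert_self _ _)) hx₁
      (G.biUnion fun g => (S g).biUnion fun b => R.window * {b, b * g}) n
    refine ⟨x₂, hx₂, Function.update S g S', fun g' hg' => ?_⟩
    by_cases h : g' = g
    · subst h
      simpa using ⟨hS', hwit⟩
    · have hg'' := (Finset.mem_insert.mp hg').resolve_left h
      rw [Function.update_of_ne h]
      refine ⟨(hS g' hg'').1, fun b hb => ?_⟩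
      exact (R.ne_congr _ _ _ _ fun κ hκ => hT κ (Finset.mem_biUnion.mpr ⟨g', hg'',
        Finset.mem_biUnion.mpr ⟨b, hb, hκ⟩⟩)).mpr ((hS g' hg'').2 b hb)

/-- An initial coloring with many witnesses against invariance under finitely many elements of
finite class. -/
lemma exists_initial_coloring [Countable Γ] (hFsym : ∀ σ ∈ F, σ⁻¹ ∈ F) (hF1 : (1 : Γ) ∉ F)
    (hℓ : F.card + 1 ≤ ℓ) (R : NonconstantRule F ℓ β) (G : Finset Γ)
    (hG : ∀ g ∈ G, FiniteClass g)
    (hconj : ∀ g ∈ G, ∀ u, u * g * u⁻¹ ∈ G)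
    (hw : ∀ g ∈ G, ∃ w ∈ properCol F ℓ, ∃ δ,
      R.rule (shiftAct δ w) ≠ R.rule (shiftAct (δ * g) w)) (W : ℕ) :
    ∃ D : Finset Γ, ∀ (X : Type) [MeasurableSpace X] [MeasurableSpace.CountablySeparated X]
      [MulAction Γ X] [MeasurableConstSMul Γ X], (∀ (γ : Γ) (x : X), γ • x = x → γ = 1) →
      ∃ c : X → Fin ℓ, Measurable c ∧ (∀ x, ∀ σ ∈ F, c x ≠ c (σ • x)) ∧
        ∀ g ∈ G, ∀ y : X, ∃ S ⊆ D, W < S.card ∧ ∀ δ ∈ S,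
          R.rule (colView c (δ • y)) ≠ R.rule (colView c ((δ * g) • y)) := by
  obtain ⟨w, hwcol, S, hS⟩ := R.exists_pattern hFsym hF1 hℓ G hG hw (W + 1)
  obtain ⟨Λ₀, hΛ₀⟩ : ∃ Λ₀ : Finset Γ, ∀ g ∈ G, ∀ b ∈ S g, ∀ κ ∈ R.window,
      κ * b ∈ Λ₀ ∧ κ * (b * g) ∈ Λ₀ := by
    refine ⟨G.biUnion fun g => (S g).biUnion fun b => R.window * {b, b * g},
      fun g hg b hb κ hκ => ⟨?_, ?_⟩⟩ <;>
    exact Finset.mem_biUnion.mpr ⟨g, hg, Finset.mem_biUnion.mpr ⟨b, hb,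
      Finset.mul_mem_mul hκ (by simp)⟩⟩
  obtain ⟨T, hT1, hTsym, hT⟩ : ∃ T : Finset Γ, 1 ∈ T ∧ (∀ t ∈ T, t⁻¹ ∈ T) ∧
      ∀ δ ∈ Λ₀ ∪ F * Λ₀, ∀ δ' ∈ Λ₀ ∪ F * Λ₀, ∀ τ, (τ = 1 ∨ τ ∈ F) → δ'⁻¹ * τ * δ ∈ T := by
    let T₀ := insert 1 ((Λ₀ ∪ F * Λ₀)⁻¹ * insert 1 F * (Λ₀ ∪ F * Λ₀))
    refine ⟨T₀ ∪ T₀⁻¹, by simp [T₀], fun t ht => ?_, fun δ hδ δ' hδ' τ hτ => ?_⟩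
    · simp only [Finset.mem_union, Finset.mem_inv', inv_inv] at ht ⊢
      exact ht.symm
    · exact Finset.mem_union_left _ (Finset.mem_insert_of_mem (Finset.mul_mem_mul
        (Finset.mul_mem_mul (Finset.inv_mem_inv hδ') (Finset.mem_insert.mpr hτ)) hδ))
  refine ⟨G.biUnion S * T, ?_⟩
  intro X _ _ _ _ hfree
  obtain ⟨c₀, hc₀, hc₀F⟩ := exists_measurable_fin_coloring (X := X) hfree F hF1 hFsym hℓ
  obtain ⟨M, hM, hMdisc, hMmax⟩ := exists_measurable_maximal_discrete (X := X) hfree T hT1 hTsym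
  obtain ⟨c, hc, hcF, hcw, -⟩ := exists_measurable_recoloring hfree hc₀ hc₀F hM (Λ₀ ∪ F * Λ₀)
    (by
      intro a ha a' ha' δ hδ δ' hδ' τ hτ h
      have h1 : a' = (δ'⁻¹ * τ * δ) • a := by
        rw [mul_smul, mul_smul, ← h, inv_smul_smul]
      have h2 := hMdisc a ha _ (hT δ hδ δ' hδ' τ hτ) (h1 ▸ ha')
      rw [h1, h2, one_smul])
    (p := {x | ∀ κ ∈ Λ₀, x κ = w κ})
    (measurableSet_of_congr_on_finset Λ₀ fun u v huv =>
      forall₂_congr fun κ hκ => by rw [huv κ hκ])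
    (by
      intro a _
      obtain ⟨x', hx', hon, hoff⟩ :=
        exists_properCol_patch hFsym hF1 hℓ (colView_mem_properCol hc₀F a) hwcol Λ₀
      exact ⟨x', hon, hx', hoff⟩)
  refine ⟨c, hc, hcF, fun g hg y => ?_⟩
  obtain ⟨s, hs, hsM⟩ := hMmax y
  obtain ⟨x', hx', hcx', -⟩ := hcw _ hsM
  have hval : ∀ d, (∀ κ ∈ R.window, κ * d ∈ Λ₀) →
      R.rule (colView c (d • s • y)) = R.rule (shiftAct d w) := fun d hd =>
    R.rule_congr _ _ fun κ hκ => by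
      simp only [colView, shiftAct]
      rw [← mul_smul, hcx' _ (Finset.mem_union_left _ (hd κ hκ)), hx' _ (hd κ hκ)]
  have hg' := hconj g hg s
  refine ⟨S (s * g * s⁻¹) * {s}, Finset.mul_subset_mul
    (Finset.subset_biUnion_of_mem S hg') (Finset.singleton_subset_iff.mpr hs), ?_, ?_⟩
  · rw [Finset.card_mul_singleton, (hS _ hg').1]
    omega
  · intro δ hδ
    obtain ⟨b, hb, s', hs', rfl⟩ := Finset.mem_mul.mp hδ
    rw [Finset.mem_singleton] at hs'
    subst hs'
    have h1 := (hS _ hg').2 b hb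
    rw [← hval b fun κ hκ => (hΛ₀ _ hg' b hb κ hκ).1,
      ← hval _ fun κ hκ => (hΛ₀ _ hg' b hb κ hκ).2] at h1
    simp only [← mul_smul] at h1
    simpa [mul_assoc] using h1

end InitialColoring

section Iteration

variable {Γ : Type} [Group Γ] [DecidableEq Γ] {F : Finset Γ} {ℓ : ℕ} {β : Type*}

/-- The requirement on the set `D` of possible witnesses against `γ` for one round of recoloring
that is allowed to use cells in `C`-translates and keeps distinct cells `V`-apart. -/
def NonconstantRule.IsStage (R : NonconstantRule F ℓ β) (V C : Finset Γ) (γ : Γ) (W : ℕ)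
    (D : Finset Γ) : Prop :=
  ∀ (X : Type) [MeasurableSpace X] [MeasurableSpace.CountablySeparated X]
    [MulAction Γ X] [MeasurableConstSMul Γ X], (∀ (γ : Γ) (x : X), γ • x = x → γ = 1) →
    ∀ c : X → Fin ℓ, Measurable c → (∀ x, ∀ σ ∈ F, c x ≠ c (σ • x)) →
    ∀ B : Set X, MeasurableSet B → (∀ x : X, ∃ a ∈ C, a • x ∉ B) →
    ∃ (c' : X → Fin ℓ) (Z : Set X), Measurable c' ∧ (∀ x, ∀ σ ∈ F, c' x ≠ c' (σ • x)) ∧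
      MeasurableSet Z ∧ Disjoint Z B ∧ (∀ z ∈ Z, ∀ v ∈ V, v • z ∈ Z → v • z = z) ∧
      (∀ x, c' x ≠ c x → ∃ κ ∈ R.nbhd, κ⁻¹ • x ∈ Z) ∧
      (γ ∉ R.exceptional → ∀ y : X, ∃ S ⊆ D, W < S.card ∧ ∀ δ ∈ S,
        R.rule (colView c' (δ • y)) ≠ R.rule (colView c' ((δ * γ) • y)))

lemma exists_isStage [Countable Γ] [Infinite Γ] (hFsym : ∀ σ ∈ F, σ⁻¹ ∈ F) (hF1 : (1 : Γ) ∉ F)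
    (hℓ : F.card + 1 ≤ ℓ) (R : NonconstantRule F ℓ β) (V C : Finset Γ) (γ : Γ) (W : ℕ) :
    ∃ D, R.IsStage V C γ W D := by
  by_cases hγ : γ ∈ R.exceptional
  · refine ⟨∅, fun X _ _ _ _ _ c hc hcF B _ _ => ⟨c, ∅, hc, hcF, MeasurableSet.empty, by simp,
      by simp, fun x hx => (hx rfl).elim, fun h => (h hγ).elim⟩⟩
  · obtain ⟨D, hD⟩ := exists_stage hFsym hF1 hℓ R V C γ hγ W
    refine ⟨D, fun X _ _ _ _ hfree c hc hcF B hB hCB => ?_⟩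
    obtain ⟨c', Z, h1, h2, h3, h4, h5, h6, h7⟩ := hD X hfree c hc hcF B hB hCB
    exact ⟨c', Z, h1, h2, h3, h4, h5, h6, fun _ => h7⟩

/-- All elements by which a cell spoiling a possible witness in `D` can differ from the base
point. -/
def NonconstantRule.spoil (R : NonconstantRule F ℓ β) (γ : Γ) (D : Finset Γ) : Finset Γ :=
  R.inter * (D ∪ D * {γ})

/-- The parameters of an infinite sequence of rounds, chosen independently of the action. -/
structure NonconstantRule.Schedule (R : NonconstantRule F ℓ β) (W : ℕ) (V₀ : Finset Γ)
    (γ : ℕ → Γ) where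
  /-- Separation of cells in each round. -/
  V : ℕ → Finset Γ
  /-- Translates among which an allowed cell can be found. -/
  C : ℕ → Finset Γ
  /-- Translates used to enlarge `C`. -/
  b : ℕ → Γ
  /-- Possible positions of witnesses. -/
  D : ℕ → Finset Γ
  subset_V_zero : V₀ ⊆ V 0
  C_zero : C 0 = {1}
  b_ne : ∀ n, ∀ a ∈ C n, ∀ a' ∈ C n, ∀ v ∈ V n, ∀ v' ∈ V n, b n ≠ a'⁻¹ * v' * v⁻¹ * a
  C_succ : ∀ n, C (n + 1) = C n ∪ C n * {b n}
  V_succ : ∀ n, V n ⊆ V (n + 1)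
  spoil_subset : ∀ n, R.spoil (γ n) (D n) * (R.spoil (γ n) (D n))⁻¹ ⊆ V (n + 1)
  isStage : ∀ n, R.IsStage (V n ∪ (V n)⁻¹ * C n * {b n} * (C n)⁻¹ * V n) (C n) (γ n) W (D n)

lemma NonconstantRule.nonempty_schedule [Countable Γ] [Infinite Γ] (hFsym : ∀ σ ∈ F, σ⁻¹ ∈ F)
    (hF1 : (1 : Γ) ∉ F) (hℓ : F.card + 1 ≤ ℓ) (R : NonconstantRule F ℓ β) (W : ℕ)
    (V₀ : Finset Γ) (γ : ℕ → Γ) : Nonempty (R.Schedule W V₀ γ) := by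
  choose b hb using fun s : Finset Γ × Finset Γ =>
    Infinite.exists_notMem_finset (s.2⁻¹ * s.1 * s.1⁻¹ * s.2)
  choose D hD using fun (s : Finset Γ × Finset Γ) (n : ℕ) =>
    exists_isStage hFsym hF1 hℓ R (s.1 ∪ s.1⁻¹ * s.2 * {b s} * s.2⁻¹ * s.1) s.2 (γ n) W
  let s : ℕ → Finset Γ × Finset Γ := fun n => Nat.rec (V₀, {1}) (fun n s =>
    (s.1 ∪ R.spoil (γ n) (D s n) * (R.spoil (γ n) (D s n))⁻¹, s.2 ∪ s.2 * {b s})) n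
  exact ⟨{
    V := fun n => (s n).1
    C := fun n => (s n).2
    b := fun n => b (s n)
    D := fun n => D (s n) n
    subset_V_zero := subset_rfl
    C_zero := rfl
    b_ne := fun n a ha a' ha' v hv v' hv' h => hb (s n) (by
      rw [h]
      exact Finset.mul_mem_mul (Finset.mul_mem_mul (Finset.mul_mem_mul
        (Finset.inv_mem_inv ha') hv') (Finset.inv_mem_inv hv)) ha)
    C_succ := fun n => rfl
    V_succ := fun n => Finset.subset_union_left
    spoil_subset := fun n => Finset.subset_union_right
    isStage := fun n => hD (s n) n }⟩

/-- The colorings and cells produced by a schedule. -/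
structure NonconstantRule.Run (R : NonconstantRule F ℓ β) (W : ℕ) (V : ℕ → Finset Γ)
    (γ : ℕ → Γ) (D : ℕ → Finset Γ) (X : Type) [MulAction Γ X] [MeasurableSpace X]
    (c₀ : X → Fin ℓ) where
  /-- The colorings. -/
  c : ℕ → X → Fin ℓ
  /-- The cells near which the coloring changes. -/
  Z : ℕ → Set X
  c_zero : c 0 = c₀
  measurable_c : ∀ n, Measurable (c n)
  proper : ∀ n, ∀ x, ∀ σ ∈ F, c n x ≠ c n (σ • x)
  sep : ∀ n, ∀ z ∈ Z n, ∀ v ∈ V n, v • z ∈ Z n → v • z = z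
  sep_of_lt : ∀ j k, j < k → ∀ z ∈ Z j, ∀ v ∈ V j, v • z ∉ Z k
  change : ∀ n x, c (n + 1) x ≠ c n x → ∃ κ ∈ R.nbhd, κ⁻¹ • x ∈ Z n
  witnesses : ∀ n, γ n ∉ R.exceptional → ∀ y : X, ∃ S ⊆ D n, W < S.card ∧ ∀ δ ∈ S,
    R.rule (colView (c (n + 1)) (δ • y)) ≠ R.rule (colView (c (n + 1)) ((δ * γ n) • y))

lemma NonconstantRule.Schedule.nonempty_run {R : NonconstantRule F ℓ β} {W : ℕ}
    {V₀ : Finset Γ} {γ : ℕ → Γ} (s : R.Schedule W V₀ γ) (X : Type) [MeasurableSpace X]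
    [MeasurableSpace.CountablySeparated X] [MulAction Γ X] [MeasurableConstSMul Γ X]
    (hfree : ∀ (γ : Γ) (x : X), γ • x = x → γ = 1) (c₀ : X → Fin ℓ) (hc₀ : Measurable c₀)
    (hc₀F : ∀ x, ∀ σ ∈ F, c₀ x ≠ c₀ (σ • x)) :
    Nonempty (R.Run W s.V γ s.D X c₀) := by
  let P : ℕ → (X → Fin ℓ) × Set X → Prop := fun n p => Measurable p.1 ∧
    (∀ x, ∀ σ ∈ F, p.1 x ≠ p.1 (σ • x)) ∧ MeasurableSet p.2 ∧ ∀ x : X, ∃ a ∈ s.C n, a • x ∉ p.2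
  have hstep : ∀ n (p : {p // P n p}), ∃ q : {p // P (n + 1) p}, ∃ Z : Set X,
      q.1.2 = p.1.2 ∪ {x | ∃ v ∈ s.V n, v⁻¹ • x ∈ Z} ∧ Disjoint Z p.1.2 ∧
      (∀ z ∈ Z, ∀ v ∈ s.V n, v • z ∈ Z → v • z = z) ∧
      (∀ x, q.1.1 x ≠ p.1.1 x → ∃ κ ∈ R.nbhd, κ⁻¹ • x ∈ Z) ∧
      (γ n ∉ R.exceptional → ∀ y : X, ∃ S ⊆ s.D n, W < S.card ∧ ∀ δ ∈ S,
        R.rule (colView q.1.1 (δ • y)) ≠ R.rule (colView q.1.1 ((δ * γ n) • y))) := by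
    rintro n ⟨⟨c, B⟩, hc, hcF, hB, hCB⟩
    obtain ⟨c', Z, hc', hcF', hZ, hZB, hsep, hch, hwit⟩ :=
      s.isStage n X hfree c hc hcF B hB hCB
    refine ⟨⟨(c', B ∪ {x | ∃ v ∈ s.V n, v⁻¹ • x ∈ Z}), hc', hcF', hB.union ?_, fun x => ?_⟩,
      Z, rfl, hZB, fun z hz v hv => hsep z hz v (Finset.mem_union_left _ hv), hch, hwit⟩
    · have : {x : X | ∃ v ∈ s.V n, v⁻¹ • x ∈ Z} = ⋃ v ∈ s.V n, {x | v⁻¹ • x ∈ Z} := by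
        ext x
        simp
      rw [this]
      exact Finset.measurableSet_biUnion _ fun v _ => measurableSet_smul_preimage hZ _
    · obtain ⟨a, ha, hax⟩ := hCB x
      obtain ⟨a', ha', hax'⟩ := hCB (s.b n • x)
      rw [← mul_smul] at hax'
      simp only [s.C_succ]
      by_contra! hcon
      have h1 := (hcon a (Finset.mem_union_left _ ha)).resolve_left hax
      have h2 := (hcon (a' * s.b n) (Finset.mem_union_right _
        (Finset.mul_mem_mul ha' (Finset.mem_singleton_self _)))).resolve_left hax'
      obtain ⟨v, hv, hz⟩ := h1
      obtain ⟨v', hv', hz'⟩ := h2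
      have heq : v'⁻¹ • (a' * s.b n) • x = (v'⁻¹ * a' * s.b n * a⁻¹ * v) • v⁻¹ • a • x := by
        simp only [← mul_smul]
        congr 1
        group
      have hmem : v'⁻¹ * a' * s.b n * a⁻¹ * v ∈ (s.V n)⁻¹ * s.C n * {s.b n} * (s.C n)⁻¹ * s.V n :=
        Finset.mul_mem_mul (Finset.mul_mem_mul (Finset.mul_mem_mul (Finset.mul_mem_mul
          (Finset.inv_mem_inv hv') ha') (Finset.mem_singleton_self _)) (Finset.inv_mem_inv ha)) hv
      have h3 := hfree _ _ (hsep _ hz _ (Finset.mem_union_right _ hmem) (heq ▸ hz'))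
      refine s.b_ne n a ha a' ha' v hv v' hv' ?_
      calc s.b n = a'⁻¹ * v' * (v'⁻¹ * a' * s.b n * a⁻¹ * v) * v⁻¹ * a := by group
        _ = _ := by rw [h3, mul_one]
  choose q Z hq using hstep
  let p : ∀ n, {p // P n p} := fun n => Nat.rec ⟨(c₀, ∅), hc₀, hc₀F, MeasurableSet.empty,
    fun x => ⟨1, by rw [s.C_zero]; simp, by simp⟩⟩ (fun n p => q n p) n
  have hmono : ∀ j k, j ≤ k → (p j).1.2 ⊆ (p k).1.2 := by
    intro j k hjk
    induction k, hjk using Nat.le_induction with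
    | base => exact subset_rfl
    | succ k _ ih =>
      refine ih.trans ?_
      rw [show p (k + 1) = q k (p k) from rfl, (hq k (p k)).1]
      exact Set.subset_union_left
  exact ⟨{
    c := fun n => (p n).1.1
    Z := fun n => Z n (p n)
    c_zero := rfl
    measurable_c := fun n => (p n).2.1
    proper := fun n => (p n).2.2.1
    sep := fun n => (hq n (p n)).2.2.1
    sep_of_lt := fun j k hjk z hz v hv hk => Set.disjoint_left.mp (hq k (p k)).2.1 hk
      (hmono (j + 1) k hjk (by
        rw [show p (j + 1) = q j (p j) from rfl, (hq j (p j)).1]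
        exact Or.inr ⟨v, hv, by rwa [inv_smul_smul]⟩))
    change := fun n => (hq n (p n)).2.2.2.1
    witnesses := fun n => (hq n (p n)).2.2.2.2 }⟩

end Iteration

section Limit

variable {Γ : Type} [Group Γ] [DecidableEq Γ] {F : Finset Γ} {ℓ : ℕ} {β : Type*}
  {R : NonconstantRule F ℓ β} {W : ℕ} {V : ℕ → Finset Γ} {γ : ℕ → Γ} {D : ℕ → Finset Γ}
  {X : Type} [MulAction Γ X] [MeasurableSpace X] {c₀ : X → Fin ℓ}

lemma NonconstantRule.Run.cell_eq (r : R.Run W V γ D X c₀) (hV : Monotone V) {n j k : ℕ}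
    (hj : n ≤ j) (hk : n ≤ k) {v : Γ} (hv : v ∈ V n) (hv' : v⁻¹ ∈ V n) {z : X} (hz : z ∈ r.Z j)
    (hz' : v • z ∈ r.Z k) : j = k ∧ v • z = z := by
  rcases lt_trichotomy j k with h | h | h
  · exact (r.sep_of_lt j k h z hz v (hV hj hv) hz').elim
  · subst h
    exact ⟨rfl, r.sep j z hz v (hV hj hv) hz'⟩
  · refine (r.sep_of_lt k j h _ hz' v⁻¹ (hV hk hv') ?_).elim
    rwa [inv_smul_smul]

lemma NonconstantRule.Run.exists_change (r : R.Run W V γ D X c₀) {n N : ℕ} (h : n ≤ N) {x : X}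
    (hx : r.c N x ≠ r.c n x) : ∃ j ≥ n, r.c (j + 1) x ≠ r.c j x := by
  by_contra! hcon
  induction N, h using Nat.le_induction with
  | base => exact hx rfl
  | succ N hN ih => exact ih (by rwa [← hcon N hN])

lemma NonconstantRule.Run.exists_stable (r : R.Run W V γ D X c₀) (hV : Monotone V)
    (hV0 : ∀ κ ∈ R.nbhd, ∀ κ' ∈ R.nbhd, κ'⁻¹ * κ ∈ V 0) (x : X) :
    ∃ N, ∀ n ≥ N, r.c n x = r.c N x := by
  by_cases h : ∃ j, r.c (j + 1) x ≠ r.c j x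
  · obtain ⟨j, hj⟩ := h
    refine ⟨j + 1, fun n hn => ?_⟩
    by_contra hne
    obtain ⟨k, hk, hkx⟩ := r.exists_change hn hne
    obtain ⟨κ, hκ, hz⟩ := r.change j x hj
    obtain ⟨κ', hκ', hz'⟩ := r.change k x hkx
    have := (r.cell_eq hV (Nat.zero_le j) (Nat.zero_le k) (v := κ'⁻¹ * κ) (hV0 κ hκ κ' hκ')
      (by rw [mul_inv_rev, inv_inv]; exact hV0 κ' hκ' κ hκ) hz
      (by rwa [mul_smul, smul_inv_smul])).1
    omega
  · push Not at h
    refine ⟨0, fun n _ => ?_⟩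
    by_contra hne
    obtain ⟨k, -, hk⟩ := r.exists_change (Nat.zero_le n) hne
    exact hk (h k)

/-- The colorings of a run converge pointwise. -/
lemma NonconstantRule.Run.exists_limit (r : R.Run W V γ D X c₀) (hV : Monotone V)
    (hV0 : ∀ κ ∈ R.nbhd, ∀ κ' ∈ R.nbhd, κ'⁻¹ * κ ∈ V 0) :
    ∃ c : X → Fin ℓ, Measurable c ∧ (∀ x, ∀ σ ∈ F, c x ≠ c (σ • x)) ∧
      ∀ n x, c x ≠ r.c n x → ∃ j ≥ n, ∃ κ ∈ R.nbhd, κ⁻¹ • x ∈ r.Z j := by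
  choose N hN using r.exists_stable hV hV0
  refine ⟨fun x => r.c (N x) x, measurable_to_countable' fun i => ?_, fun x σ hσ => ?_,
    fun n x hx => ?_⟩
  · have : (fun x => r.c (N x) x) ⁻¹' {i} = ⋃ n, ⋂ m ≥ n, r.c m ⁻¹' {i} := by
      ext x
      simp only [Set.mem_preimage, Set.mem_singleton_iff, Set.mem_iUnion, Set.mem_iInter]
      refine ⟨fun h => ⟨N x, fun m hm => (hN x m hm).trans h⟩, fun ⟨n, hn⟩ => ?_⟩
      rw [← hn _ (le_max_left n (N x)), hN x _ (le_max_right n (N x))]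
    rw [this]
    exact MeasurableSet.iUnion fun n => MeasurableSet.iInter fun m => MeasurableSet.iInter
      fun _ => r.measurable_c m (measurableSet_singleton i)
  · have := r.proper (max (N x) (N (σ • x))) x σ hσ
    rwa [hN x _ (le_max_left _ _), hN (σ • x) _ (le_max_right _ _)] at this
  · change r.c (N x) x ≠ _ at hx
    rw [← hN x _ (le_max_right n (N x))] at hx
    obtain ⟨j, hj, hjx⟩ := r.exists_change (le_max_left _ _) hx
    exact ⟨j, hj, r.change j x hjx⟩

/-- All but few of the witnesses present at some time survive. -/
lemma NonconstantRule.Run.exists_surviving_witness (r : R.Run W V γ D X c₀) (hV : Monotone V)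
    (hfree : ∀ (γ : Γ) (x : X), γ • x = x → γ = 1) {c : X → Fin ℓ}
    (hc : ∀ n x, c x ≠ r.c n x → ∃ j ≥ n, ∃ κ ∈ R.nbhd, κ⁻¹ • x ∈ r.Z j) {n : ℕ} {g : Γ}
    {D₀ S : Finset Γ} (hn : R.spoil g D₀ * (R.spoil g D₀)⁻¹ ⊆ V n) (hS : S ⊆ D₀)
    (hcard : R.inter.card * 2 < S.card) {y : X}
    (hwit : ∀ δ ∈ S, R.rule (colView (r.c n) (δ • y)) ≠ R.rule (colView (r.c n) ((δ * g) • y))) :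
    ∃ δ ∈ D₀, R.rule (colView c (δ • y)) ≠ R.rule (colView c ((δ * g) • y)) := by
  by_contra! hcon
  have hval : ∀ d : Γ, (∀ e ∈ R.inter, ∀ j ≥ n, (e * d) • y ∉ r.Z j) →
      R.rule (colView c (d • y)) = R.rule (colView (r.c n) (d • y)) := by
    intro d hd
    refine R.rule_congr _ _ fun κ hκ => ?_
    by_contra hne
    obtain ⟨j, hj, κ', hκ', hz⟩ := hc n _ hne
    refine hd _ (R.inv_mem_inter (R.inv_mul_mem_inter hκ hκ')) j hj ?_
    rwa [mul_inv_rev, inv_inv, mul_smul, mul_smul]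
  have hspoil : ∀ δ ∈ S, ∃ d, (d = δ ∨ d = δ * g) ∧ ∃ e ∈ R.inter, ∃ j ≥ n,
      (e * d) • y ∈ r.Z j := by
    intro δ hδ
    by_contra! h
    refine hwit δ hδ ?_
    rw [← hval δ (h δ (Or.inl rfl)), ← hval _ (h _ (Or.inr rfl))]
    exact hcon δ (hS hδ)
  have hmem : ∀ δ ∈ S, ∀ d, (d = δ ∨ d = δ * g) → ∀ e ∈ R.inter, e * d ∈ R.spoil g D₀ := by
    rintro δ hδ d (rfl | rfl) e he
    · exact Finset.mul_mem_mul he (Finset.mem_union_left _ (hS hδ))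
    · exact Finset.mul_mem_mul he (Finset.mem_union_right _
        (Finset.mul_mem_mul (hS hδ) (Finset.mem_singleton_self g)))
  obtain ⟨δ₀, hδ₀⟩ : S.Nonempty := Finset.card_pos.mp (by omega)
  obtain ⟨d₀, hd₀, e₀, he₀, j, hj, hz₀⟩ := hspoil δ₀ hδ₀
  have hsub : S ⊆ R.inter * {e₀ * d₀, e₀ * d₀ * g⁻¹} := by
    intro δ hδ
    obtain ⟨d, hd, e, he, k, hk, hz⟩ := hspoil δ hδ
    have h1 := hmem δ hδ d hd e he
    have h0 := hmem δ₀ hδ₀ d₀ hd₀ e₀ he₀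
    have heq := (r.cell_eq hV hj hk (v := e * d * (e₀ * d₀)⁻¹)
      (hn (Finset.mul_mem_mul h1 (Finset.inv_mem_inv h0)))
      (by rw [mul_inv_rev, inv_inv]; exact hn (Finset.mul_mem_mul h0 (Finset.inv_mem_inv h1)))
      hz₀ (by rwa [← mul_smul, inv_mul_cancel_right])).2
    have heq' : d = e⁻¹ * (e₀ * d₀) :=
      eq_inv_mul_of_mul_eq (mul_inv_eq_one.mp (hfree _ _ heq))
    have he' := R.inv_mem_inter he
    rcases hd with rfl | rfl
    · rw [heq']
      exact Finset.mul_mem_mul he' (by simp)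
    · rw [eq_mul_inv_of_mul_eq heq', mul_assoc e⁻¹]
      exact Finset.mul_mem_mul he' (by simp)
  have := (Finset.card_le_card hsub).trans Finset.card_mul_le
  have h2 : ({e₀ * d₀, e₀ * d₀ * g⁻¹} : Finset Γ).card ≤ 2 := Finset.card_le_two
  have := Nat.mul_le_mul_left R.inter.card h2
  omega

/-- On every free action there is a proper coloring for which, uniformly, the values of the rule
are nowhere invariant under any element that moves them somewhere. -/
lemma exists_nowhere_invariant_coloring [Countable Γ] [Infinite Γ] (hFsym : ∀ σ ∈ F, σ⁻¹ ∈ F)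
    (hF1 : (1 : Γ) ∉ F) (hℓ : F.card + 1 ≤ ℓ) (R : NonconstantRule F ℓ β) :
    ∃ D : Γ → Finset Γ, ∀ (X : Type) [MeasurableSpace X] [MeasurableSpace.CountablySeparated X]
      [MulAction Γ X] [MeasurableConstSMul Γ X], (∀ (γ : Γ) (x : X), γ • x = x → γ = 1) →
      ∃ c : X → Fin ℓ, Measurable c ∧ (∀ x, ∀ σ ∈ F, c x ≠ c (σ • x)) ∧
        ∀ γ, (∃ w ∈ properCol F ℓ, ∃ δ, R.rule (shiftAct δ w) ≠ R.rule (shiftAct (δ * γ) w)) →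
          ∀ y : X, ∃ δ ∈ D γ, R.rule (colView c (δ • y)) ≠ R.rule (colView c ((δ * γ) • y)) := by
  let mv : Set Γ := {γ | ∃ w ∈ properCol F ℓ, ∃ δ,
    R.rule (shiftAct δ w) ≠ R.rule (shiftAct (δ * γ) w)}
  have hmvconj : ∀ g ∈ mv, ∀ u, u * g * u⁻¹ ∈ mv := by
    rintro g ⟨w, hw, δ, hδ⟩ u
    refine ⟨shiftAct u w, shiftAct_mem_properCol hw u, δ * u⁻¹, ?_⟩
    have hcomp : ∀ a b : Γ, shiftAct a (shiftAct b w) = shiftAct (a * b) w := fun a b => by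
      funext κ
      simp [shiftAct, mul_assoc]
    rw [hcomp, hcomp]
    simpa [mul_assoc] using hδ
  have hfin : (R.exceptional ∩ mv).Finite := R.finite_exceptional.inter_of_left _
  obtain ⟨D₀, hD₀⟩ := exists_initial_coloring hFsym hF1 hℓ R hfin.toFinset
    (fun g hg => (hfin.mem_toFinset.mp hg).1.1)
    (fun g hg u => hfin.mem_toFinset.mpr ⟨R.conj_mem_exceptional (hfin.mem_toFinset.mp hg).1 u,
      hmvconj g (hfin.mem_toFinset.mp hg).2 u⟩)
    (fun g hg => (hfin.mem_toFinset.mp hg).2) (R.inter.card * 2)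
  obtain ⟨γ, hγ⟩ := exists_surjective_nat Γ
  obtain ⟨s⟩ := R.nonempty_schedule hFsym hF1 hℓ (R.inter.card * 2)
    (R.nbhd⁻¹ * R.nbhd ∪ hfin.toFinset.biUnion fun g => R.spoil g D₀ * (R.spoil g D₀)⁻¹) γ
  choose idx hidx using hγ
  classical
  refine ⟨fun g => if g ∈ R.exceptional then D₀ else s.D (idx g), ?_⟩
  intro X _ _ _ _ hfree
  obtain ⟨c₀, hc₀, hc₀F, hwit₀⟩ := hD₀ X hfree
  obtain ⟨r⟩ := s.nonempty_run X hfree c₀ hc₀ hc₀F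
  have hV : Monotone s.V := monotone_nat_of_le_succ s.V_succ
  obtain ⟨c, hc, hcF, hch⟩ := r.exists_limit hV fun κ hκ κ' hκ' => s.subset_V_zero
    (Finset.mem_union_left _ (Finset.mul_mem_mul (Finset.inv_mem_inv hκ') hκ))
  refine ⟨c, hc, hcF, fun g hg y => ?_⟩
  by_cases hex : g ∈ R.exceptional
  · simp only [if_pos hex]
    have hmem := hfin.mem_toFinset.mpr ⟨hex, hg⟩
    obtain ⟨S, hS, hcard, hwit⟩ := hwit₀ g hmem y
    refine r.exists_surviving_witness hV hfree hch (n := 0) ?_ hS hcard (by rwa [r.c_zero])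
    exact (Finset.subset_biUnion_of_mem (fun g => R.spoil g D₀ * (R.spoil g D₀)⁻¹) hmem).trans
      (Finset.subset_union_right.trans s.subset_V_zero)
  · simp only [if_neg hex]
    have h1 := r.witnesses (idx g)
    have h2 := s.spoil_subset (idx g)
    rw [hidx] at h1 h2
    obtain ⟨S, hS, hcard, hwit⟩ := h1 hex y
    exact r.exists_surviving_witness hV hfree hch h2 hS hcard hwit

end Limit

section BlockCode

variable {Γ : Type} [Group Γ] {F : Finset Γ} {ℓ m : ℕ}

lemma shiftAct_shiftAct {α : Type*} (a b : Γ) (x : Γ → α) :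
    shiftAct a (shiftAct b x) = shiftAct (a * b) x := by
  funext κ
  simp [shiftAct, mul_assoc]

lemma isClosed_properCol : IsClosed (properCol F ℓ) := by
  classical
  have : properCol F ℓ = ⋂ γ, ⋂ σ ∈ F, {x : Γ → Fin ℓ | x γ ≠ x (σ * γ)} := by
    ext x
    simp [properCol]
  rw [this]
  exact isClosed_iInter fun γ => isClosed_biInter fun σ _ =>
    (isClopen_of_congr_on_finset {γ, σ * γ} fun u v h => by
      rw [h γ (by simp), h (σ * γ) (by simp)]).isClosed

lemma exists_window {π : (Γ → Fin ℓ) → (Γ → Fin m)} (hπ : ContinuousOn π (properCol F ℓ)) :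
    ∃ K : Finset Γ, ∀ x ∈ properCol F ℓ, ∀ y ∈ properCol F ℓ, (∀ κ ∈ K, x κ = y κ) →
      π x 1 = π y 1 := by
  classical
  have hloc : ∀ x : Γ → Fin ℓ, ∃ I : Finset Γ, x ∈ properCol F ℓ → ∀ y ∈ properCol F ℓ,
      (∀ i ∈ I, y i = x i) → π y 1 = π x 1 := by
    intro x
    obtain ⟨u, hu, hux⟩ := continuousOn_iff'.mp hπ _
      ((isOpen_discrete {π x 1}).preimage (continuous_apply (1 : Γ)))
    by_cases hx : x ∈ properCol F ℓ
    · obtain ⟨I, w, hw, hwu⟩ := isOpen_pi_iff.mp hu x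
        (hux.subset ⟨by simp, hx⟩).1
      refine ⟨I, fun _ y hy hyx => ?_⟩
      have : y ∈ u ∩ properCol F ℓ := ⟨hwu fun i hi => by rw [hyx i hi]; exact (hw i hi).2, hy⟩
      exact (hux.symm.subset this).1
    · exact ⟨∅, fun h => (hx h).elim⟩
  choose I hI using hloc
  obtain ⟨t, ht, hcov⟩ := isClosed_properCol.isCompact.elim_nhds_subcover
    (fun x : Γ → Fin ℓ => {y | ∀ i ∈ I x, y i = x i}) fun x _ =>
      (isClopen_of_congr_on_finset (I x) fun u v h => forall₂_congr fun i hi => by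
        rw [h i hi]).isOpen.mem_nhds fun _ _ => rfl
  refine ⟨t.biUnion I, fun x hx y hy hxy => ?_⟩
  obtain ⟨z, hz, hxz⟩ := Set.mem_iUnion₂.mp (hcov hx)
  rw [hI z (ht z hz) x hx hxz, hI z (ht z hz) y hy fun i hi => ?_]
  rw [← hxy i (Finset.mem_biUnion.mpr ⟨z, hz, hi⟩)]
  exact hxz i hi

/-- A continuous equivariant map that is not invariant under the whole group is given by a
nonconstant local rule. -/
lemma exists_nonconstantRule {π : (Γ → Fin ℓ) → (Γ → Fin m)}
    (hπ : ContinuousOn π (properCol F ℓ)) (hequiv : EquivariantOn π (properCol F ℓ)) {γ : Γ}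
    (hγ : γ ∉ mapStab π (properCol F ℓ)) :
    ∃ R : NonconstantRule F ℓ (Set (Fin m)), ∀ x ∈ properCol F ℓ, ∀ a b,
      R.rule (shiftAct a x) ≠ R.rule (shiftAct b x) ↔ π x a ≠ π x b := by
  obtain ⟨K, hK⟩ := exists_window hπ
  let P : (Γ → Fin ℓ) → Set (Fin m) := fun u =>
    {i | ∃ x ∈ properCol F ℓ, (∀ κ ∈ K, x κ = u κ) ∧ π x 1 = i}
  have hPcongr : ∀ u v : Γ → Fin ℓ, (∀ κ ∈ K, u κ = v κ) → P u = P v := by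
    intro u v h
    ext i
    refine exists_congr fun x => and_congr_right fun _ => and_congr_left fun _ =>
      forall₂_congr fun κ hκ => by rw [h κ hκ]
  have hP : ∀ x ∈ properCol F ℓ, ∀ a, P (shiftAct a x) = {π x a} := by
    intro x hx a
    have hxa := shiftAct_mem_properCol hx a
    have hval : π (shiftAct a x) 1 = π x a := by
      rw [hequiv x hx a]
      simp [shiftAct]
    ext i
    constructor
    · rintro ⟨y, hy, hyx, rfl⟩
      rw [← hval]
      exact hK y hy _ hxa hyx
    · rintro rfl
      exact ⟨_, hxa, fun _ _ => rfl, hval⟩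
  simp only [mapStab, Set.mem_ofPred_eq, not_forall] at hγ
  obtain ⟨x, hx, hne⟩ := hγ
  obtain ⟨δ, hδ⟩ := Function.ne_iff.mp hne
  refine ⟨⟨P, K, hPcongr, fun b => shiftAct (if b then δ * γ else δ) x,
    fun b => shiftAct_mem_properCol hx _, ?_⟩, fun x hx a b => ?_⟩
  · rw [hP x hx, hP x hx]
    simpa using fun h : π x δ = π x (δ * γ) => hδ h.symm
  · change P _ ≠ P _ ↔ _
    rw [hP x hx, hP x hx, ne_eq, Set.singleton_eq_singleton_iff]

end BlockCode

/-- Lemma `col+Stab`.  Let `F ⊂ Γ` be a finite symmetric set with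
`1 ∉ F`, let `ℓ ≥ |F| + 1`, `m ≥ 1`, and let `π : Col(F, ℓ) → m^Γ` be a continuous
`Γ`-equivariant map.  Then there is a subshift `Z ⊆ Col(F, ℓ)` such that
`Stab(π(z)) = Stab(π)` for all `z ∈ Z`, and every free Borel action of `Γ` on a
Polish space admits a Borel `Γ`-equivariant map to `Z`. -/
theorem stmt5 {Γ : Type} [Group Γ] [Countable Γ] [Infinite Γ]
    (F : Finset Γ) (hFsym : ∀ σ ∈ F, σ⁻¹ ∈ F) (hF1 : (1 : Γ) ∉ F)
    (ℓ m : ℕ) (hℓ : F.card + 1 ≤ ℓ) (hm : 1 ≤ m)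
    (π : (Γ → Fin ℓ) → (Γ → Fin m))
    (hπcont : ContinuousOn π (properCol F ℓ))
    (hπequiv : EquivariantOn π (properCol F ℓ)) :
    ∃ Z : Set (Γ → Fin ℓ), Z ⊆ properCol F ℓ ∧ IsSubshift Z ∧
      (∀ z ∈ Z, ptStab (π z) = mapStab π (properCol F ℓ)) ∧
      (∀ (X : Type) [TopologicalSpace X] [PolishSpace X] [MeasurableSpace X] [BorelSpace X]
        (a : Γ → X → X),
        (∀ x, a 1 x = x) →
        (∀ γ δ : Γ, ∀ x, a (γ * δ) x = a γ (a δ x)) →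
        (∀ γ : Γ, Measurable (a γ)) →
        (∀ (γ : Γ) (x : X), a γ x = x → γ = 1) →
        ∃ f : X → (Γ → Fin ℓ), Measurable f ∧ (∀ x, f x ∈ Z) ∧
          ∀ (γ : Γ) (x : X), f (a γ x) = shiftAct γ (f x)) := by
  classical
  by_cases huniv : mapStab π (properCol F ℓ) = Set.univ
  · refine ⟨properCol F ℓ, subset_rfl, ⟨isClosed_properCol, fun γ x hx =>
      shiftAct_mem_properCol hx γ⟩, fun z hz => ?_, ?_⟩
    · rw [huniv, Set.eq_univ_iff_forall]
      exact fun γ => (huniv.symm.subset (Set.mem_univ γ)) z hz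
    · intro X _ _ _ _ a h1 hmul hmeas hfree
      let _ : MulAction Γ X := { smul := a, one_smul := h1, mul_smul := hmul }
      have : MeasurableConstSMul Γ X := ⟨hmeas⟩
      obtain ⟨c, hc, hcF⟩ := exists_measurable_fin_coloring (X := X) hfree F hF1 hFsym hℓ
      exact ⟨colView c, measurable_colView hc, colView_mem_properCol hcF,
        fun γ x => (shiftAct_colView c γ x).symm⟩
  · obtain ⟨γ₀, hγ₀⟩ := (Set.ne_univ_iff_exists_notMem _).mp huniv
    obtain ⟨R, hR⟩ := exists_nonconstantRule hπcont hπequiv hγ₀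
    obtain ⟨D, hD⟩ := exists_nowhere_invariant_coloring hFsym hF1 hℓ R
    refine ⟨properCol F ℓ ∩ {z | ∀ γ ∉ mapStab π (properCol F ℓ), ∀ η, ∃ δ ∈ D γ,
      R.rule (shiftAct (δ * η) z) ≠ R.rule (shiftAct (δ * γ * η) z)},
      Set.inter_subset_left, ⟨isClosed_properCol.inter ?_, ?_⟩, ?_, ?_⟩
    · have : {z | ∀ γ ∉ mapStab π (properCol F ℓ), ∀ η, ∃ δ ∈ D γ,
          R.rule (shiftAct (δ * η) z) ≠ R.rule (shiftAct (δ * γ * η) z)} =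
          ⋂ γ ∈ (mapStab π (properCol F ℓ))ᶜ, ⋂ η, ⋃ δ ∈ D γ,
            {z | R.rule (shiftAct (δ * η) z) ≠ R.rule (shiftAct (δ * γ * η) z)} := by
        ext z
        simp
      rw [this]
      exact isClosed_biInter fun γ _ => isClosed_iInter fun η =>
        isClosed_biUnion_finset fun δ _ => (R.isClopen_ne _ _).isClosed
    · rintro γ z ⟨hz, hz'⟩
      refine ⟨shiftAct_mem_properCol hz γ, fun g hg η => ?_⟩
      obtain ⟨δ, hδ, hne⟩ := hz' g hg (η * γ)
      refine ⟨δ, hδ, ?_⟩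
      simpa only [shiftAct_shiftAct, mul_assoc] using hne
    · rintro z ⟨hz, hz'⟩
      refine Set.Subset.antisymm (fun γ hγ => ?_) fun γ hγ => hγ z hz
      by_contra hcon
      obtain ⟨δ, -, hne⟩ := hz' γ hcon 1
      rw [hR z hz, mul_one, mul_one] at hne
      exact hne (congrFun hγ δ).symm
    · intro X _ _ _ _ a h1 hmul hmeas hfree
      let _ : MulAction Γ X := { smul := a, one_smul := h1, mul_smul := hmul }
      have : MeasurableConstSMul Γ X := ⟨hmeas⟩
      obtain ⟨c, hc, hcF, hwit⟩ := hD X hfree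
      refine ⟨colView c, measurable_colView hc, fun x => ⟨colView_mem_properCol hcF x,
        fun γ hγ η => ?_⟩, fun γ x => (shiftAct_colView c γ x).symm⟩
      have hγ' : ∃ w ∈ properCol F ℓ, ∃ δ,
          R.rule (shiftAct δ w) ≠ R.rule (shiftAct (δ * γ) w) := by
        simp only [mapStab, Set.mem_ofPred_eq, not_forall] at hγ
        obtain ⟨w, hw, hne⟩ := hγ
        obtain ⟨δ, hδ⟩ := Function.ne_iff.mp hne
        exact ⟨w, hw, δ, (hR w hw _ _).mpr fun h => hδ h.symm⟩
      obtain ⟨δ, hδ, hne⟩ := hwit γ hγ' (η • x)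
      refine ⟨δ, hδ, ?_⟩
      simpa only [shiftAct_colView, mul_smul] using hne
end

section
/- Let Γ be a countably infinite group. There exists a free subshift S ⊂ 2^Γ such that every free Borel action Γ ↷ X on a Polish space admits a Borel Γ-equivariant map X → S. -/
open scoped Pointwise
section Counting

variable {Γ : Type} [DecidableEq Γ]

lemma card_filter_powerset_mul_le {B A : Finset Γ} {m : ℕ} (hA : A ⊆ B) (hm : m ≤ A.card)
    (ev : Finset Γ → Prop) [DecidablePred ev]
    (h : ∀ p q, ev p → ev q → p \ A = q \ A → p = q) :
    (B.powerset.filter ev).card * 2 ^ m ≤ 2 ^ B.card := by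
  have h1 : (B.powerset.filter ev).card ≤ (B \ A).powerset.card := by
    refine Finset.card_le_card_of_injOn (fun p => p \ A) ?_ ?_
    · intro p hp
      simp only [Finset.coe_filter, Finset.mem_powerset, Set.mem_ofPred_eq] at hp
      exact Finset.mem_coe.2 (Finset.mem_powerset.2
        (Finset.sdiff_subset_sdiff hp.1 (Finset.Subset.refl A)))
    · intro p hp q hq hpq
      simp only [Finset.coe_filter, Finset.mem_powerset, Set.mem_ofPred_eq] at hp hq
      exact h p q hp.2 hq.2 hpq
  rw [Finset.card_powerset, Finset.card_sdiff_of_subset hA] at h1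
  calc (B.powerset.filter ev).card * 2 ^ m ≤ 2 ^ (B.card - A.card) * 2 ^ A.card :=
        Nat.mul_le_mul h1 (Nat.pow_le_pow_right (by norm_num) hm)
    _ = 2 ^ B.card := by
        rw [← pow_add, Nat.sub_add_cancel (Finset.card_le_card hA)]

lemma card_filter_prescribed_mul_le {B Q : Finset Γ} {m : ℕ} (s : Γ → Γ)
    (hs : Function.Injective s) (hQ : ∀ b ∈ Q, s b ∈ B) (τ : Γ → Prop)
    (ev : Finset Γ → Prop) [DecidablePred ev]
    (h : ∀ p, ev p → m ≤ Q.card ∧ ∀ b ∈ Q, (s b ∈ p ↔ τ b)) :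
    (B.powerset.filter ev).card * 2 ^ m ≤ 2 ^ B.card := by
  by_cases hm : m ≤ Q.card
  · refine card_filter_powerset_mul_le (A := Q.image s) ?_ ?_ ev ?_
    · intro x hx
      obtain ⟨b, hb, rfl⟩ := Finset.mem_image.1 hx
      exact hQ b hb
    · rwa [Finset.card_image_of_injective _ hs]
    · intro p q hp hq hpq
      ext x
      by_cases hx : x ∈ Q.image s
      · obtain ⟨b, hb, rfl⟩ := Finset.mem_image.1 hx
        rw [(h p hp).2 b hb, (h q hq).2 b hb]
      · have := congrArg (x ∈ ·) hpq
        simpa [Finset.mem_sdiff, hx] using this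
  · have : B.powerset.filter ev = ∅ :=
      Finset.filter_eq_empty_iff.2 fun p _ hp => hm (h p hp).1
    simp [this]

lemma exists_subset_disjoint_mul_right [Group Γ] (Q : Finset Γ) {h : Γ} (hh : h ≠ 1) :
    ∃ A ⊆ Q, (∀ a ∈ A, a * h ∉ A) ∧ Q.card ≤ 3 * A.card := by
  obtain ⟨A, hA, hmax⟩ := Finset.exists_max_image
    (Q.powerset.filter fun A => ∀ a ∈ A, a * h ∉ A) Finset.card ⟨∅, by simp⟩
  simp only [Finset.mem_filter, Finset.mem_powerset] at hA hmax
  refine ⟨A, hA.1, hA.2, ?_⟩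
  have hsub : Q ⊆ A ∪ (A.image (· * h) ∪ A.image (· * h⁻¹)) := by
    intro q hq
    by_contra hcon
    simp only [Finset.mem_union, Finset.mem_image, not_or, not_exists, not_and] at hcon
    obtain ⟨hqA, h1, h2⟩ := hcon
    have := hmax (insert q A) ⟨Finset.insert_subset hq hA.1, ?_⟩
    · rw [Finset.card_insert_of_notMem hqA] at this
      omega
    · intro a ha
      rw [Finset.mem_insert] at ha ⊢
      rintro (he | he)
      · rcases ha with rfl | ha
        · exact hh (by simpa using he)
        · exact h1 a ha he
      · rcases ha with rfl | ha
        · exact h2 _ he (by simp)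
        · exact hA.2 a ha he
  calc Q.card ≤ _ := Finset.card_le_card hsub
    _ ≤ A.card + (A.card + A.card) :=
        (Finset.card_union_le _ _).trans <| Nat.add_le_add_left
          ((Finset.card_union_le _ _).trans
            (Nat.add_le_add Finset.card_image_le Finset.card_image_le)) _
    _ = 3 * A.card := by ring

lemma card_filter_invariant_mul_le [Group Γ] {B Q : Finset Γ} {m : ℕ} {h : Γ} (hh : h ≠ 1)
    (hQ : Q ⊆ B) (ev : Finset Γ → Prop) [DecidablePred ev]
    (hev : ∀ p, ev p → 3 * m ≤ Q.card ∧ ∀ b ∈ Q, (b ∈ p ↔ b * h ∈ p)) :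
    (B.powerset.filter ev).card * 2 ^ m ≤ 2 ^ B.card := by
  by_cases hm : 3 * m ≤ Q.card
  · obtain ⟨A, hAQ, hAh, hcard⟩ := exists_subset_disjoint_mul_right Q hh
    refine card_filter_powerset_mul_le (hAQ.trans hQ) (by omega) ev ?_
    intro p q hp hq hpq
    have key : ∀ x, x ∉ A → (x ∈ p ↔ x ∈ q) := by
      intro x hx
      have := congrArg (x ∈ ·) hpq
      simpa [Finset.mem_sdiff, hx] using this
    ext x
    by_cases hx : x ∈ A
    · rw [(hev p hp).2 x (hAQ hx), (hev q hq).2 x (hAQ hx)]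
      exact key _ (hAh x hx)
    · exact key x hx
  · have : B.powerset.filter ev = ∅ :=
      Finset.filter_eq_empty_iff.2 fun p _ hp => hm (hev p hp).1
    simp [this]

open Classical in
lemma exists_avoiding {ι : Type} (I : Finset ι) (B : Finset Γ) {m : ℕ}
    (ev : ι → Finset Γ → Prop)
    (h : ∀ i ∈ I, (B.powerset.filter (ev i)).card * 2 ^ m ≤ 2 ^ B.card)
    (hI : I.card < 2 ^ m) : ∃ p : Finset Γ, ∀ i ∈ I, ¬ ev i p := by
  by_contra! hcon
  have hcov : B.powerset ⊆ I.biUnion fun i => B.powerset.filter (ev i) := by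
    intro p hp
    obtain ⟨i, hi, hp'⟩ := hcon p
    exact Finset.mem_biUnion.2 ⟨i, hi, Finset.mem_filter.2 ⟨hp, hp'⟩⟩
  have h1 : 2 ^ B.card ≤ ∑ i ∈ I, (B.powerset.filter (ev i)).card := by
    rw [← Finset.card_powerset]
    exact (Finset.card_le_card hcov).trans Finset.card_biUnion_le
  have h2 : 2 ^ B.card * 2 ^ m ≤ I.card * 2 ^ B.card := by
    calc 2 ^ B.card * 2 ^ m ≤ (∑ i ∈ I, (B.powerset.filter (ev i)).card) * 2 ^ m :=
          Nat.mul_le_mul_right _ h1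
      _ = ∑ i ∈ I, (B.powerset.filter (ev i)).card * 2 ^ m := Finset.sum_mul ..
      _ ≤ I.card * 2 ^ B.card := by simpa using Finset.sum_le_card_nsmul I _ _ h
  have h3 : 0 < 2 ^ B.card := by positivity
  rw [mul_comm] at h2
  exact absurd (Nat.le_of_mul_le_mul_right h2 h3) (by omega)

lemma exists_poly_lt_two_pow (t : ℕ) : ∃ m : ℕ, 6 * (t * (9 * m + 2)) ^ 10 < 2 ^ m := by
  have h := tendsto_pow_const_div_const_pow_of_one_lt 10 (r := (2 : ℝ)) (by norm_num)
  have hpos : (0 : ℝ) < 1 / (6 * (11 * t) ^ 10 + 1) := by positivity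
  obtain ⟨m, hm, h0⟩ := ((h.eventually_lt_const hpos).and (Filter.eventually_gt_atTop 0)).exists
  refine ⟨m, ?_⟩
  rw [div_lt_div_iff₀ (by positivity) (by positivity)] at hm
  have hm' : m ^ 10 * (6 * (11 * t) ^ 10 + 1) < 2 ^ m := by
    have : (m : ℝ) ^ 10 * (6 * (11 * t) ^ 10 + 1) < 2 ^ m := by linarith
    exact_mod_cast this
  calc 6 * (t * (9 * m + 2)) ^ 10 ≤ 6 * (t * (11 * m)) ^ 10 := by gcongr; omega
    _ = m ^ 10 * (6 * (11 * t) ^ 10) := by ring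
    _ ≤ m ^ 10 * (6 * (11 * t) ^ 10 + 1) := by gcongr; omega
    _ < 2 ^ m := hm'

lemma exists_finset_card_inter_ge [Group Γ] [Infinite Γ] (T : Finset Γ) (K : ℕ) :
    ∃ B : Finset Γ, B.card ≤ T.card * K ∧ ∀ W : Set Γ, (∀ g, ∃ t ∈ T, t * g ∈ W) →
      ∃ Q ⊆ B, K ≤ Q.card ∧ ∀ q ∈ Q, q ∈ W := by
  induction K with
  | zero => exact ⟨∅, by simp, fun W _ => ⟨∅, by simp⟩⟩
  | succ K ih =>
    obtain ⟨B, hB, hW⟩ := ih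
    obtain ⟨g, hg⟩ := Infinite.exists_notMem_finset (T⁻¹ * B)
    refine ⟨B ∪ T.image (· * g), ?_, fun W h => ?_⟩
    · calc _ ≤ B.card + T.card :=
            (Finset.card_union_le _ _).trans (Nat.add_le_add_left Finset.card_image_le _)
        _ ≤ T.card * (K + 1) := by rw [mul_add, mul_one]; omega
    · obtain ⟨Q, hQB, hQ, hQW⟩ := hW W h
      obtain ⟨t, ht, htW⟩ := h g
      have hnot : t * g ∉ Q := fun hmem => hg <| Finset.mem_mul.2
        ⟨t⁻¹, Finset.inv_mem_inv ht, t * g, hQB hmem, by simp⟩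
      refine ⟨insert (t * g) Q, ?_, ?_, ?_⟩
      · refine Finset.insert_subset ?_ (hQB.trans Finset.subset_union_left)
        exact Finset.mem_union_right _ (Finset.mem_image_of_mem _ ht)
      · rw [Finset.card_insert_of_notMem hnot]; omega
      · intro q hq
        rcases Finset.mem_insert.1 hq with rfl | hq
        · exact htW
        · exact hQW q hq

end Counting

section Greedy

variable {Γ X : Type} [Group Γ] [MulAction Γ X]

/-- Greedy choice along `φ`: the least value that is admissible given the values at the
`D`-neighbours with smaller `φ`. -/
noncomputable def greedyColoring (D : Finset Γ) (φ : X → ℕ) (U : X → ℕ → Prop)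
    (E : Γ → X → ℕ → ℕ → Prop) (x : X) : ℕ :=
  sInf {p | ¬ U x p ∧ ∀ d ∈ D, ∀ _ : φ (d • x) < φ x,
    ¬ E d x p (greedyColoring D φ U E (d • x))}
termination_by φ x

variable {D : Finset Γ} {φ : X → ℕ} {U : X → ℕ → Prop} {E : Γ → X → ℕ → ℕ → Prop}

lemma greedyColoring_spec (h : ∀ x (σ : Γ → ℕ), ∃ p, ¬ U x p ∧ ∀ d ∈ D, ¬ E d x p (σ d)) (x : X) :
    ¬ U x (greedyColoring D φ U E x) ∧ ∀ d ∈ D, φ (d • x) < φ x →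
      ¬ E d x (greedyColoring D φ U E x) (greedyColoring D φ U E (d • x)) := by
  obtain ⟨p, hp⟩ := h x fun d => greedyColoring D φ U E (d • x)
  have := Nat.sInf_mem (s := {p | ¬ U x p ∧ ∀ d ∈ D, ∀ _ : φ (d • x) < φ x,
    ¬ E d x p (greedyColoring D φ U E (d • x))}) ⟨p, hp.1, fun d hd _ => hp.2 d hd⟩
  rw [← greedyColoring] at this
  exact this

lemma greedyColoring_least {x : X} {p : ℕ} (hp : p < greedyColoring D φ U E x) :
    U x p ∨ ∃ d ∈ D, φ (d • x) < φ x ∧ E d x p (greedyColoring D φ U E (d • x)) := by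
  rw [greedyColoring] at hp
  have := Nat.notMem_of_lt_sInf hp
  by_contra! hcon
  exact this ⟨hcon.1, hcon.2⟩

variable [MeasurableSpace X]

lemma measurable_greedyColoring [MeasurableConstSMul Γ X] (hφ : Measurable φ)
    (hU : ∀ p, MeasurableSet {x | U x p}) (hE : ∀ d p q, MeasurableSet {x | E d x p q})
    (h : ∀ x (σ : Γ → ℕ), ∃ p, ¬ U x p ∧ ∀ d ∈ D, ¬ E d x p (σ d)) :
    Measurable (greedyColoring D φ U E) := by
  have hfib : ∀ n p, MeasurableSet {x | φ x = n ∧ greedyColoring D φ U E x = p} := by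
    intro n
    induction n using Nat.strong_induction_on with
    | _ n ih =>
    have hgood : ∀ p, MeasurableSet {x | φ x = n ∧ ¬ U x p ∧ ∀ d ∈ D, φ (d • x) < φ x →
        ¬ E d x p (greedyColoring D φ U E (d • x))} := by
      intro p
      have heq : {x | φ x = n ∧ ¬ U x p ∧ ∀ d ∈ D, φ (d • x) < φ x →
          ¬ E d x p (greedyColoring D φ U E (d • x))} =
          φ ⁻¹' {n} ∩ ({x | U x p}ᶜ ∩ ⋂ d ∈ D, ⋂ k, ⋂ (_ : k < n), ⋂ q,
            (((d • ·) ⁻¹' {y | φ y = k ∧ greedyColoring D φ U E y = q}) ∩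
              {x | E d x p q})ᶜ) := by
        ext x
        simp only [Set.mem_ofPred_eq, Set.mem_inter_iff, Set.mem_preimage, Set.mem_singleton_iff,
          Set.mem_compl_iff, Set.mem_iInter]
        refine and_congr_right fun hx => and_congr_right fun _ => forall₂_congr fun d _ => ?_
        rw [hx]
        constructor
        · rintro h k hk q ⟨⟨rfl, rfl⟩, hE'⟩
          exact h hk hE'
        · intro h hk hE'
          exact h _ hk _ ⟨⟨rfl, rfl⟩, hE'⟩
      rw [heq]
      refine (hφ (measurableSet_singleton n)).inter ((hU p).compl.inter ?_)
      refine Finset.measurableSet_biInter _ fun d _ => ?_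
      refine MeasurableSet.iInter fun k => MeasurableSet.iInter fun hk =>
        MeasurableSet.iInter fun q => ?_
      exact ((measurable_const_smul d (ih k hk q)).inter (hE d p q)).compl
    intro p
    have heq : {x | φ x = n ∧ greedyColoring D φ U E x = p} =
        {x | φ x = n ∧ ¬ U x p ∧ ∀ d ∈ D, φ (d • x) < φ x →
          ¬ E d x p (greedyColoring D φ U E (d • x))} ∩
        ⋂ q, ⋂ (_ : q < p), {x | φ x = n ∧ ¬ U x q ∧ ∀ d ∈ D, φ (d • x) < φ x →
          ¬ E d x q (greedyColoring D φ U E (d • x))}ᶜ := by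
      ext x
      simp only [Set.mem_ofPred_eq, Set.mem_inter_iff, Set.mem_iInter, Set.mem_compl_iff]
      constructor
      · rintro ⟨hx, rfl⟩
        refine ⟨⟨hx, greedyColoring_spec h x⟩, fun q hq hcon => ?_⟩
        rcases greedyColoring_least hq with h1 | ⟨d, hd, h1, h2⟩
        · exact hcon.2.1 h1
        · exact hcon.2.2 d hd h1 h2
      · rintro ⟨⟨hx, hp⟩, hlt⟩
        refine ⟨hx, ?_⟩
        rcases lt_trichotomy (greedyColoring D φ U E x) p with h1 | h1 | h1
        · exact absurd ⟨hx, greedyColoring_spec h x⟩ (hlt _ h1)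
        · exact h1
        · rcases greedyColoring_least h1 with h2 | ⟨d, hd, h2, h3⟩
          · exact absurd h2 hp.1
          · exact absurd h3 (hp.2 d hd h2)
    rw [heq]
    exact (hgood p).inter (MeasurableSet.iInter fun q => MeasurableSet.iInter fun _ =>
      (hgood q).compl)
  refine measurable_to_countable' fun p => ?_
  have : greedyColoring D φ U E ⁻¹' {p} =
      ⋃ n, {x | φ x = n ∧ greedyColoring D φ U E x = p} := by
    ext x; simp
  rw [this]
  exact MeasurableSet.iUnion fun n => hfib n p

variable [TopologicalSpace X] [T1Space X] [SecondCountableTopology X] [OpensMeasurableSpace X]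
  [MeasurableConstSMul Γ X]

lemma exists_measurable_proper_coloring
    (hfree : ∀ (γ : Γ) (x : X), γ • x = x → γ = 1) (D : Finset Γ) (hD : 1 ∉ D) :
    ∃ φ : X → ℕ, Measurable φ ∧ ∀ x, ∀ d ∈ D, φ (d • x) ≠ φ x := by
  classical
  rcases isEmpty_or_nonempty X with hX | hX
  · exact ⟨fun _ => 0, measurable_const, fun x => hX.elim x⟩
  have hbasis := TopologicalSpace.isBasis_countableBasis X
  obtain ⟨u, hu, -⟩ := hbasis.exists_subset_of_mem_open (Set.mem_univ hX.some) isOpen_univ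
  obtain ⟨U, hU⟩ := (TopologicalSpace.countable_countableBasis X).exists_eq_range ⟨u, hu⟩
  have hopen : ∀ n, IsOpen (U n) := fun n => hbasis.isOpen (hU ▸ Set.mem_range_self n)
  have hex : ∀ x : X, ∃ n, x ∈ U n ∧ ∀ d ∈ D, d • x ∉ U n := by
    intro x
    have hfin : IsOpen (((D.image (· • x) : Finset X) : Set X)ᶜ) :=
      (Finset.finite_toSet _).isClosed.isOpen_compl
    have hx : x ∈ (((D.image (· • x) : Finset X) : Set X)ᶜ) := by
      simp only [Finset.coe_image, Set.mem_compl_iff, Set.mem_image, not_exists, not_and]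
      intro d hd hdx
      exact hD (hfree d x hdx ▸ hd)
    obtain ⟨u, hu, hxu, hsub⟩ := hbasis.exists_subset_of_mem_open hx hfin
    rw [hU] at hu
    obtain ⟨n, rfl⟩ := hu
    exact ⟨n, hxu, fun d hd hmem =>
      hsub hmem (Finset.mem_coe.2 (Finset.mem_image_of_mem (· • x) hd))⟩
  refine ⟨fun x => Nat.find (hex x), measurable_find hex fun n => ?_, fun x d hd heq => ?_⟩
  · refine (hopen n).measurableSet.inter ?_
    have : {x : X | ∀ d ∈ D, d • x ∉ U n} = ⋂ d ∈ D, ((d • ·) ⁻¹' U n)ᶜ := by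
      ext x; simp
    change MeasurableSet {x : X | ∀ d ∈ D, d • x ∉ U n}
    rw [this]
    exact Finset.measurableSet_biInter _ fun d _ =>
      (measurable_const_smul d (hopen n).measurableSet).compl
  · have h1 := (Nat.find_spec (hex x)).2 d hd
    have h2 := (Nat.find_spec (hex (d • x))).1
    rw [show Nat.find (hex (d • x)) = Nat.find (hex x) from heq] at h2
    exact h1 h2

/-- A Borel assignment satisfying local constraints, each of which involves at most two points,
when every point can always be completed given its neighbours. -/
lemma exists_measurable_assignment {P : Type} [Countable P] [Nonempty P]
    (hfree : ∀ (γ : Γ) (x : X), γ • x = x → γ = 1)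
    (hD : 1 ∉ D) (hDinv : ∀ d ∈ D, d⁻¹ ∈ D) (U : X → P → Prop) (E : Γ → X → P → P → Prop)
    (hU : ∀ p, MeasurableSet {x | U x p}) (hE : ∀ d p q, MeasurableSet {x | E d x p q})
    (h : ∀ x (σ : Γ → P), ∃ p, ¬ U x p ∧
      ∀ d ∈ D, ¬ E d x p (σ d) ∧ ¬ E d⁻¹ (d • x) (σ d) p) :
    ∃ g : X → P, (∀ p, MeasurableSet {x | g x = p}) ∧
      ∀ x, ¬ U x (g x) ∧ ∀ d ∈ D, ¬ E d x (g x) (g (d • x)) := by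
  obtain ⟨φ, hφ, hφD⟩ := exists_measurable_proper_coloring hfree D hD
  obtain ⟨ν, hν⟩ := exists_surjective_nat P
  let U' : X → ℕ → Prop := fun x i => U x (ν i)
  let E' : Γ → X → ℕ → ℕ → Prop := fun d x i j =>
    E d x (ν i) (ν j) ∨ E d⁻¹ (d • x) (ν j) (ν i)
  have h' : ∀ x (σ : Γ → ℕ), ∃ p, ¬ U' x p ∧ ∀ d ∈ D, ¬ E' d x p (σ d) := by
    intro x σ
    obtain ⟨p, hp1, hp2⟩ := h x fun d => ν (σ d)
    obtain ⟨i, rfl⟩ := hν p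
    exact ⟨i, hp1, fun d hd => not_or.2 (hp2 d hd)⟩
  have hmeas : Measurable (greedyColoring D φ U' E') :=
    measurable_greedyColoring hφ (fun p => hU _)
      (fun d p q => (hE d _ _).union (measurable_const_smul d (hE d⁻¹ _ _))) h'
  refine ⟨fun x => ν (greedyColoring D φ U' E' x), fun p => ?_, fun x => ?_⟩
  · exact hmeas (MeasurableSet.of_discrete (s := {i | ν i = p}))
  · refine ⟨(greedyColoring_spec (φ := φ) h' x).1, fun d hd hcon => ?_⟩
    rcases lt_or_gt_of_ne (hφD x d hd) with hlt | hlt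
    · exact (greedyColoring_spec (φ := φ) h' x).2 d hd hlt (Or.inl hcon)
    · refine (greedyColoring_spec (φ := φ) h' (d • x)).2 d⁻¹ (hDinv d hd) ?_ (Or.inr ?_)
      · rwa [inv_smul_smul]
      · rw [inv_smul_smul, inv_inv]
        exact hcon

lemma exists_maximal_independent (hfree : ∀ (γ : Γ) (x : X), γ • x = x → γ = 1)
    (hD : 1 ∉ D) (hDinv : ∀ d ∈ D, d⁻¹ ∈ D) {V : Set X} (hV : MeasurableSet V) :
    ∃ M ⊆ V, MeasurableSet M ∧ (∀ x ∈ M, ∀ d ∈ D, d • x ∉ M) ∧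
      ∀ x ∈ V, x ∈ M ∨ ∃ d ∈ D, d • x ∈ M := by
  obtain ⟨φ, hφ, hφD⟩ := exists_measurable_proper_coloring hfree D hD
  let U : X → ℕ → Prop := fun x p => p = 0 ∧ x ∉ V
  let E : Γ → X → ℕ → ℕ → Prop := fun _ _ p q => p = 0 ∧ q = 0
  have h : ∀ x (σ : Γ → ℕ), ∃ p, ¬ U x p ∧ ∀ d ∈ D, ¬ E d x p (σ d) :=
    fun x σ => ⟨1, by simp [U], by simp [E]⟩
  have hmeas : Measurable (greedyColoring D φ U E) :=
    measurable_greedyColoring hφ (fun p => (MeasurableSet.const _).inter hV.compl)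
      (fun d p q => MeasurableSet.const _) h
  have hspec := greedyColoring_spec (φ := φ) h
  refine ⟨{x | greedyColoring D φ U E x = 0}, fun x hx => ?_, hmeas (measurableSet_singleton 0),
    fun x hx d hd hdx => ?_, fun x hx => or_iff_not_imp_left.2 fun hne => ?_⟩
  · by_contra hxV
    exact (hspec x).1 ⟨hx, hxV⟩
  · rcases lt_or_gt_of_ne (hφD x d hd) with hlt | hlt
    · exact (hspec x).2 d hd hlt ⟨hx, hdx⟩
    · refine (hspec (d • x)).2 d⁻¹ (hDinv d hd) ?_ ⟨hdx, ?_⟩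
      · rwa [inv_smul_smul]
      · rwa [inv_smul_smul]
  · rcases greedyColoring_least (Nat.pos_of_ne_zero hne) with h1 | ⟨d, hd, _, _, h2⟩
    · exact absurd hx h1.2
    · exact ⟨d, hd, h2⟩

end Greedy

section Step

variable {Γ X : Type}

open Classical in
/-- If `V'` meets each translate of `B` at most once and `b • u`, `b ∈ B`, runs through many points
of `V`, then many of the pairs `(b • u, b • h • u)` avoid `V'` with first entry in `V`. -/
lemma le_card_filter_avoiding [Group Γ] [MulAction Γ X] {B : Finset Γ} {V V' : Set X} {k : ℕ}
    (hV' : ∀ x ∈ V', ∀ z ∈ B * B⁻¹, z • x ∈ V' → z = 1) {u : X} (h : Γ)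
    (hu : ∃ Q ⊆ B, k + 2 ≤ Q.card ∧ ∀ q ∈ Q, q • u ∈ V) :
    k ≤ (B.filter fun b => b • u ∈ V ∧ b • u ∉ V' ∧ b • h • u ∉ V').card := by
  have hone : ∀ y : X, (B.filter fun b => b • y ∈ V').card ≤ 1 := by
    intro y
    refine Finset.card_le_one.2 fun a ha b hb => ?_
    rw [Finset.mem_filter] at ha hb
    have := hV' (a • y) ha.2 (b * a⁻¹) (Finset.mul_mem_mul hb.1 (Finset.inv_mem_inv ha.1))
      (by rw [mul_smul, inv_smul_smul]; exact hb.2)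
    exact (mul_inv_eq_one.1 this).symm
  obtain ⟨Q, hQB, hQ, hQV⟩ := hu
  have hsub : Q ⊆ (B.filter fun b => b • u ∈ V ∧ b • u ∉ V' ∧ b • h • u ∉ V') ∪
      ((B.filter fun b => b • u ∈ V') ∪ B.filter fun b => b • (h • u) ∈ V') := by
    intro b hb
    have h1 := hQB hb
    have h2 := hQV b hb
    simp only [Finset.mem_union, Finset.mem_filter, h1, h2, true_and]
    tauto
  have h1 := Finset.card_le_card hsub
  have h2 := Finset.card_union_le
    (B.filter fun b => b • u ∈ V ∧ b • u ∉ V' ∧ b • h • u ∉ V')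
    ((B.filter fun b => b • u ∈ V') ∪ B.filter fun b => b • (h • u) ∈ V')
  have h3 := Finset.card_union_le (B.filter fun b => b • u ∈ V')
    (B.filter fun b => b • (h • u) ∈ V')
  have h4 := hone u
  have h5 := hone (h • u)
  omega

variable [MeasurableSpace X]

lemma measurableSet_le_card_filter (B : Finset Γ) (k : ℕ) {R : X → Γ → Prop}
    [∀ x, DecidablePred (R x)]
    (hR : ∀ b, MeasurableSet {x | R x b}) :
    MeasurableSet {x | k ≤ (B.filter (R x)).card} := by
  have : {x | k ≤ (B.filter (R x)).card} =
      ⋃ Q ∈ B.powerset.filter fun Q => k ≤ Q.card, ⋂ b ∈ Q, {x | R x b} := by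
    ext x
    simp only [Set.mem_ofPred_eq, Set.mem_iUnion, Set.mem_iInter, Finset.mem_filter,
      Finset.mem_powerset, exists_prop]
    constructor
    · exact fun h => ⟨_, ⟨Finset.filter_subset _ _, h⟩, fun b hb => (Finset.mem_filter.1 hb).2⟩
    · rintro ⟨Q, ⟨hQB, hQ⟩, hQR⟩
      exact hQ.trans (Finset.card_le_card fun b hb =>
        Finset.mem_filter.2 ⟨hQB hb, hQR b hb⟩)
  rw [this]
  exact Finset.measurableSet_biUnion _ fun Q _ => Finset.measurableSet_biInter _ fun b _ => hR b

lemma measurableSet_setOf_and {p q : X → Prop} (hp : MeasurableSet {x | p x})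
    (hq : MeasurableSet {x | q x}) : MeasurableSet {x | p x ∧ q x} :=
  hp.inter hq

lemma measurableSet_setOf_imp {p q : X → Prop} (hp : MeasurableSet {x | p x})
    (hq : MeasurableSet {x | q x}) : MeasurableSet {x | p x → q x} := by
  simp only [imp_iff_not_or]
  exact hp.compl.union hq

lemma measurableSet_forall_mem_finset (B : Finset Γ) {R : Γ → X → Prop}
    (hR : ∀ b, MeasurableSet {x | R b x}) : MeasurableSet {x | ∀ b ∈ B, R b x} := by
  have : {x | ∀ b ∈ B, R b x} = ⋂ b ∈ B, {x | R b x} := by ext; simp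
  rw [this]
  exact Finset.measurableSet_biInter _ fun b _ => hR b

lemma measurableSet_exists_mem_finset (B : Finset Γ) {R : Γ → X → Prop}
    (hR : ∀ b, MeasurableSet {x | R b x}) : MeasurableSet {x | ∃ b ∈ B, R b x} := by
  have : {x | ∃ b ∈ B, R b x} = ⋃ b ∈ B, {x | R b x} := by ext; simp
  rw [this]
  exact Finset.measurableSet_biUnion _ fun b _ => hR b

/-- Simultaneous avoidance of the coincidences between the patterns `p, σ d ⊆ B` attached to
the centres of a marker set. The positions at which a shift by `h ∈ H` lands outside all other
blocks are `O h` (same block) and `L h` (prescribed values); those where it lands in the block of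
the `d`-neighbour are `N d h`, and `N' d h` is the same set seen from the neighbour. -/
lemma exists_pattern [Group Γ] [DecidableEq Γ] {B H D : Finset Γ} {m : ℕ} (hH : 1 ∉ H)
    (hcard : 2 * H.card + 2 * (H.card * D.card) < 2 ^ m)
    (O L : Γ → Finset Γ) (N N' : Γ → Γ → Finset Γ) (τ : Γ → Γ → Prop) (σ : Γ → Finset Γ)
    (hO : ∀ h, O h ⊆ B) (hL : ∀ h, L h ⊆ B) (hN : ∀ d h, N d h ⊆ B)
    (hN' : ∀ d h, ∀ b ∈ N' d h, b * h * d ∈ B) :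
    ∃ p : Finset Γ,
      (∀ h ∈ H, ¬ (3 * m ≤ (O h).card ∧ ∀ b ∈ O h, (b ∈ p ↔ b * h ∈ p))) ∧
      (∀ h ∈ H, ¬ (3 * m ≤ (L h).card ∧ ∀ b ∈ L h, (b ∈ p ↔ τ h b))) ∧
      ∀ d ∈ D, ∀ h ∈ H,
        ¬ (3 * m ≤ (N d h).card ∧ ∀ b ∈ N d h, (b ∈ p ↔ b * h * d⁻¹ ∈ σ d)) ∧
        ¬ (3 * m ≤ (N' d h).card ∧ ∀ b ∈ N' d h, (b ∈ σ d ↔ b * h * d ∈ p)) := by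
  classical
  let ev : (Γ ⊕ Γ) ⊕ (Γ × Γ ⊕ Γ × Γ) → Finset Γ → Prop := Sum.elim
    (Sum.elim (fun h p => 3 * m ≤ (O h).card ∧ ∀ b ∈ O h, (b ∈ p ↔ b * h ∈ p))
      (fun h p => 3 * m ≤ (L h).card ∧ ∀ b ∈ L h, (b ∈ p ↔ τ h b)))
    (Sum.elim (fun i p => 3 * m ≤ (N i.2 i.1).card ∧
        ∀ b ∈ N i.2 i.1, (b ∈ p ↔ b * i.1 * i.2⁻¹ ∈ σ i.2))
      (fun i p => 3 * m ≤ (N' i.2 i.1).card ∧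
        ∀ b ∈ N' i.2 i.1, (b ∈ σ i.2 ↔ b * i.1 * i.2 ∈ p)))
  have hev : ∀ i ∈ (H.disjSum H).disjSum ((H ×ˢ D).disjSum (H ×ˢ D)),
      (B.powerset.filter (ev i)).card * 2 ^ m ≤ 2 ^ B.card := by
    rintro ((h | h) | (⟨h, d⟩ | ⟨h, d⟩)) hi
    · refine card_filter_invariant_mul_le (h := h) ?_ (hO h) _ fun p hp => hp
      rintro rfl
      exact hH (by simpa using hi)
    · exact card_filter_prescribed_mul_le id Function.injective_id (hL h) (τ h) _
        fun p hp => ⟨by have := hp.1; omega, hp.2⟩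
    · exact card_filter_prescribed_mul_le id Function.injective_id (hN d h)
        (fun b => b * h * d⁻¹ ∈ σ d) _ fun p hp => ⟨by have := hp.1; dsimp at this; omega, hp.2⟩
    · exact card_filter_prescribed_mul_le (fun b => b * h * d)
        (fun a b hab => by simpa using hab) (hN' d h)
        (fun b => b ∈ σ d) _
        fun p hp => ⟨by have := hp.1; dsimp at this; omega, fun b hb => (hp.2 b hb).symm⟩
  obtain ⟨p, hp⟩ := exists_avoiding _ B ev hev (by
    simp only [Finset.card_disjSum, Finset.card_product]
    omega)
  refine ⟨p, fun h hh => ?_, fun h hh => ?_, fun d hd h hh => ⟨?_, ?_⟩⟩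
  · exact hp (.inl (.inl h)) (by simp [hh])
  · exact hp (.inl (.inr h)) (by simp [hh])
  · exact hp (.inr (.inl (h, d))) (by simp [hh, hd])
  · exact hp (.inr (.inr (h, d))) (by simp [hh, hd])

open Classical in
/-- Recolouring `V` block by block, the blocks being `B • u` with `u` in the marker set `C`, so that
every centre `u` is told apart from `h • u`, `h ∈ H`, without using the points of `V'`. -/
lemma exists_recoloring [Group Γ] [Countable Γ] [MulAction Γ X] [TopologicalSpace X]
    [T1Space X] [SecondCountableTopology X] [OpensMeasurableSpace X] [MeasurableConstSMul Γ X]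
    (hfree : ∀ (γ : Γ) (x : X), γ • x = x → γ = 1)
    {A V V' C : Set X} (hA : MeasurableSet A) (hVm : MeasurableSet V) (hV'm : MeasurableSet V')
    (hCm : MeasurableSet C) {B H D : Finset Γ} {m : ℕ} (hH : 1 ∉ H) (hD : 1 ∉ D)
    (hDinv : ∀ d ∈ D, d⁻¹ ∈ D)
    (hDH : ∀ b ∈ B, ∀ b' ∈ B, ∀ h ∈ H, b'⁻¹ * b * h ≠ 1 → b'⁻¹ * b * h ∈ D)
    (hcard : 2 * H.card + 2 * (H.card * D.card) < 2 ^ m)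
    (hC : ∀ u ∈ C, ∀ d ∈ (B⁻¹ * B) * (B⁻¹ * B), d • u ∈ C → d = 1)
    (hV' : ∀ x ∈ V', ∀ z ∈ B * B⁻¹, z • x ∈ V' → z = 1)
    (hV : ∀ u : X, ∃ Q ⊆ B, 9 * m + 2 ≤ Q.card ∧ ∀ q ∈ Q, q • u ∈ V) :
    ∃ A' : Set X, MeasurableSet A' ∧ (∀ x ∉ V, (x ∈ A' ↔ x ∈ A)) ∧
      ∀ u ∈ C, ∀ h ∈ H, ∃ b ∈ B, b • u ∉ V' ∧ b • h • u ∉ V' ∧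
        ¬ (b • u ∈ A' ↔ b • h • u ∈ A') := by
  let good : Γ → X → Γ → Prop := fun h u b => b • u ∈ V ∧ b • u ∉ V' ∧ b • h • u ∉ V'
  let own : Γ → X → Γ → Prop := fun h u b => good h u b ∧ b • h • u ∈ V ∧ b * h ∈ B
  let fixd : Γ → X → Γ → Prop := fun h u b =>
    good h u b ∧ (b • h • u ∉ V ∨ ∀ b' ∈ B, b'⁻¹ • b • h • u ∉ C)
  let oth : Γ → Γ → X → Γ → Prop := fun d h u b =>
    good h u b ∧ b • h • u ∈ V ∧ b * h * d⁻¹ ∈ B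
  have hsm : ∀ {S : Set X} (g : Γ), MeasurableSet S → MeasurableSet {x | g • x ∈ S} :=
    fun g hS => measurable_const_smul g hS
  have hsm2 : ∀ {S : Set X} (g h : Γ), MeasurableSet S → MeasurableSet {x | g • h • x ∈ S} :=
    fun g h hS => hsm h (hsm g hS)
  have hgood : ∀ h b, MeasurableSet {x | good h x b} := fun h b =>
    (hsm b hVm).inter ((hsm b hV'm).compl.inter (hsm2 b h hV'm).compl)
  have hown : ∀ h b, MeasurableSet {x | own h x b} := fun h b =>
    (hgood h b).inter ((hsm2 b h hVm).inter (MeasurableSet.const _))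
  have hfixd : ∀ h b, MeasurableSet {x | fixd h x b} := fun h b =>
    (hgood h b).inter ((hsm2 b h hVm).compl.union
      (measurableSet_forall_mem_finset B fun b' => (hsm2 b h (hsm b'⁻¹ hCm)).compl))
  have hoth : ∀ d h b, MeasurableSet {x | oth d h x b} := fun d h b =>
    (hgood h b).inter ((hsm2 b h hVm).inter (MeasurableSet.const _))
  let U : X → Finset Γ → Prop := fun u p =>
    (∃ h ∈ H, 3 * m ≤ (B.filter (own h u)).card ∧
      ∀ b ∈ B, own h u b → (b ∈ p ↔ b * h ∈ p)) ∨
    ∃ h ∈ H, 3 * m ≤ (B.filter (fixd h u)).card ∧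
      ∀ b ∈ B, fixd h u b → (b ∈ p ↔ b • h • u ∈ A)
  let E : Γ → X → Finset Γ → Finset Γ → Prop := fun d u p q =>
    ∃ h ∈ H, 3 * m ≤ (B.filter (oth d h u)).card ∧
      ∀ b ∈ B, oth d h u b → (b ∈ p ↔ b * h * d⁻¹ ∈ q)
  have hU : ∀ p, MeasurableSet {x | U x p} := fun p => by
    refine MeasurableSet.union (measurableSet_exists_mem_finset H fun h => ?_)
      (measurableSet_exists_mem_finset H fun h => ?_)
    · exact measurableSet_setOf_and (measurableSet_le_card_filter B _ (hown h))
        (measurableSet_forall_mem_finset B fun b =>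
          measurableSet_setOf_imp (hown h b) (MeasurableSet.const _))
    · refine measurableSet_setOf_and (measurableSet_le_card_filter B _ (hfixd h))
        (measurableSet_forall_mem_finset B fun b => measurableSet_setOf_imp (hfixd h b) ?_)
      by_cases hb : b ∈ p
      · simpa [hb] using hsm2 b h hA
      · simp only [hb, false_iff]
        exact (hsm2 b h hA).compl
  have hE : ∀ d p q, MeasurableSet {x | E d x p q} := fun d p q =>
    measurableSet_exists_mem_finset H fun h =>
      measurableSet_setOf_and (measurableSet_le_card_filter B _ (hoth d h))
        (measurableSet_forall_mem_finset B fun b =>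
          measurableSet_setOf_imp (hoth d h b) (MeasurableSet.const _))
  obtain ⟨g, hg, hgs⟩ := exists_measurable_assignment (P := Finset Γ) hfree hD hDinv U E hU hE <| by
    intro u σ
    obtain ⟨p, h1, h2, h3⟩ := exists_pattern (B := B) hH hcard
      (fun h => B.filter (own h u)) (fun h => B.filter (fixd h u))
      (fun d h => B.filter (oth d h u)) (fun d h => B.filter (oth d⁻¹ h (d • u)))
      (fun h b => b • h • u ∈ A) σ
      (fun h b hb => (Finset.mem_filter.1 hb).1) (fun h => Finset.filter_subset _ _)
      (fun d h => Finset.filter_subset _ _)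
      (fun d h b hb => by simpa using (Finset.mem_filter.1 hb).2.2.2)
    simp only [Finset.mem_filter, and_imp] at h1 h2 h3
    refine ⟨p, ?_, fun d hd => ⟨?_, ?_⟩⟩
    · rintro (⟨h, hh, hc⟩ | ⟨h, hh, hc⟩)
      · exact h1 h hh hc
      · exact h2 h hh hc
    · rintro ⟨h, hh, hc⟩
      exact (h3 d hd h hh).1 hc
    · rintro ⟨h, hh, hc⟩
      simp only [inv_inv] at hc
      exact (h3 d hd h hh).2 hc
  let block : X → Prop := fun x => x ∈ V ∧ ∃ b ∈ B, b⁻¹ • x ∈ C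
  have huniq : ∀ b ∈ B, ∀ b' ∈ B, ∀ x, b⁻¹ • x ∈ C → b'⁻¹ • x ∈ C → b = b' := by
    intro b hb b' hb' x hx hx'
    have hmem : b'⁻¹ * b ∈ (B⁻¹ * B) * (B⁻¹ * B) := by
      have h1 : b'⁻¹ * b ∈ B⁻¹ * B := Finset.mul_mem_mul (Finset.inv_mem_inv hb') hb
      have h2 : b⁻¹ * b ∈ B⁻¹ * B := Finset.mul_mem_mul (Finset.inv_mem_inv hb) hb
      simpa using Finset.mul_mem_mul h1 h2
    have := hC _ hx _ hmem (by rw [mul_smul, smul_inv_smul]; exact hx')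
    exact (inv_mul_eq_one.1 this).symm
  let A' : Set X := {x | (x ∈ V ∧ ∃ b ∈ B, b⁻¹ • x ∈ C ∧ b ∈ g (b⁻¹ • x)) ∨
    ((x ∉ V ∨ ∀ b ∈ B, b⁻¹ • x ∉ C) ∧ x ∈ A)}
  have hblock : ∀ u ∈ C, ∀ b ∈ B, b • u ∈ V → (b • u ∈ A' ↔ b ∈ g u) := by
    intro u hu b hb hbV
    constructor
    · rintro (⟨_, b', hb', hC', hg'⟩ | ⟨h | h, _⟩)
      · obtain rfl := huniq b' hb' b hb _ hC' (by rwa [inv_smul_smul])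
        rwa [inv_smul_smul] at hg'
      · exact absurd hbV h
      · exact absurd (by rwa [inv_smul_smul]) (h b hb)
    · intro hbg
      exact Or.inl ⟨hbV, b, hb, by rwa [inv_smul_smul], by rwa [inv_smul_smul]⟩
  have hout : ∀ x, (x ∉ V ∨ ∀ b ∈ B, b⁻¹ • x ∉ C) → (x ∈ A' ↔ x ∈ A) := by
    intro x hx
    constructor
    · rintro (⟨hxV, b, hb, hbC, _⟩ | ⟨_, h⟩)
      · rcases hx with hx | hx
        · exact absurd hxV hx
        · exact absurd hbC (hx b hb)
      · exact h
    · exact fun h => Or.inr ⟨hx, h⟩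
  have hgmem : ∀ b, MeasurableSet {x | b ∈ g x} := fun b => by
    have : {x | b ∈ g x} = ⋃ p : Finset Γ, ⋃ (_ : b ∈ p), {x | g x = p} := by ext; simp
    rw [this]
    exact MeasurableSet.iUnion fun p => MeasurableSet.iUnion fun _ => hg p
  refine ⟨A', ?_, fun x hx => hout x (Or.inl hx), fun u hu h hh => ?_⟩
  · refine (hVm.inter (measurableSet_exists_mem_finset B fun b => ?_)).union
      ((hVm.compl.union (measurableSet_forall_mem_finset B fun b => ?_)).inter hA)
    · exact (hsm b⁻¹ hCm).inter (hsm b⁻¹ (hgmem b))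
    · exact (hsm b⁻¹ hCm).compl
  by_contra! hcon
  have hgoodA : ∀ b ∈ B, good h u b → (b ∈ g u ↔ b • h • u ∈ A') := by
    intro b hb hbg
    rw [← hblock u hu b hb hbg.1]
    exact hcon b hb hbg.2.1 hbg.2.2
  have hQ : 9 * m ≤ (B.filter (good h u)).card := le_card_filter_avoiding hV' h (hV u)
  have hownlt : (B.filter (own h u)).card < 3 * m := by
    by_contra! hle
    refine (hgs u).1 (Or.inl ⟨h, hh, hle, fun b hb hbo => ?_⟩)
    rw [hgoodA b hb hbo.1, ← mul_smul, hblock u hu _ hbo.2.2]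
    rw [mul_smul]
    exact hbo.2.1
  have hfixlt : (B.filter (fixd h u)).card < 3 * m := by
    by_contra! hle
    refine (hgs u).1 (Or.inr ⟨h, hh, hle, fun b hb hbo => ?_⟩)
    rw [hgoodA b hb hbo.1, hout _ hbo.2]
  have hothlt : ∀ d ∈ D, d • u ∈ C → (B.filter (oth d h u)).card < 3 * m := by
    intro d hd hdC
    by_contra! hle
    refine (hgs u).2 d hd ⟨h, hh, hle, fun b hb hbo => ?_⟩
    have heq : b • h • u = (b * h * d⁻¹) • d • u := by
      simp only [← mul_smul]
      simp
    rw [hgoodA b hb hbo.1, heq, hblock _ hdC _ hbo.2.2]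
    rw [← heq]
    exact hbo.2.1
  let rest := B.filter fun b => good h u b ∧ ¬ own h u b ∧ ¬ fixd h u b
  have hrest : ∀ b ∈ rest, b • h • u ∈ V ∧ ∃ b' ∈ B, b'⁻¹ * b * h ≠ 1 ∧
      (b'⁻¹ * b * h) • u ∈ C := by
    intro b hb
    obtain ⟨hbB, hbg, hno, hnf⟩ := Finset.mem_filter.1 hb
    have hnf' : ¬ (b • h • u ∉ V ∨ ∀ b' ∈ B, b'⁻¹ • b • h • u ∉ C) := fun hc => hnf ⟨hbg, hc⟩
    push Not at hnf'
    obtain ⟨hbV, b', hb', hb'C⟩ := hnf'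
    refine ⟨hbV, b', hb', fun h1 => ?_, ?_⟩
    · refine hno ⟨hbg, hbV, ?_⟩
      rw [mul_assoc, inv_mul_eq_one] at h1
      rwa [← h1]
    · rwa [mul_smul, mul_smul]
  have hcov : B.filter (good h u) ⊆
      B.filter (own h u) ∪ (B.filter (fixd h u) ∪ rest) := by
    intro b hb
    obtain ⟨hbB, hbg⟩ := Finset.mem_filter.1 hb
    simp only [rest, Finset.mem_union, Finset.mem_filter, hbB, hbg, true_and]
    tauto
  have hrestge : 3 * m < rest.card := by
    have h1 := Finset.card_le_card hcov
    have h2 := Finset.card_union_le (B.filter (own h u)) (B.filter (fixd h u) ∪ rest)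
    have h3 := Finset.card_union_le (B.filter (fixd h u)) rest
    omega
  obtain ⟨b₀, hb₀⟩ := Finset.card_pos.1 (by omega : 0 < rest.card)
  obtain ⟨-, c₀, hc₀, hne, hc₀C⟩ := hrest b₀ hb₀
  have hdD := hDH b₀ (Finset.mem_filter.1 hb₀).1 c₀ hc₀ h hh hne
  have hsub : rest ⊆ B.filter (oth (c₀⁻¹ * b₀ * h) h u) := by
    intro b hb
    obtain ⟨hbV, c, hc, -, hcC⟩ := hrest b hb
    obtain ⟨hbB, hbg, -, -⟩ := Finset.mem_filter.1 hb
    have hb₀B := (Finset.mem_filter.1 hb₀).1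
    refine Finset.mem_filter.2 ⟨hbB, hbg, hbV, ?_⟩
    have hmem : (c⁻¹ * b) * (b₀⁻¹ * c₀) ∈ (B⁻¹ * B) * (B⁻¹ * B) :=
      Finset.mul_mem_mul (Finset.mul_mem_mul (Finset.inv_mem_inv hc) hbB)
        (Finset.mul_mem_mul (Finset.inv_mem_inv hb₀B) hc₀)
    have h1 := hC _ hc₀C _ hmem (by
      rw [← mul_smul]
      convert hcC using 2
      group)
    have h2 : b * h * (c₀⁻¹ * b₀ * h)⁻¹ = c * ((c⁻¹ * b) * (b₀⁻¹ * c₀)) := by group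
    rw [h2, h1, mul_one]
    exact hc
  have h1 := hothlt _ hdD hc₀C
  have h2 := Finset.card_le_card hsub
  omega

lemma exists_step [Group Γ] [Countable Γ] [Infinite Γ] (T : Finset Γ) {γ : Γ} (hγ : γ ≠ 1) :
    ∃ F T' : Finset Γ, ∀ (X : Type) [MeasurableSpace X] [MulAction Γ X] [TopologicalSpace X]
      [T1Space X] [SecondCountableTopology X] [OpensMeasurableSpace X] [MeasurableConstSMul Γ X],
      (∀ (γ : Γ) (x : X), γ • x = x → γ = 1) →
      ∀ A V : Set X, MeasurableSet A → MeasurableSet V → (∀ x : X, ∃ t ∈ T, t • x ∈ V) →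
      ∃ A' V' : Set X, MeasurableSet A' ∧ MeasurableSet V' ∧ V' ⊆ V ∧
        (∀ x ∉ V, (x ∈ A' ↔ x ∈ A)) ∧ (∀ x : X, ∃ t ∈ T', t • x ∈ V') ∧
        ∀ x : X, ∃ δ ∈ F, δ • x ∉ V' ∧ δ • γ • x ∉ V' ∧ ¬ (δ • x ∈ A' ↔ δ • γ • x ∈ A') := by
  classical
  obtain ⟨m, hlt⟩ := exists_poly_lt_two_pow T.card
  obtain ⟨B, hBcard, hB⟩ := exists_finset_card_inter_ge T (9 * m + 2)
  let M := B⁻¹ * B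
  let R := M * M
  let H := R.image fun r => r * γ * r⁻¹
  let G := M * H
  let D := (G ∪ G⁻¹).erase 1
  let Z := B * B⁻¹
  have hMinv : M⁻¹ = M := by simp [M]
  have hRinv : R⁻¹ = R := by simp [R, hMinv]
  have hZinv : Z⁻¹ = Z := by simp [Z]
  have hGinv : (G ∪ G⁻¹)⁻¹ = G ∪ G⁻¹ := by
    ext x
    simp [or_comm]
  have herase : ∀ S : Finset Γ, S⁻¹ = S → ∀ d ∈ S.erase 1, d⁻¹ ∈ S.erase 1 := by
    intro S hS d hd
    rw [Finset.mem_erase] at hd ⊢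
    exact ⟨inv_ne_one.2 hd.1, hS ▸ Finset.inv_mem_inv hd.2⟩
  have hH : 1 ∉ H := by
    intro h
    obtain ⟨r, -, hr⟩ := Finset.mem_image.1 h
    exact hγ (by simpa using hr)
  have hcard : 2 * H.card + 2 * (H.card * D.card) < 2 ^ m := by
    set N := B.card with hN
    have h1 : M.card ≤ N ^ 2 := by
      calc M.card ≤ B⁻¹.card * B.card := Finset.card_mul_le
        _ = N ^ 2 := by rw [Finset.card_inv]; ring
    have h2 : H.card ≤ N ^ 4 := by
      calc H.card ≤ R.card := Finset.card_image_le
        _ ≤ M.card * M.card := Finset.card_mul_le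
        _ ≤ N ^ 2 * N ^ 2 := Nat.mul_le_mul h1 h1
        _ = N ^ 4 := by ring
    have h3 : G.card ≤ N ^ 6 := by
      calc G.card ≤ M.card * H.card := Finset.card_mul_le
        _ ≤ N ^ 2 * N ^ 4 := Nat.mul_le_mul h1 h2
        _ = N ^ 6 := by ring
    have h4 : D.card ≤ 2 * N ^ 6 := by
      calc D.card ≤ (G ∪ G⁻¹).card := Finset.card_erase_le
        _ ≤ G.card + G⁻¹.card := Finset.card_union_le _ _
        _ ≤ 2 * N ^ 6 := by rw [Finset.card_inv]; omega
    have h5 : N ^ 4 ≤ N ^ 10 := by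
      rcases Nat.eq_zero_or_pos N with h0 | h0
      · simp [h0]
      · exact Nat.pow_le_pow_right h0 (by norm_num)
    calc 2 * H.card + 2 * (H.card * D.card) ≤ 2 * N ^ 4 + 2 * (N ^ 4 * (2 * N ^ 6)) := by gcongr
      _ = 2 * N ^ 4 + 4 * N ^ 10 := by ring
      _ ≤ 6 * N ^ 10 := by omega
      _ ≤ 6 * (T.card * (9 * m + 2)) ^ 10 := by gcongr
      _ < 2 ^ m := hlt
  refine ⟨B * R, insert 1 Z * T, ?_⟩
  intro X _ _ _ _ _ _ _ hfree A V hA hV hsynd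
  obtain ⟨V', hV'V, hV'm, hV'ind, hV'max⟩ := exists_maximal_independent hfree
    (Finset.notMem_erase 1 Z) (herase Z hZinv) hV
  obtain ⟨C, -, hCm, hCind, hCmax⟩ := exists_maximal_independent hfree
    (Finset.notMem_erase 1 R) (herase R hRinv) (MeasurableSet.univ (α := X))
  obtain ⟨A', hA', hA'A, hdist⟩ := exists_recoloring hfree hA hV hV'm hCm hH
    (Finset.notMem_erase 1 (G ∪ G⁻¹)) (herase _ hGinv)
    (fun b hb b' hb' h hh hne => Finset.mem_erase.2 ⟨hne, Finset.mem_union_left _ <|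
      Finset.mul_mem_mul (Finset.mul_mem_mul (Finset.inv_mem_inv hb') hb) hh⟩) hcard
    (fun u hu d hd hdu => by
      by_contra hne
      exact hCind u hu d (Finset.mem_erase.2 ⟨hne, hd⟩) hdu)
    (fun u hu d hd hdu => by
      by_contra hne
      exact hV'ind u hu d (Finset.mem_erase.2 ⟨hne, hd⟩) hdu)
    (fun u => hB {g : Γ | g • u ∈ V} fun g => by
      obtain ⟨t, ht, htV⟩ := hsynd (g • u)
      exact ⟨t, ht, by simpa [mul_smul] using htV⟩)
  refine ⟨A', V', hA', hV'm, hV'V, hA'A, fun x => ?_, fun x => ?_⟩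
  · obtain ⟨t, ht, htV⟩ := hsynd x
    rcases hV'max _ htV with h | ⟨d, hd, h⟩
    · exact ⟨1 * t, Finset.mul_mem_mul (Finset.mem_insert_self _ _) ht, by rwa [one_mul]⟩
    · exact ⟨d * t, Finset.mul_mem_mul (Finset.mem_insert_of_mem (Finset.mem_of_mem_erase hd)) ht,
        by rwa [mul_smul]⟩
  · have hr : ∃ r ∈ R, r • x ∈ C := by
      rcases hCmax x (Set.mem_univ x) with h | ⟨d, hd, h⟩
      · obtain ⟨b, hb, hcb, -⟩ := hB Set.univ fun g => by
          obtain ⟨t, ht, -⟩ := hsynd x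
          exact ⟨t, ht, trivial⟩
        obtain ⟨c, hc⟩ := Finset.card_pos.1 (by omega : 0 < b.card)
        have h1 : (1 : Γ) ∈ M := by
          simpa [M] using Finset.mul_mem_mul (Finset.inv_mem_inv (hb hc)) (hb hc)
        exact ⟨1, by simpa [R] using Finset.mul_mem_mul h1 h1, by rwa [one_smul]⟩
      · exact ⟨d, Finset.mem_of_mem_erase hd, h⟩
    obtain ⟨r, hr, hrC⟩ := hr
    obtain ⟨b, hb, h1, h2, h3⟩ := hdist _ hrC _
      (Finset.mem_image_of_mem (fun r => r * γ * r⁻¹) hr)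
    have he : b • (r * γ * r⁻¹) • r • x = (b * r) • γ • x := by
      simp only [← mul_smul]
      congr 1
      group
    rw [he] at h2 h3
    rw [← mul_smul] at h1 h3
    exact ⟨b * r, Finset.mul_mem_mul hb hr, h1, h2, h3⟩

end Step

section Iteration

/-- Every free Borel action of `Γ` has a Borel set `A` that tells `x` apart from `γ • x`, `γ ≠ 1`,
within a finite window `F γ` that depends on `Γ` only. -/
lemma exists_uniformly_separating_set (Γ : Type) [Group Γ] [Countable Γ] [Infinite Γ] :
    ∃ F : Γ → Finset Γ, ∀ (X : Type) [MeasurableSpace X] [MulAction Γ X] [TopologicalSpace X]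
      [T1Space X] [SecondCountableTopology X] [OpensMeasurableSpace X] [MeasurableConstSMul Γ X],
      (∀ (γ : Γ) (x : X), γ • x = x → γ = 1) →
      ∃ A : Set X, MeasurableSet A ∧
        ∀ γ : Γ, γ ≠ 1 → ∀ x : X, ∃ δ ∈ F γ, ¬ (δ • x ∈ A ↔ δ • γ • x ∈ A) := by
  have step : ∀ (T : Finset Γ) (γ : Γ), ∃ F T' : Finset Γ, ∀ (X : Type) [MeasurableSpace X]
      [MulAction Γ X] [TopologicalSpace X] [T1Space X] [SecondCountableTopology X]
      [OpensMeasurableSpace X] [MeasurableConstSMul Γ X],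
      (∀ (γ : Γ) (x : X), γ • x = x → γ = 1) →
      ∀ A V : Set X, MeasurableSet A → MeasurableSet V → (∀ x : X, ∃ t ∈ T, t • x ∈ V) →
      ∃ A' V' : Set X, MeasurableSet A' ∧ MeasurableSet V' ∧ V' ⊆ V ∧
        (∀ x ∉ V, (x ∈ A' ↔ x ∈ A)) ∧ (∀ x : X, ∃ t ∈ T', t • x ∈ V') ∧
        (γ ≠ 1 → ∀ x : X, ∃ δ ∈ F, δ • x ∉ V' ∧ δ • γ • x ∉ V' ∧
          ¬ (δ • x ∈ A' ↔ δ • γ • x ∈ A')) := by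
    intro T γ
    by_cases hγ : γ = 1
    · exact ⟨∅, T, fun X _ _ _ _ _ _ _ _ A V hA hV hT =>
        ⟨A, V, hA, hV, subset_rfl, fun _ _ => Iff.rfl, hT, fun h => absurd hγ h⟩⟩
    · obtain ⟨F, T', h⟩ := exists_step T hγ
      refine ⟨F, T', fun X _ _ _ _ _ _ _ hfree A V hA hV hT => ?_⟩
      obtain ⟨A', V', h1, h2, h3, h4, h5, h6⟩ := h X hfree A V hA hV hT
      exact ⟨A', V', h1, h2, h3, h4, h5, fun _ => h6⟩
  choose F₀ T₀ hstep using step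
  obtain ⟨e, he⟩ := exists_surjective_nat Γ
  choose i hi using he
  let T : ℕ → Finset Γ := fun n => Nat.rec {1} (fun n S => T₀ S (e n)) n
  refine ⟨fun γ => F₀ (T (i γ)) γ, fun X _ _ _ _ _ _ _ hfree => ?_⟩
  let St : ℕ → Type := fun n =>
    {p : Set X × Set X // MeasurableSet p.1 ∧ MeasurableSet p.2 ∧ ∀ x : X, ∃ t ∈ T n, t • x ∈ p.2}
  have hnext : ∀ n (p : St n), ∃ q : St (n + 1), q.1.2 ⊆ p.1.2 ∧
      (∀ x ∉ p.1.2, (x ∈ q.1.1 ↔ x ∈ p.1.1)) ∧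
      (e n ≠ 1 → ∀ x : X, ∃ δ ∈ F₀ (T n) (e n), δ • x ∉ q.1.2 ∧ δ • e n • x ∉ q.1.2 ∧
        ¬ (δ • x ∈ q.1.1 ↔ δ • e n • x ∈ q.1.1)) := by
    intro n p
    obtain ⟨A', V', h1, h2, h3, h4, h5, h6⟩ :=
      hstep (T n) (e n) X hfree p.1.1 p.1.2 p.2.1 p.2.2.1 p.2.2.2
    exact ⟨⟨(A', V'), h1, h2, h5⟩, h3, h4, h6⟩
  choose next hnextV hnextA hnextS using hnext
  let s : ∀ n, St n := fun n => Nat.rec (motive := St)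
    ⟨(∅, Set.univ), MeasurableSet.empty, MeasurableSet.univ,
      fun x => ⟨1, Finset.mem_singleton_self 1, trivial⟩⟩ next n
  have hV : Antitone fun n => (s n).1.2 := antitone_nat_of_succ_le fun n => hnextV n (s n)
  have hA : ∀ n k x, x ∉ (s n).1.2 → (x ∈ (s (n + k)).1.1 ↔ x ∈ (s n).1.1) := by
    intro n k x hx
    induction k with
    | zero => rfl
    | succ k ih =>
      exact (hnextA _ _ x fun h => hx (hV (Nat.le_add_right n k) h)).trans ih
  have hlim : ∀ n x, x ∉ (s n).1.2 →
      (x ∈ {x | ∃ k, x ∉ (s k).1.2 ∧ x ∈ (s k).1.1} ↔ x ∈ (s n).1.1) := by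
    intro n x hx
    refine ⟨?_, fun h => ⟨n, hx, h⟩⟩
    rintro ⟨k, hk, hkA⟩
    rw [← hA n k x hx, add_comm, hA k n x hk]
    exact hkA
  refine ⟨{x | ∃ n, x ∉ (s n).1.2 ∧ x ∈ (s n).1.1}, ?_, fun γ hγ x => ?_⟩
  · have : {x | ∃ n, x ∉ (s n).1.2 ∧ x ∈ (s n).1.1} = ⋃ n, ((s n).1.2ᶜ ∩ (s n).1.1) := by
      ext x
      simp
    rw [this]
    exact MeasurableSet.iUnion fun n => (s n).2.2.1.compl.inter (s n).2.1
  · obtain ⟨δ, hδ, h1, h2, h3⟩ := hnextS (i γ) (s (i γ)) (by rwa [hi]) x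
    simp only [hi] at hδ h1 h2 h3
    refine ⟨δ, hδ, ?_⟩
    rwa [hlim (i γ + 1) _ h1, hlim (i γ + 1) _ h2]

end Iteration

/-- The configurations in which `γ ≠ 1` is witnessed not to fix any translate within `F γ` form a
free subshift. -/
lemma isSubshift_setOf_separated {Γ : Type} [Group Γ] {A : Type*} [TopologicalSpace A]
    [DiscreteTopology A] (F : Γ → Finset Γ) :
    IsSubshift {y : Γ → A | ∀ γ : Γ, γ ≠ 1 → ∀ g : Γ, ∃ δ ∈ F γ, y (δ * g) ≠ y (δ * γ * g)} ∧
      {y : Γ → A | ∀ γ : Γ, γ ≠ 1 → ∀ g : Γ, ∃ δ ∈ F γ, y (δ * g) ≠ y (δ * γ * g)} ⊆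
        freePart Γ A := by
  refine ⟨⟨?_, fun γ x hx γ' hγ' g => ?_⟩, fun x hx γ hγ => ?_⟩
  · have : {y : Γ → A | ∀ γ : Γ, γ ≠ 1 → ∀ g : Γ, ∃ δ ∈ F γ, y (δ * g) ≠ y (δ * γ * g)} =
        ⋂ γ : Γ, ⋂ (_ : γ ≠ 1), ⋂ g : Γ, ⋃ δ ∈ F γ, {y | y (δ * g) ≠ y (δ * γ * g)} := by
      ext y
      simp
    rw [this]
    refine isClosed_iInter fun γ => isClosed_iInter fun _ => isClosed_iInter fun g =>
      (F γ).finite_toSet.isClosed_biUnion fun δ _ => ?_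
    have hcont : Continuous fun y : Γ → A => (y (δ * g), y (δ * γ * g)) := by fun_prop
    exact (isClosed_discrete {p : A × A | p.1 ≠ p.2}).preimage hcont
  · simpa only [shiftAct, mul_assoc] using hx γ' hγ' (g * γ)
  · by_contra hne
    obtain ⟨δ, -, h⟩ := hx γ hne 1
    rw [mul_one, mul_one] at h
    exact h (congrFun hγ δ).symm

/-- Seward–Tucker-Drob.  There exists a free subshift `S ⊂ 2^Γ`
such that every free Borel action `Γ ↷ X` on a Polish space admits a Borel
`Γ`-equivariant map `X → S`. -/
theorem stmt16 {Γ : Type} [Group Γ] [Countable Γ] [Infinite Γ] :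
    ∃ S : Set (Γ → Fin 2), IsSubshift S ∧ S ⊆ freePart Γ (Fin 2) ∧
      (∀ (X : Type) [TopologicalSpace X] [PolishSpace X] [MeasurableSpace X] [BorelSpace X]
        (a : Γ → X → X),
        (∀ x, a 1 x = x) →
        (∀ γ δ : Γ, ∀ x, a (γ * δ) x = a γ (a δ x)) →
        (∀ γ : Γ, Measurable (a γ)) →
        (∀ (γ : Γ) (x : X), a γ x = x → γ = 1) →
        ∃ f : X → (Γ → Fin 2), Measurable f ∧ (∀ x, f x ∈ S) ∧
          ∀ (γ : Γ) (x : X), f (a γ x) = shiftAct γ (f x)) := by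
  obtain ⟨F, hF⟩ := exists_uniformly_separating_set Γ
  obtain ⟨hS, hfreeS⟩ := isSubshift_setOf_separated (A := Fin 2) F
  refine ⟨_, hS, hfreeS, fun X _ _ _ _ a hone hmul hmeas hfree => ?_⟩
  let _ : MulAction Γ X := { smul := a, one_smul := hone, mul_smul := hmul }
  have _ : MeasurableConstSMul Γ X := ⟨hmeas⟩
  obtain ⟨A, hA, hsep⟩ := hF X hfree
  classical
  refine ⟨fun x δ => if a δ x ∈ A then 1 else 0, ?_, fun x γ hγ g => ?_, fun γ x => ?_⟩
  · exact measurable_pi_iff.2 fun δ =>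
      Measurable.ite (hmeas δ hA) measurable_const measurable_const
  · obtain ⟨δ, hδ, h⟩ := hsep γ hγ (a g x)
    refine ⟨δ, hδ, fun heq => h ?_⟩
    change a δ (a g x) ∈ A ↔ a δ (a γ (a g x)) ∈ A
    rw [← hmul, ← hmul, ← hmul]
    by_cases h1 : a (δ * g) x ∈ A <;> by_cases h2 : a (δ * γ * g) x ∈ A <;> simp_all
  · funext δ
    simp only [shiftAct, hmul]
end
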